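/- Let n ≥ 18 be fixed and let c satisfy 2 + 2√(1 − 1/n²) < c < (n−1)²/(4n). Then for any unitarily invariant sequence (X_d)_{d≥1} of random positive semidefinite matrices X_d ∈ M_n(ℂ) ⊗ M_d(ℂ) converging strongly to the Marčenko–Pastur distribution MP_c, almost surely, for all sufficiently large d, X_d ∈ PPT_{n,d} and X_d ∉ SEP_{n,d} (X_d is PPT and entangled). -/

import Mathlib

open MeasureTheory Filter Topology Polynomial Matrix Kronecker
open scoped ComplexOrder

noncomputable section

/-- Measurable space structure on matrices (entrywise). -/
instance matMS (m n : Type*) : MeasurableSpace (Matrix m n ℂ) :=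
  inferInstanceAs (MeasurableSpace (m → n → ℂ))

/-- The ℓ²→ℓ² operator norm of a complex square matrix. -/
def opNorm {N : Type*} [Fintype N] [DecidableEq N] (X : Matrix N N ℂ) : ℝ :=
  ‖Matrix.toEuclideanCLM (𝕜 := ℂ) (n := N) X‖

/-- Application of a real polynomial to a complex square matrix. -/
def polyApply {N : Type*} [Fintype N] [DecidableEq N] (P : Polynomial ℝ)
    (X : Matrix N N ℂ) : Matrix N N ℂ :=
  Polynomial.aeval X (P.map (algebraMap ℝ ℂ))

/-- The (topological) support of a measure on ℝ: points all of whose open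
neighbourhoods have positive measure. -/
def msupport (μ : Measure ℝ) : Set ℝ :=
  {x | ∀ U : Set ℝ, IsOpen U → x ∈ U → 0 < μ U}

/-- Strong convergence of a sequence of random matrices `X d ∈ M_n(ℂ) ⊗ M_d(ℂ)`
towards a compactly supported probability measure `μ`: almost surely, for every
real polynomial `P`, the normalized traces of `P(X d)` converge to `∫ P dμ` and the
operator norms of `P(X d)` converge to `sup {|P(x)| : x ∈ supp μ}`. -/
def StrongConv {Ω : Type*} [MeasurableSpace Ω] (ℙ : Measure Ω) (n : ℕ)
    (X : (d : ℕ) → Ω → Matrix (Fin n × Fin d) (Fin n × Fin d) ℂ)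
    (μ : Measure ℝ) : Prop :=
  ∀ᵐ ω ∂ℙ, ∀ P : Polynomial ℝ,
    Tendsto (fun d : ℕ => ((n : ℂ) * (d : ℂ))⁻¹ * (polyApply P (X d ω)).trace) atTop
      (𝓝 ((∫ x, P.eval x ∂μ : ℝ) : ℂ)) ∧
    Tendsto (fun d : ℕ => opNorm (polyApply P (X d ω))) atTop
      (𝓝 (sSup ((fun x => |P.eval x|) '' msupport μ)))

/-- Unitary invariance of a sequence of random matrices: for every `d` and every
unitary `U`, the random matrix `U (X d) U*` has the same distribution as `X d`. -/
def UnitInv {Ω : Type*} [MeasurableSpace Ω] (ℙ : Measure Ω) (n : ℕ)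
    (X : (d : ℕ) → Ω → Matrix (Fin n × Fin d) (Fin n × Fin d) ℂ) : Prop :=
  ∀ d : ℕ, ∀ U : Matrix (Fin n × Fin d) (Fin n × Fin d) ℂ,
    U ∈ unitary (Matrix (Fin n × Fin d) (Fin n × Fin d) ℂ) →
    Measure.map (fun ω => U * X d ω * star U) ℙ = Measure.map (X d) ℙ

/-- The separable cone `SEP_{n,d}`. -/
def SEP (n d : ℕ) : Set (Matrix (Fin n × Fin d) (Fin n × Fin d) ℂ) :=
  {X | ∃ (k : ℕ) (A : Fin k → Matrix (Fin n) (Fin n) ℂ)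
      (B : Fin k → Matrix (Fin d) (Fin d) ℂ),
    (∀ i, (A i).PosSemidef) ∧ (∀ i, (B i).PosSemidef) ∧ X = ∑ i, A i ⊗ₖ B i}

/-- The partial transpose on `M_n(ℂ) ⊗ M_d(ℂ)`: transposition of the first factor. -/
def ptrans {n d : ℕ} (X : Matrix (Fin n × Fin d) (Fin n × Fin d) ℂ) :
    Matrix (Fin n × Fin d) (Fin n × Fin d) ℂ :=
  fun p q => X (q.1, p.2) (p.1, q.2)

/-- The PPT cone `PPT_{n,d}`: positive semidefinite matrices with positive
semidefinite partial transpose. -/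
def PPT (n d : ℕ) : Set (Matrix (Fin n × Fin d) (Fin n × Fin d) ℂ) :=
  {X | X.PosSemidef ∧ (ptrans X).PosSemidef}

/-- The Marčenko–Pastur distribution of parameter `c > 0`:
`max(1−c,0)·δ₀ + (√((b−x)(x−a))/(2πx))·1_{(a,b)}(x) dx`,
with `a = (1−√c)²` and `b = (1+√c)²`. -/
def MP (c : ℝ) : Measure ℝ :=
  ENNReal.ofReal (max (1 - c) 0) • Measure.dirac (0 : ℝ) +
    MeasureTheory.volume.withDensity (fun x => ENNReal.ofReal
      (Set.indicator (Set.Ioo ((1 - Real.sqrt c) ^ 2) ((1 + Real.sqrt c) ^ 2))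
        (fun y => Real.sqrt (((1 + Real.sqrt c) ^ 2 - y) * (y - (1 - Real.sqrt c) ^ 2))
          / (2 * Real.pi * y)) x))

open ProbabilityTheory in
/-- The standard complex Gaussian distribution, normalized by `E|z|² = 1`. -/
def cGauss : Measure ℂ :=
  (Measure.pi (fun _ : Fin 2 => gaussianReal 0 1)).map
    (fun x => (1 / Real.sqrt 2 : ℝ) • ∑ i, x i • Complex.orthonormalBasisOneI i)

instance : IsProbabilityMeasure cGauss := by
  unfold cGauss
  exact Measure.isProbabilityMeasure_map (Measurable.aemeasurable (by fun_prop))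

open ProbabilityTheory in
lemma charFun_cGauss (t : ℂ) : charFun cGauss t = Complex.exp (-‖t‖ ^ 2 / 4 : ℝ) := by
  have h : cGauss = (stdGaussian ℂ).map (fun x => (1 / Real.sqrt 2 : ℝ) • x) := by
    rw [stdGaussian_eq_map_pi_orthonormalBasis Complex.orthonormalBasisOneI,
      Measure.map_map (by fun_prop) (by fun_prop)]
    rfl
  rw [h, charFun_map_smul, charFun_stdGaussian]
  congr 1
  push_cast
  rw [norm_smul, Complex.ofReal_mul, mul_pow, ← Complex.ofReal_pow, Real.norm_eq_abs, sq_abs,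
    div_pow, Real.sq_sqrt (by norm_num)]
  push_cast
  ring

open ProbabilityTheory in
lemma integral_gaussianReal_exp_sq {h : ℝ} (hh : h < 1) :
    Integrable (fun x : ℝ => Real.exp (h * x ^ 2 / 2)) (gaussianReal 0 1) ∧
    ∫ x, Real.exp (h * x ^ 2 / 2) ∂(gaussianReal 0 1) = 1 / Real.sqrt (1 - h) := by
  have key : (fun x : ℝ => gaussianPDFReal 0 1 x • Real.exp (h * x ^ 2 / 2))
      = fun x => (Real.sqrt (2 * Real.pi))⁻¹ * Real.exp (-((1 - h) / 2) * x ^ 2) := by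
    ext x
    simp only [gaussianPDFReal, smul_eq_mul, NNReal.coe_one, mul_one, sub_zero]
    rw [mul_assoc, ← Real.exp_add]
    ring_nf
  constructor
  · rw [gaussianReal_of_var_ne_zero _ one_ne_zero, integrable_withDensity_iff_integrable_smul₀'
      (by fun_prop) (by simp [gaussianPDF])]
    have : (fun x : ℝ => (gaussianPDF 0 1 x).toReal • Real.exp (h * x ^ 2 / 2))
        = fun x => (Real.sqrt (2 * Real.pi))⁻¹ * Real.exp (-((1 - h) / 2) * x ^ 2) := by
      rw [← key]; ext x; rw [toReal_gaussianPDF]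
    rw [this]
    exact (integrable_exp_neg_mul_sq (by linarith)).const_mul _
  · rw [integral_gaussianReal_eq_integral_smul one_ne_zero, key, integral_const_mul,
      integral_gaussian]
    rw [← Real.sqrt_inv, ← Real.sqrt_mul (by positivity), one_div, ← Real.sqrt_inv]
    congr 1
    have : 1 - h ≠ 0 := by linarith
    field_simp

lemma cGauss_exp {h : ℝ} (hh : |h| ≤ 1 / 2) :
    Integrable (fun z : ℂ => Real.exp (h * (‖z‖ ^ 2 - 1))) cGauss ∧
    ∫ z, Real.exp (h * (‖z‖ ^ 2 - 1)) ∂cGauss ≤ Real.exp (h ^ 2) := by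
  have h1 : h < 1 := by linarith [le_abs_self h]
  obtain ⟨hi, he⟩ := integral_gaussianReal_exp_sq h1
  have hfun : ∀ x : Fin 2 → ℝ,
      Real.exp (h * (‖(1 / Real.sqrt 2 : ℝ) • ∑ i, x i • Complex.orthonormalBasisOneI i‖ ^ 2 - 1))
      = Real.exp (-h) * ∏ i, Real.exp (h * (x i) ^ 2 / 2) := by
    intro x
    rw [← Real.exp_sum, ← Real.exp_add]
    congr 1
    rw [norm_smul, mul_pow, Real.norm_eq_abs, sq_abs, div_pow, Real.sq_sqrt (by norm_num)]
    simp only [Fin.sum_univ_two, Complex.coe_orthonormalBasisOneI]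
    simp only [Matrix.cons_val_zero, Matrix.cons_val_one, Complex.real_smul]
    rw [Complex.sq_norm, Complex.normSq_apply]
    simp
    ring
  constructor
  · unfold cGauss
    rw [integrable_map_measure (by fun_prop) (Measurable.aemeasurable (by fun_prop))]
    have : ((fun z : ℂ => Real.exp (h * (‖z‖ ^ 2 - 1))) ∘
      (fun x : Fin 2 → ℝ => (1 / Real.sqrt 2 : ℝ) • ∑ i, x i • Complex.orthonormalBasisOneI i))
      = fun x => Real.exp (-h) * ∏ i, Real.exp (h * (x i) ^ 2 / 2) := by
      ext x; exact hfun x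
    rw [this]
    apply Integrable.const_mul
    exact Integrable.fintype_prod (f := fun _ x => Real.exp (h * x ^ 2 / 2)) (fun _ => hi)
  · unfold cGauss
    rw [integral_map (Measurable.aemeasurable (by fun_prop)) (by fun_prop)]
    simp_rw [hfun]
    rw [integral_const_mul, integral_fintype_prod_eq_prod (f := fun _ x => Real.exp (h * x ^ 2 / 2))]
    simp only [he, Fin.prod_univ_two]
    rw [div_mul_div_comm, Real.mul_self_sqrt (by linarith), one_mul, mul_one_div,
      div_le_iff₀ (by linarith)]
    have h3 : 1 ≤ Real.exp (h + h ^ 2) * (1 - h) := by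
      rcases le_total 0 h with h0 | h0
      · have := Real.quadratic_le_exp_of_nonneg (x := h + h ^ 2) (by positivity)
        have hh' : h ≤ 1 / 2 := le_trans (le_abs_self h) hh
        have h4 : 0 ≤ h ^ 2 * (1 / 2 - h) := mul_nonneg (sq_nonneg h) (by linarith)
        have h5 : 0 ≤ h ^ 4 * (1 / 2 - h) := mul_nonneg (by positivity) (by linarith)
        have h6 : 0 ≤ h ^ 3 * (1 / 2 - h) := mul_nonneg (by positivity) (by linarith)
        nlinarith [mul_le_mul_of_nonneg_right this (by linarith : (0 : ℝ) ≤ 1 - h)]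
      · have := Real.add_one_le_exp (h + h ^ 2)
        have h4 : 0 ≤ (-h) ^ 3 := pow_nonneg (by linarith) 3
        nlinarith [mul_le_mul_of_nonneg_right this (by linarith : (0 : ℝ) ≤ 1 - h)]
    calc Real.exp (-h) = Real.exp (-h) * 1 := (mul_one _).symm
      _ ≤ Real.exp (-h) * (Real.exp (h + h ^ 2) * (1 - h)) := by gcongr
      _ = Real.exp (h ^ 2) * (1 - h) := by rw [← mul_assoc, ← Real.exp_add]; ring_nf

/-- The standard complex Gaussian vector indexed by `J`. -/
def gvec (J : Type*) [Fintype J] : Measure (J → ℂ) := Measure.pi fun _ => cGauss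

instance (J : Type*) [Fintype J] : IsProbabilityMeasure (gvec J) := by
  unfold gvec; infer_instance

/-- The quadratic form `v* C v`. -/
def qf {J : Type*} [Fintype J] (C : Matrix J J ℂ) (v : J → ℂ) : ℂ := star v ⬝ᵥ (C *ᵥ v)

/-- The squared Frobenius norm. -/
def frob2 {I J : Type*} [Fintype I] [Fintype J] (C : Matrix I J ℂ) : ℝ := ∑ i, ∑ j, ‖C i j‖ ^ 2

lemma measurable_mulVec {I J : Type*} [Fintype I] [Fintype J] (A : Matrix I J ℂ) :
    Measurable (fun v : J → ℂ => A *ᵥ v) := by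
  refine measurable_pi_lambda _ fun i => ?_
  simp only [mulVec, dotProduct]
  fun_prop

lemma measurable_qf {J : Type*} [Fintype J] (C : Matrix J J ℂ) : Measurable (qf C) := by
  unfold qf
  simp only [mulVec, dotProduct, Pi.star_apply]
  refine Finset.measurable_sum _ fun i _ => ?_
  refine Measurable.mul ?_ (by fun_prop)
  exact Complex.continuous_conj.measurable.comp (measurable_pi_apply i)

lemma inner_toLp_eq {K : Type*} [Fintype K] (x : K → ℂ) (y : PiLp 2 (fun _ : K => ℂ)) :
    inner ℝ (WithLp.toLp 2 x : PiLp 2 (fun _ : K => ℂ)) y = (star x ⬝ᵥ y.ofLp).re := by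
  rw [PiLp.inner_apply]
  simp only [dotProduct, Complex.re_sum, Complex.inner, Pi.star_apply]
  simp_rw [mul_comm (y.ofLp _)]
  rfl

lemma sum_norm_sq_eq {K : Type*} [Fintype K] (x : K → ℂ) :
    ∑ i, ‖x i‖ ^ 2 = (star x ⬝ᵥ x).re := by
  simp only [dotProduct, Complex.re_sum, Pi.star_apply, Complex.sq_norm, Complex.normSq_apply,
    Complex.mul_re, RCLike.star_def, Complex.conj_re, Complex.conj_im]
  congr 1; ext; ring

lemma gvec_map {I J : Type*} [Fintype I] [Fintype J] [DecidableEq I] (A : Matrix I J ℂ)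
    (hA : A * Aᴴ = 1) : (gvec J).map (fun v => A *ᵥ v) = gvec I := by
  have : IsProbabilityMeasure ((gvec J).map (fun v => A *ᵥ v)) :=
    Measure.isProbabilityMeasure_map (measurable_mulVec A).aemeasurable
  refine charFun_eq_pi_iff.mp fun t => ?_
  have h1 : charFun (((gvec J).map (fun v => A *ᵥ v)).map (WithLp.toLp 2)) t
      = charFun ((gvec J).map (WithLp.toLp 2)) (WithLp.toLp 2 (Aᴴ *ᵥ t.ofLp)) := by
    have hm : Measurable (WithLp.toLp 2 : (I → ℂ) → PiLp 2 (fun _ : I => ℂ)) := by fun_prop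
    have hm' : Measurable (WithLp.toLp 2 : (J → ℂ) → PiLp 2 (fun _ : J => ℂ)) := by fun_prop
    rw [Measure.map_map hm (measurable_mulVec A), charFun_apply, charFun_apply,
      integral_map (hm.comp (measurable_mulVec A)).aemeasurable (by fun_prop),
      integral_map hm'.aemeasurable (by fun_prop)]
    congr 1
    ext v
    congr 3
    simp only [Function.comp]
    rw [inner_toLp_eq, inner_toLp_eq, star_mulVec, ← dotProduct_mulVec]
  rw [h1, gvec, charFun_pi]
  simp_rw [charFun_cGauss, ← Complex.exp_sum, ← Complex.ofReal_sum]
  congr 2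
  simp_rw [← Finset.sum_div, Finset.sum_neg_distrib]
  congr 2
  rw [sum_norm_sq_eq, sum_norm_sq_eq, star_mulVec, ← dotProduct_mulVec, conjTranspose_conjTranspose, mulVec_mulVec, hA,
    one_mulVec]

lemma frob2_eq_trace {I J : Type*} [Fintype I] [Fintype J] (C : Matrix I J ℂ) :
    frob2 C = (C * Cᴴ).trace.re := by
  simp only [frob2, trace, diag_apply, Matrix.mul_apply, conjTranspose_apply, Complex.re_sum,
    Complex.sq_norm, Complex.normSq_apply, Complex.mul_re, RCLike.star_def, Complex.conj_re,
    Complex.conj_im]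
  congr 1; ext; congr 1; ext; ring

lemma frob2_nonneg {I J : Type*} [Fintype I] [Fintype J] (C : Matrix I J ℂ) : 0 ≤ frob2 C := by
  unfold frob2; positivity

lemma qf_spectral {J : Type*} [Fintype J] [DecidableEq J] {H : Matrix J J ℂ}
    (hH : H.IsHermitian) (v : J → ℂ) : qf H v =
    ((∑ i, hH.eigenvalues i *
      ‖(((hH.eigenvectorUnitary : Matrix J J ℂ)ᴴ) *ᵥ v) i‖ ^ 2 : ℝ) : ℂ) := by
  set U : Matrix J J ℂ := (hH.eigenvectorUnitary : Matrix J J ℂ) with hU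
  have hs : H = U * diagonal (fun i => (hH.eigenvalues i : ℂ)) * Uᴴ := by
    conv_lhs => rw [hH.spectral_theorem]
    rfl
  have : qf H v = star (Uᴴ *ᵥ v) ⬝ᵥ (diagonal (fun i => (hH.eigenvalues i : ℂ)) *ᵥ (Uᴴ *ᵥ v)) := by
    conv_lhs => rw [hs]
    rw [qf, star_mulVec, ← dotProduct_mulVec, conjTranspose_conjTranspose, mulVec_mulVec,
      mulVec_mulVec, mul_assoc]
  rw [this]
  simp only [dotProduct, mulVec_diagonal, Pi.star_apply]
  push_cast
  congr 1; ext i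
  rw [← Complex.conj_mul', RCLike.star_def]
  ring

lemma sum_eigenvalues_sq {J : Type*} [Fintype J] [DecidableEq J] {H : Matrix J J ℂ}
    (hH : H.IsHermitian) : ∑ i, hH.eigenvalues i ^ 2 = frob2 H := by
  set U : Matrix J J ℂ := (hH.eigenvectorUnitary : Matrix J J ℂ) with hU
  have hs : H = U * diagonal (fun i => (hH.eigenvalues i : ℂ)) * Uᴴ := by
    conv_lhs => rw [hH.spectral_theorem]
    rfl
  have hUU : Uᴴ * U = 1 := by
    have := (Unitary.mem_iff.mp hH.eigenvectorUnitary.2).1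
    simpa [star_eq_conjTranspose] using this
  rw [frob2_eq_trace, hH.eq]
  have : H * H = U * (diagonal (fun i => (hH.eigenvalues i : ℂ)) *
      diagonal (fun i => (hH.eigenvalues i : ℂ))) * Uᴴ := by
    conv_lhs => rw [hs]
    simp only [mul_assoc]
    rw [← mul_assoc Uᴴ U, hUU, one_mul]
  rw [this, trace_mul_comm, ← mul_assoc, hUU, one_mul, diagonal_mul_diagonal, trace_diagonal,
    Complex.re_sum]
  congr 1; ext i
  rw [← Complex.ofReal_mul, Complex.ofReal_re, sq]

lemma gvec_exp {J : Type*} [Fintype J] [DecidableEq J] {H : Matrix J J ℂ}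
    (hH : H.IsHermitian) (hF : frob2 H ≤ 1 / 4) :
    Integrable (fun v => Real.exp ((qf H v).re - H.trace.re)) (gvec J) ∧
    ∫ v, Real.exp ((qf H v).re - H.trace.re) ∂(gvec J) ≤ Real.exp (frob2 H) := by
  set U : Matrix J J ℂ := (hH.eigenvectorUnitary : Matrix J J ℂ) with hU
  have hUU : Uᴴ * U = 1 := by
    have := (Unitary.mem_iff.mp hH.eigenvectorUnitary.2).1
    simpa [star_eq_conjTranspose] using this
  have hlam : ∀ i, |hH.eigenvalues i| ≤ 1 / 2 := by
    intro i
    have h1 : hH.eigenvalues i ^ 2 ≤ ∑ i, hH.eigenvalues i ^ 2 :=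
      Finset.single_le_sum (f := fun i => hH.eigenvalues i ^ 2) (fun i _ => sq_nonneg _)
        (Finset.mem_univ i)
    rw [sum_eigenvalues_sq hH] at h1
    exact abs_le_of_sq_le_sq (by linarith) (by norm_num)
  have hfun : (fun v => Real.exp ((qf H v).re - H.trace.re)) =
      (fun w : J → ℂ => ∏ i, Real.exp (hH.eigenvalues i * (‖w i‖ ^ 2 - 1))) ∘
        (fun v => Uᴴ *ᵥ v) := by
    ext v
    simp only [Function.comp]
    rw [← Real.exp_sum, qf_spectral hH, Complex.ofReal_re]
    congr 1
    have ht : H.trace.re = ∑ i, hH.eigenvalues i := by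
      rw [hH.trace_eq_sum_eigenvalues]; simp
    rw [ht, ← Finset.sum_sub_distrib]
    congr 1; ext i; rw [mul_sub, mul_one]
  have hmap := gvec_map Uᴴ (by rw [conjTranspose_conjTranspose, hUU])
  have hmeas : Measurable (fun w : J → ℂ => ∏ i, Real.exp (hH.eigenvalues i * (‖w i‖ ^ 2 - 1))) := by
    fun_prop
  constructor
  · rw [hfun, ← integrable_map_measure hmeas.aestronglyMeasurable
      (measurable_mulVec _).aemeasurable, hmap]
    exact Integrable.fintype_prod
      (f := fun i (z : ℂ) => Real.exp (hH.eigenvalues i * (‖z‖ ^ 2 - 1)))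
      (fun i => (cGauss_exp (hlam i)).1)
  · rw [hfun]
    have : ∫ v, ((fun w : J → ℂ => ∏ i, Real.exp (hH.eigenvalues i * (‖w i‖ ^ 2 - 1))) ∘
        (fun v => Uᴴ *ᵥ v)) v ∂(gvec J)
        = ∫ w, ∏ i, Real.exp (hH.eigenvalues i * (‖w i‖ ^ 2 - 1)) ∂(gvec J) := by
      conv_rhs => rw [← hmap]
      rw [integral_map (measurable_mulVec _).aemeasurable hmeas.aestronglyMeasurable]
      rfl
    rw [this, gvec, integral_fintype_prod_eq_prod
      (f := fun i (z : ℂ) => Real.exp (hH.eigenvalues i * (‖z‖ ^ 2 - 1))),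
      ← sum_eigenvalues_sq hH, Real.exp_sum]
    exact Finset.prod_le_prod (fun i _ => integral_nonneg fun _ => (Real.exp_pos _).le)
      (fun i _ => (cGauss_exp (hlam i)).2)

lemma qf_add {J : Type*} [Fintype J] (A B : Matrix J J ℂ) (v : J → ℂ) :
    qf (A + B) v = qf A v + qf B v := by
  simp [qf, add_mulVec, dotProduct_add]

lemma qf_sub {J : Type*} [Fintype J] (A B : Matrix J J ℂ) (v : J → ℂ) :
    qf (A - B) v = qf A v - qf B v := by
  simp [qf, sub_mulVec, dotProduct_sub]

lemma qf_smul {J : Type*} [Fintype J] (a : ℂ) (B : Matrix J J ℂ) (v : J → ℂ) :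
    qf (a • B) v = a * qf B v := by
  simp [qf, smul_mulVec, dotProduct_smul]

lemma qf_conjTranspose {J : Type*} [Fintype J] (A : Matrix J J ℂ) (v : J → ℂ) :
    qf Aᴴ v = star (qf A v) := by
  rw [qf, qf, star_dotProduct, star_mulVec, ← dotProduct_mulVec,
    conjTranspose_conjTranspose]

lemma frob2_smul {I J : Type*} [Fintype I] [Fintype J] (a : ℂ) (C : Matrix I J ℂ) :
    frob2 (a • C) = ‖a‖ ^ 2 * frob2 C := by
  simp only [frob2, Matrix.smul_apply, smul_eq_mul, norm_mul, mul_pow, Finset.mul_sum]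

lemma frob2_conjTranspose {I J : Type*} [Fintype I] [Fintype J] (C : Matrix I J ℂ) :
    frob2 Cᴴ = frob2 C := by
  simp only [frob2, conjTranspose_apply, norm_star]
  rw [Finset.sum_comm]

lemma frob2_add_le {I J : Type*} [Fintype I] [Fintype J] (A B : Matrix I J ℂ) :
    frob2 (A + B) ≤ 2 * frob2 A + 2 * frob2 B := by
  simp only [frob2, Finset.mul_sum, ← Finset.sum_add_distrib, Matrix.add_apply]
  gcongr with i _ j _
  have h1 := norm_add_le (A i j) (B i j)
  nlinarith [sq_nonneg (‖A i j‖ - ‖B i j‖), norm_nonneg (A i j + B i j)]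

lemma gvec_tail_upper {J : Type*} [Fintype J] [DecidableEq J] {H : Matrix J J ℂ}
    (hH : H.IsHermitian) {F θ : ℝ} (hF : 0 < F) (hHF : frob2 H ≤ F ^ 2) :
    (gvec J).real {v | θ ≤ (qf H v).re - H.trace.re} ≤ 2 * Real.exp (-(θ / (2 * F))) := by
  have hF' : (2 * F) ≠ 0 := by positivity
  set a : ℂ := ((1 / (2 * F) : ℝ) : ℂ) with ha
  have hH' : (a • H).IsHermitian := by
    rw [IsHermitian, conjTranspose_smul, hH.eq, ha, RCLike.star_def, Complex.conj_ofReal]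
  have hfr : frob2 (a • H) ≤ 1 / 4 := by
    rw [frob2_smul, ha, Complex.norm_real, Real.norm_eq_abs, sq_abs]
    calc (1 / (2 * F)) ^ 2 * frob2 H ≤ (1 / (2 * F)) ^ 2 * F ^ 2 := by gcongr
      _ = 1 / 4 := by field_simp; norm_num
  obtain ⟨hi, hle⟩ := gvec_exp hH' hfr
  have hval : ∀ v, (qf (a • H) v).re - (a • H).trace.re
      = (1 / (2 * F)) * ((qf H v).re - H.trace.re) := by
    intro v
    rw [qf_smul, trace_smul, ha, smul_eq_mul, Complex.re_ofReal_mul, Complex.re_ofReal_mul]; ring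
  have hm := mul_meas_ge_le_integral_of_nonneg (μ := gvec J)
    (Filter.Eventually.of_forall fun v => (Real.exp_pos _).le) hi (Real.exp (θ / (2 * F)))
  have hset : {v | θ ≤ (qf H v).re - H.trace.re} ⊆
      {v | Real.exp (θ / (2 * F)) ≤ Real.exp ((qf (a • H) v).re - (a • H).trace.re)} := by
    intro v hv
    simp only [Set.mem_ofPred_eq] at hv ⊢
    rw [hval]
    apply Real.exp_le_exp.mpr
    rw [div_eq_mul_one_div, mul_comm]
    gcongr
  have h2 : Real.exp (frob2 (a • H)) ≤ 2 := by
    calc Real.exp (frob2 (a • H)) ≤ Real.exp (1 / 4) := Real.exp_le_exp.mpr hfr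
      _ ≤ 2 := by
        have := Real.exp_one_lt_d9
        have h3 : Real.exp (1 / 4) ^ 4 = Real.exp 1 := by rw [← Real.exp_nat_mul]; norm_num
        by_contra hc
        push Not at hc
        have : (2 : ℝ) ^ 4 < Real.exp (1 / 4) ^ 4 := by gcongr
        linarith
  calc (gvec J).real {v | θ ≤ (qf H v).re - H.trace.re}
      ≤ (gvec J).real {v | Real.exp (θ / (2 * F)) ≤
          Real.exp ((qf (a • H) v).re - (a • H).trace.re)} := measureReal_mono hset
    _ = Real.exp (-(θ / (2 * F))) * (Real.exp (θ / (2 * F)) *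
        (gvec J).real {v | Real.exp (θ / (2 * F)) ≤
          Real.exp ((qf (a • H) v).re - (a • H).trace.re)}) := by
        rw [← mul_assoc, ← Real.exp_add, neg_add_cancel, Real.exp_zero, one_mul]
    _ ≤ Real.exp (-(θ / (2 * F))) * 2 := by gcongr; linarith
    _ = _ := mul_comm _ _

lemma gvec_tail_herm {J : Type*} [Fintype J] [DecidableEq J] {H : Matrix J J ℂ}
    (hH : H.IsHermitian) {F θ : ℝ} (hF : 0 < F) (hHF : frob2 H ≤ F ^ 2) :
    (gvec J).real {v | θ ≤ |(qf H v).re - H.trace.re|} ≤ 4 * Real.exp (-(θ / (2 * F))) := by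
  have h1 := gvec_tail_upper (θ := θ) hH hF hHF
  have h2 := gvec_tail_upper (H := -H) (θ := θ) hH.neg hF (by
    simpa [frob2] using hHF)
  have hset : {v | θ ≤ |(qf H v).re - H.trace.re|} ⊆
      {v | θ ≤ (qf H v).re - H.trace.re} ∪ {v | θ ≤ (qf (-H) v).re - (-H).trace.re} := by
    intro v hv
    simp only [Set.mem_ofPred_eq, Set.mem_union] at hv ⊢
    have : qf (-H) v = - qf H v := by simp [qf, neg_mulVec]
    rw [this, trace_neg, Complex.neg_re, Complex.neg_re]
    rcases le_abs.mp hv with h | h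
    · left; exact h
    · right; linarith
  calc _ ≤ _ := measureReal_mono hset
    _ ≤ _ := measureReal_union_le _ _
    _ ≤ _ := by linarith

/-- Concentration of a general complex quadratic form of a Gaussian vector. -/
lemma gvec_tail {J : Type*} [Fintype J] [DecidableEq J] (C : Matrix J J ℂ)
    {F θ : ℝ} (hF : 0 < F) (hCF : frob2 C ≤ F ^ 2) :
    (gvec J).real {v | θ ≤ ‖qf C v - C.trace‖} ≤ 8 * Real.exp (-(θ / (4 * F))) := by
  set A : Matrix J J ℂ := (1 / 2 : ℂ) • (C + Cᴴ) with hA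
  set B : Matrix J J ℂ := (-Complex.I / 2 : ℂ) • (C + (-1 : ℂ) • Cᴴ) with hB
  have hCAB : C = A + Complex.I • B := by
    rw [hA, hB, smul_smul]
    ext i j
    simp only [Matrix.add_apply, Matrix.smul_apply, smul_eq_mul]
    linear_combination ((1 / 2 : ℂ) * (C i j - Cᴴ i j)) * Complex.I_sq
  have hAh : A.IsHermitian := by
    rw [IsHermitian, hA, conjTranspose_smul, conjTranspose_add, conjTranspose_conjTranspose,
      add_comm]
    simp
  have hBh : B.IsHermitian := by
    rw [IsHermitian, hB, conjTranspose_smul, conjTranspose_add, conjTranspose_smul,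
      conjTranspose_conjTranspose]
    ext i j
    simp
    ring
  have hAF : frob2 A ≤ F ^ 2 := by
    have := frob2_add_le C Cᴴ
    rw [frob2_conjTranspose] at this
    rw [hA, frob2_smul]
    norm_num
    linarith
  have hBF : frob2 B ≤ F ^ 2 := by
    have := frob2_add_le C ((-1 : ℂ) • Cᴴ)
    rw [frob2_smul, frob2_conjTranspose] at this
    rw [hB, frob2_smul]
    norm_num at this ⊢
    linarith
  have h1 := gvec_tail_herm (θ := θ / 2) hAh hF hAF
  have h2 := gvec_tail_herm (θ := θ / 2) hBh hF hBF
  have him : ∀ {M : Matrix J J ℂ} (_ : M.IsHermitian) (v : J → ℂ),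
      qf M v - M.trace = (((qf M v).re - M.trace.re : ℝ) : ℂ) := by
    intro M hM v
    have e1 : (qf M v) = ((qf M v).re : ℂ) := by
      rw [qf_spectral hM, Complex.ofReal_re]
    have e2 : M.trace = (M.trace.re : ℂ) := by
      rw [hM.trace_eq_sum_eigenvalues]; simp
    rw [Complex.ofReal_sub, ← e1, ← e2]
  have hset : {v | θ ≤ ‖qf C v - C.trace‖} ⊆
      {v | θ / 2 ≤ |(qf A v).re - A.trace.re|} ∪ {v | θ / 2 ≤ |(qf B v).re - B.trace.re|} := by
    intro v hv
    simp only [Set.mem_ofPred_eq, Set.mem_union] at hv ⊢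
    by_contra hc
    push Not at hc
    have : qf C v - C.trace = (qf A v - A.trace) + Complex.I * (qf B v - B.trace) := by
      have hq : qf C v = qf A v + Complex.I * qf B v := by rw [← qf_smul, ← qf_add, ← hCAB]
      have ht : C.trace = A.trace + Complex.I * B.trace := by
        rw [← smul_eq_mul, ← trace_smul, ← trace_add, ← hCAB]
      rw [hq, ht]; ring
    rw [this, him hAh, him hBh] at hv
    have := norm_add_le (((qf A v).re - A.trace.re : ℝ) : ℂ)
      (Complex.I * (((qf B v).re - B.trace.re : ℝ) : ℂ))
    rw [norm_mul, Complex.norm_I, one_mul, Complex.norm_real, Complex.norm_real,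
      Real.norm_eq_abs, Real.norm_eq_abs] at this
    linarith
  have e : θ / 2 / (2 * F) = θ / (4 * F) := by ring
  rw [e] at h1 h2
  calc _ ≤ _ := measureReal_mono hset
    _ ≤ _ := measureReal_union_le _ _
    _ ≤ _ := by linarith

lemma gvec_integrable_herm {J : Type*} [Fintype J] [DecidableEq J] {H : Matrix J J ℂ}
    (hH : H.IsHermitian) : Integrable (fun v => (qf H v).re) (gvec J) := by
  obtain ⟨t, ht, htF⟩ : ∃ t : ℝ, 0 < t ∧ t ^ 2 * frob2 H ≤ 1 / 4 := by
    refine ⟨1 / (2 * (frob2 H + 1)), by have := frob2_nonneg H; positivity, ?_⟩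
    have h0 := frob2_nonneg H
    rw [div_pow, one_pow, mul_pow, one_div, inv_mul_le_iff₀ (by positivity)]
    nlinarith
  have hsm : ∀ {s : ℝ}, ((s : ℂ) • H).IsHermitian := by
    intro s
    rw [IsHermitian, conjTranspose_smul, hH.eq, RCLike.star_def, Complex.conj_ofReal]
  have h1 := (gvec_exp (hsm (s := t)) (by
    rwa [frob2_smul, Complex.norm_real, Real.norm_eq_abs, sq_abs])).1
  have h2 := (gvec_exp (hsm (s := -t)) (by
    rw [frob2_smul, Complex.norm_real, Real.norm_eq_abs, sq_abs, neg_sq]; exact htF)).1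
  have hZ : Integrable (fun v => t * ((qf H v).re - H.trace.re)) (gvec J) := by
    refine Integrable.mono' (h1.add h2) ?_ (Filter.Eventually.of_forall fun v => ?_)
    · exact (((Complex.measurable_re.comp (measurable_qf H)).sub_const _).const_mul
        _).aestronglyMeasurable
    · simp only [qf_smul, trace_smul, smul_eq_mul, Complex.re_ofReal_mul, Pi.add_apply,
        Real.norm_eq_abs]
      have e1 := Real.add_one_le_exp (t * (qf H v).re - t * H.trace.re)
      have e2 := Real.add_one_le_exp (-t * (qf H v).re - -t * H.trace.re)
      have e3 := Real.exp_pos (t * (qf H v).re - t * H.trace.re)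
      have e4 := Real.exp_pos (-t * (qf H v).re - -t * H.trace.re)
      rw [abs_le]
      constructor <;> nlinarith
  have := (hZ.const_mul t⁻¹).add (integrable_const H.trace.re)
  refine this.congr (Filter.Eventually.of_forall fun v => ?_)
  simp only [Pi.add_apply]
  field_simp
  ring

lemma gvec_integral_herm {J : Type*} [Fintype J] [DecidableEq J] {H : Matrix J J ℂ}
    (hH : H.IsHermitian) : ∫ v, (qf H v).re ∂(gvec J) = H.trace.re := by
  have key : ∀ {H : Matrix J J ℂ}, H.IsHermitian → ∫ v, (qf H v).re ∂(gvec J) ≤ H.trace.re := by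
    intro H hH
    set F := frob2 H with hF
    have hF0 : 0 ≤ F := frob2_nonneg H
    set D := (∫ v, (qf H v).re ∂(gvec J)) - H.trace.re with hD
    have hbound : ∀ t : ℝ, 0 < t → t ^ 2 * F ≤ 1 / 4 → D ≤ 2 * t * F := by
      intro t ht htF
      have hsm : ((t : ℂ) • H).IsHermitian := by
        rw [IsHermitian, conjTranspose_smul, hH.eq, RCLike.star_def, Complex.conj_ofReal]
      have hfr : frob2 ((t : ℂ) • H) = t ^ 2 * F := by
        rw [frob2_smul, Complex.norm_real, Real.norm_eq_abs, sq_abs]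
      obtain ⟨hi, hle⟩ := gvec_exp hsm (by rw [hfr]; exact htF)
      have hsub : Integrable (fun v => t * ((qf H v).re - H.trace.re)) (gvec J) :=
        ((gvec_integrable_herm hH).sub (integrable_const _)).const_mul _
      have hintegrable : Integrable (fun v => 1 + t * ((qf H v).re - H.trace.re)) (gvec J) :=
        (integrable_const _).add hsub
      have h1 : ∫ v, (1 + t * ((qf H v).re - H.trace.re)) ∂(gvec J) ≤ Real.exp (t ^ 2 * F) := by
        rw [← hfr]
        refine le_trans (integral_mono hintegrable hi fun v => ?_) hle
        simp only [qf_smul, trace_smul, smul_eq_mul, Complex.re_ofReal_mul]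
        have := Real.add_one_le_exp (t * (qf H v).re - t * H.trace.re)
        linarith
      rw [integral_add (integrable_const _) hsub, integral_const_mul,
        integral_sub (gvec_integrable_herm hH) (integrable_const _)] at h1
      simp only [integral_const, probReal_univ, smul_eq_mul, one_mul] at h1
      have h2 : Real.exp (t ^ 2 * F) ≤ 1 + 2 * (t ^ 2 * F) := by
        have := Real.abs_exp_sub_one_le (x := t ^ 2 * F) (by
          rw [abs_of_nonneg (by positivity)]; linarith)
        rw [abs_of_nonneg (a := t ^ 2 * F) (by positivity)] at this
        linarith [(abs_le.1 this).2]
      have h3 : t * D ≤ t * (2 * t * F) := by nlinarith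
      exact le_of_mul_le_mul_left h3 ht
    have : D ≤ 0 := by
      refine le_of_forall_pos_le_add fun ε hε => ?_
      set t := min (1 / (2 * (F + 1))) (ε / (2 * (F + 1))) with ht
      have ht0 : 0 < t := by positivity
      have h1 : t ≤ 1 / (2 * (F + 1)) := min_le_left _ _
      have h2 : t ≤ ε / (2 * (F + 1)) := min_le_right _ _
      rw [le_div_iff₀ (by positivity)] at h1 h2
      have := hbound t ht0 (by
        have : t ^ 2 * F ≤ (t * (F + 1)) ^ 2 := by nlinarith [sq_nonneg t]
        nlinarith)
      nlinarith
    linarith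
  refine le_antisymm (key hH) ?_
  have h2 := key hH.neg
  have : ∀ v, (qf (-H) v).re = - (qf H v).re := by intro v; simp [qf, neg_mulVec]
  simp_rw [this] at h2
  rw [integral_neg, trace_neg, Complex.neg_re] at h2
  linarith

lemma posSemidef_qf_nonneg {J : Type*} [Fintype J] {M : Matrix J J ℂ} (hM : M.PosSemidef)
    (v : J → ℂ) : 0 ≤ (qf M v).re := by
  have := hM.dotProduct_mulVec_nonneg v
  exact (Complex.le_def.1 this).1

lemma frob2_le_trace_sq {J : Type*} [Fintype J] [DecidableEq J] {M : Matrix J J ℂ}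
    (hM : M.PosSemidef) : frob2 M ≤ M.trace.re ^ 2 := by
  rw [← sum_eigenvalues_sq hM.1]
  have : M.trace.re = ∑ i, hM.1.eigenvalues i := by
    rw [hM.1.trace_eq_sum_eigenvalues]; simp
  rw [this]
  exact Finset.sum_sq_le_sq_sum_of_nonneg (fun i _ => hM.eigenvalues_nonneg i)

lemma posSemidef_trace_re_nonneg {J : Type*} [Fintype J] {M : Matrix J J ℂ}
    (hM : M.PosSemidef) : 0 ≤ M.trace.re := (Complex.le_def.1 hM.trace_nonneg).1

/-- Moments of positive quadratic forms of Gaussian vectors. -/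
lemma gvec_moment (k : ℕ) {K : ℝ} (hK : 0 < K) : ∃ C : ℝ, 0 ≤ C ∧
    ∀ (J : Type) [Fintype J] [DecidableEq J] (M : Matrix J J ℂ), M.PosSemidef → M.trace.re ≤ K →
      Integrable (fun v => (1 + (qf M v).re) ^ k) (gvec J) ∧
      ∫ v, (1 + (qf M v).re) ^ k ∂(gvec J) ≤ C := by
  set a : ℝ := 1 / (2 * K) with ha
  have ha0 : 0 < a := by positivity
  set C0 : ℝ := (a⁻¹) ^ k * k.factorial * Real.exp (a + 1 / 2) with hC0
  have hC00 : 0 ≤ C0 := by positivity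
  refine ⟨C0 * Real.exp (1 / 4), by positivity, ?_⟩
  intro J _ _ M hM hMK
  have htr := posSemidef_trace_re_nonneg hM
  have haK : a * M.trace.re ≤ 1 / 2 := by
    rw [ha, one_div, inv_mul_le_iff₀ (by positivity)]; linarith
  have hsm : ((a : ℂ) • M).IsHermitian := by
    rw [IsHermitian, conjTranspose_smul, hM.1.eq, RCLike.star_def, Complex.conj_ofReal]
  have hfr : frob2 ((a : ℂ) • M) ≤ 1 / 4 := by
    rw [frob2_smul, Complex.norm_real, Real.norm_eq_abs, sq_abs]
    have h1 := frob2_le_trace_sq hM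
    calc a ^ 2 * frob2 M ≤ a ^ 2 * M.trace.re ^ 2 := by gcongr
      _ = (a * M.trace.re) ^ 2 := by ring
      _ ≤ (1 / 2) ^ 2 := by gcongr
      _ = 1 / 4 := by norm_num
  obtain ⟨hi, hle⟩ := gvec_exp hsm hfr
  have hpt : ∀ v, (1 + (qf M v).re) ^ k ≤
      C0 * Real.exp ((qf ((a : ℂ) • M) v).re - ((a : ℂ) • M).trace.re) := by
    intro v
    have hq := posSemidef_qf_nonneg hM v
    have h1 := Real.pow_div_factorial_le_exp (x := a * (1 + (qf M v).re)) (by positivity) k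
    rw [div_le_iff₀ (by positivity), mul_pow] at h1
    have h2 : Real.exp (a * (1 + (qf M v).re)) ≤ Real.exp (a + 1 / 2) *
        Real.exp ((qf ((a : ℂ) • M) v).re - ((a : ℂ) • M).trace.re) := by
      rw [← Real.exp_add, Real.exp_le_exp, qf_smul, trace_smul, smul_eq_mul,
        Complex.re_ofReal_mul, Complex.re_ofReal_mul]
      linarith
    calc (1 + (qf M v).re) ^ k = (a⁻¹) ^ k * (a ^ k * (1 + (qf M v).re) ^ k) := by
          rw [← mul_assoc, ← mul_pow, inv_mul_cancel₀ ha0.ne', one_pow, one_mul]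
      _ ≤ (a⁻¹) ^ k * ((Real.exp (a + 1 / 2) *
        Real.exp ((qf ((a : ℂ) • M) v).re - ((a : ℂ) • M).trace.re)) * k.factorial) := by
          refine mul_le_mul_of_nonneg_left ?_ (by positivity)
          exact h1.trans (by gcongr)
      _ = _ := by rw [hC0]; ring
  have hintegrable : Integrable (fun v => (1 + (qf M v).re) ^ k) (gvec J) := by
    refine Integrable.mono' (hi.const_mul C0) ?_ (Filter.Eventually.of_forall fun v => ?_)
    · exact (((Complex.measurable_re.comp (measurable_qf M)).const_add _).pow_const
        _).aestronglyMeasurable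
    · rw [Real.norm_eq_abs, abs_of_nonneg (by have := posSemidef_qf_nonneg hM v; positivity)]
      exact hpt v
  refine ⟨hintegrable, ?_⟩
  calc _ ≤ ∫ v, C0 * Real.exp ((qf ((a : ℂ) • M) v).re - ((a : ℂ) • M).trace.re) ∂(gvec J) :=
        integral_mono hintegrable (hi.const_mul C0) hpt
    _ ≤ C0 * Real.exp (1 / 4) := by
        rw [integral_const_mul]
        gcongr
        exact hle.trans (Real.exp_le_exp.mpr hfr)

section MatrixTools

set_option linter.unusedSectionVars false

open scoped Matrix.Norms.L2Operator MatrixOrder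

variable {m n : Type*} [Fintype m] [Fintype n] [DecidableEq m] [DecidableEq n]

/-- Real part of the trace of the `k`-th power. -/
def pw (R : Matrix n n ℂ) (k : ℕ) : ℝ := ((R ^ k).trace).re

lemma isHermitian_eq_conj {R : Matrix n n ℂ} (hR : R.IsHermitian) :
    R = (hR.eigenvectorUnitary : Matrix n n ℂ) * diagonal (fun i => (hR.eigenvalues i : ℂ)) *
      (hR.eigenvectorUnitary : Matrix n n ℂ)ᴴ := by
  conv_lhs => rw [hR.spectral_theorem]
  rfl

lemma eigenvectorUnitary_left {R : Matrix n n ℂ} (hR : R.IsHermitian) :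
    (hR.eigenvectorUnitary : Matrix n n ℂ)ᴴ * (hR.eigenvectorUnitary : Matrix n n ℂ) = 1 :=
  (Unitary.mem_iff.mp hR.eigenvectorUnitary.2).1

lemma eigenvectorUnitary_right {R : Matrix n n ℂ} (hR : R.IsHermitian) :
    (hR.eigenvectorUnitary : Matrix n n ℂ) * (hR.eigenvectorUnitary : Matrix n n ℂ)ᴴ = 1 :=
  (Unitary.mem_iff.mp hR.eigenvectorUnitary.2).2

lemma conj_diagonal_pow {U : Matrix n n ℂ} (hU : Uᴴ * U = 1) (hU' : U * Uᴴ = 1) (D : n → ℂ)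
    (k : ℕ) : (U * diagonal D * Uᴴ) ^ k = U * diagonal (fun i => D i ^ k) * Uᴴ := by
  induction k with
  | zero => simp [hU']
  | succ k ih =>
    rw [pow_succ, ih]
    calc U * diagonal (fun i => D i ^ k) * Uᴴ * (U * diagonal D * Uᴴ)
        = U * diagonal (fun i => D i ^ k) * (Uᴴ * U) * diagonal D * Uᴴ := by
          simp only [Matrix.mul_assoc]
      _ = _ := by
          rw [hU, Matrix.mul_one, Matrix.mul_assoc U, diagonal_mul_diagonal]
          simp only [pow_succ]

lemma trace_conj_diagonal {U : Matrix n n ℂ} (hU : Uᴴ * U = 1) (D : n → ℂ) :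
    (U * diagonal D * Uᴴ).trace = ∑ i, D i := by
  rw [Matrix.trace_mul_comm, ← Matrix.mul_assoc, hU, Matrix.one_mul, trace_diagonal]

lemma trace_pow_eq {R : Matrix n n ℂ} (hR : R.IsHermitian) (k : ℕ) :
    (R ^ k).trace = ((∑ i, hR.eigenvalues i ^ k : ℝ) : ℂ) := by
  conv_lhs => rw [isHermitian_eq_conj hR]
  rw [conj_diagonal_pow (eigenvectorUnitary_left hR) (eigenvectorUnitary_right hR),
    trace_conj_diagonal (eigenvectorUnitary_left hR)]
  push_cast
  rfl

lemma pw_eq {R : Matrix n n ℂ} (hR : R.IsHermitian) (k : ℕ) :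
    pw R k = ∑ i, hR.eigenvalues i ^ k := by
  rw [pw, trace_pow_eq hR, Complex.ofReal_re]

lemma trace_pow_eq_pw {R : Matrix n n ℂ} (hR : R.IsHermitian) (k : ℕ) :
    (R ^ k).trace = (pw R k : ℂ) := by
  rw [pw_eq hR, trace_pow_eq hR]

lemma pw_nonneg {R : Matrix n n ℂ} (hR : R.PosSemidef) (k : ℕ) : 0 ≤ pw R k := by
  rw [pw_eq hR.1]
  exact Finset.sum_nonneg fun i _ => pow_nonneg (hR.eigenvalues_nonneg i) _

lemma pw_pos [Nonempty n] {R : Matrix n n ℂ} (hR : R.PosDef) (k : ℕ) : 0 < pw R k := by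
  rw [pw_eq hR.1]
  exact Finset.sum_pos (fun i _ => pow_pos (hR.eigenvalues_pos i) _) Finset.univ_nonempty

lemma pw_two_sq_le {R : Matrix n n ℂ} (hR : R.PosSemidef) : pw R 2 ^ 2 ≤ pw R 1 * pw R 3 := by
  simp only [pw_eq hR.1]
  refine Finset.sum_sq_le_sum_mul_sum_of_sq_le_mul _
    (fun i _ => pow_nonneg (hR.eigenvalues_nonneg i) _)
    (fun i _ => pow_nonneg (hR.eigenvalues_nonneg i) _) fun i _ => le_of_eq (by ring)

lemma pw_four_sq_le {R : Matrix n n ℂ} (hR : R.PosSemidef) :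
    pw R 4 ^ 2 ≤ pw R 3 ^ 2 * pw R 2 := by
  have h1 : pw R 4 ^ 2 ≤ pw R 6 * pw R 2 := by
    simp only [pw_eq hR.1]
    refine Finset.sum_sq_le_sum_mul_sum_of_sq_le_mul _
      (fun i _ => pow_nonneg (hR.eigenvalues_nonneg i) _)
      (fun i _ => pow_nonneg (hR.eigenvalues_nonneg i) _) fun i _ => le_of_eq (by ring)
  have h2 : pw R 6 ≤ pw R 3 ^ 2 := by
    simp only [pw_eq hR.1]
    calc ∑ i, hR.1.eigenvalues i ^ 6 = ∑ i, (hR.1.eigenvalues i ^ 3) ^ 2 := by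
          refine Finset.sum_congr rfl fun i _ => by ring
      _ ≤ _ := Finset.sum_sq_le_sq_sum_of_nonneg (fun i _ => pow_nonneg (hR.eigenvalues_nonneg i) _)
  exact h1.trans (mul_le_mul_of_nonneg_right h2 (pw_nonneg hR 2))

lemma pw_four_cube_le {R : Matrix n n ℂ} (hR : R.PosSemidef) : pw R 4 ^ 3 ≤ pw R 3 ^ 4 := by
  have hp := pw_nonneg hR 3
  have hp4 := pw_nonneg hR 4
  set ρ := pw R 3 ^ ((1 : ℝ) / 3) with hρ
  have hρ0 : 0 ≤ ρ := Real.rpow_nonneg hp _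
  have hρ3 : ρ ^ 3 = pw R 3 := by
    rw [hρ, ← Real.rpow_natCast, ← Real.rpow_mul hp]; norm_num
  have hle : ∀ i, hR.1.eigenvalues i ≤ ρ := by
    intro i
    refine le_of_pow_le_pow_left₀ (n := 3) (by norm_num) hρ0 ?_
    rw [hρ3, pw_eq hR.1]
    exact Finset.single_le_sum (f := fun i => hR.1.eigenvalues i ^ 3)
      (fun i _ => pow_nonneg (hR.eigenvalues_nonneg i) _) (Finset.mem_univ i)
  have h4 : pw R 4 ≤ ρ * pw R 3 := by
    simp only [pw_eq hR.1, Finset.mul_sum]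
    refine Finset.sum_le_sum fun i _ => ?_
    calc hR.1.eigenvalues i ^ 4 = hR.1.eigenvalues i * hR.1.eigenvalues i ^ 3 := by ring
      _ ≤ _ := mul_le_mul_of_nonneg_right (hle i) (pow_nonneg (hR.eigenvalues_nonneg i) _)
  calc pw R 4 ^ 3 ≤ (ρ * pw R 3) ^ 3 := pow_le_pow_left₀ hp4 h4 3
    _ = _ := by rw [mul_pow, hρ3]; ring

lemma frob2_pow_eq_pw {R : Matrix n n ℂ} (hR : R.IsHermitian) (k : ℕ) :
    frob2 (R ^ k) = pw R (2 * k) := by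
  rw [frob2_eq_trace, (hR.pow k).eq, ← pow_add, pw, two_mul]

lemma norm_qf_le (A : Matrix n n ℂ) (x : n → ℂ) : ‖qf A x‖ ≤ ‖A‖ * ∑ i, ‖x i‖ ^ 2 := by
  have h : ‖(WithLp.toLp 2 (A *ᵥ x) : EuclideanSpace ℂ n)‖ ≤
      ‖A‖ * ‖(WithLp.toLp 2 x : EuclideanSpace ℂ n)‖ := l2_opNorm_mulVec A (WithLp.toLp 2 x)
  have h2 : qf A x = inner ℂ (WithLp.toLp 2 x : EuclideanSpace ℂ n)
      (WithLp.toLp 2 (A *ᵥ x) : EuclideanSpace ℂ n) := by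
    rw [EuclideanSpace.inner_eq_star_dotProduct, qf, dotProduct_comm]
  rw [h2]
  refine (norm_inner_le_norm _ _).trans ?_
  have h3 : ∑ i, ‖x i‖ ^ 2 = ‖(WithLp.toLp 2 x : EuclideanSpace ℂ n)‖ ^ 2 := by
    rw [EuclideanSpace.norm_sq_eq]
  rw [h3]
  nlinarith [norm_nonneg (WithLp.toLp 2 x : EuclideanSpace ℂ n)]

lemma trace_mul_conjTranspose_mul (A : Matrix n n ℂ) (Q : Matrix m n ℂ) :
    (A * (Qᴴ * Q)).trace = ∑ i, qf A (star (Q i)) := by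
  rw [← Matrix.mul_assoc, Matrix.trace_mul_comm, ← Matrix.mul_assoc, Matrix.trace]
  refine Finset.sum_congr rfl fun i _ => ?_
  simp only [diag_apply, qf, Matrix.mul_apply, dotProduct, mulVec, Pi.star_apply, star_star,
    conjTranspose_apply, Finset.sum_mul, Finset.mul_sum]
  rw [Finset.sum_comm]
  exact Finset.sum_congr rfl fun _ _ => Finset.sum_congr rfl fun _ _ => by ring

lemma norm_trace_mul_le (A : Matrix n n ℂ) {P : Matrix n n ℂ} (hP : P.PosSemidef) :
    ‖(A * P).trace‖ ≤ ‖A‖ * P.trace.re := by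
  obtain ⟨Q, rfl⟩ := CStarAlgebra.nonneg_iff_eq_star_mul_self.mp hP.nonneg
  rw [star_eq_conjTranspose] at *
  have h1 : (Qᴴ * Q).trace.re = ∑ i, ∑ j, ‖Q i j‖ ^ 2 := by
    rw [Matrix.trace_mul_comm, ← frob2_eq_trace]; rfl
  rw [trace_mul_conjTranspose_mul, h1, Finset.mul_sum]
  refine (norm_sum_le _ _).trans (Finset.sum_le_sum fun i _ => ?_)
  refine (norm_qf_le _ _).trans (le_of_eq ?_)
  simp

lemma norm_le_one_of_conjTranspose_mul_self {U : Matrix n n ℂ} (hU : Uᴴ * U = 1) : ‖U‖ ≤ 1 := by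
  have := CStarRing.norm_star_mul_self (x := U)
  rw [star_eq_conjTranspose, hU] at this
  have h1 : ‖(1 : Matrix n n ℂ)‖ ≤ 1 := by
    rw [← diagonal_one, l2_opNorm_diagonal]
    exact (pi_norm_le_iff_of_nonneg zero_le_one).mpr fun i => by simp
  nlinarith [norm_nonneg U]

lemma norm_conj_le {U : Matrix n n ℂ} (hU : Uᴴ * U = 1) (A : Matrix n n ℂ) :
    ‖U * A * Uᴴ‖ ≤ ‖A‖ := by
  have h := norm_le_one_of_conjTranspose_mul_self hU
  have h2 : ‖Uᴴ‖ ≤ 1 := by rwa [l2_opNorm_conjTranspose]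
  calc ‖U * A * Uᴴ‖ ≤ ‖U‖ * ‖A‖ * ‖Uᴴ‖ :=
        (norm_mul_le _ _).trans (mul_le_mul_of_nonneg_right (norm_mul_le _ _) (norm_nonneg _))
    _ ≤ 1 * ‖A‖ * 1 := by gcongr
    _ = ‖A‖ := by ring

lemma norm_le_trace {P : Matrix n n ℂ} (hP : P.PosSemidef) : ‖P‖ ≤ P.trace.re := by
  have h1 : ‖P‖ ≤ ‖(diagonal (fun i => (hP.1.eigenvalues i : ℂ)) : Matrix n n ℂ)‖ := by
    conv_lhs => rw [isHermitian_eq_conj hP.1]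
    exact norm_conj_le (eigenvectorUnitary_left hP.1) _
  refine h1.trans ?_
  rw [l2_opNorm_diagonal]
  have htr : P.trace.re = ∑ i, hP.1.eigenvalues i := by
    have := pw_eq hP.1 1
    simpa [pw] using this
  rw [htr]
  refine (pi_norm_le_iff_of_nonneg (Finset.sum_nonneg fun i _ => hP.eigenvalues_nonneg i)).mpr ?_
  intro i
  rw [Complex.norm_real, Real.norm_of_nonneg (hP.eigenvalues_nonneg i)]
  exact Finset.single_le_sum (f := fun i => hP.1.eigenvalues i)
    (fun i _ => hP.eigenvalues_nonneg i) (Finset.mem_univ i)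

lemma norm_sq_le_frob2 (A : Matrix n n ℂ) : ‖A‖ ^ 2 ≤ frob2 A := by
  have h := CStarRing.norm_self_mul_star (x := A)
  rw [sq, ← h, star_eq_conjTranspose, frob2_eq_trace]
  exact norm_le_trace (posSemidef_self_mul_conjTranspose A)

lemma norm_le_of_entry_le (A : Matrix n n ℂ) {t : ℝ} (ht : 0 ≤ t) (h : ∀ i j, ‖A i j‖ ≤ t) :
    ‖A‖ ≤ Fintype.card n * t := by
  refine le_of_sq_le_sq ?_ (by positivity)
  refine (norm_sq_le_frob2 A).trans ?_
  calc frob2 A ≤ ∑ _i : n, ∑ _j : n, t ^ 2 := by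
        refine Finset.sum_le_sum fun i _ => Finset.sum_le_sum fun j _ => ?_
        exact pow_le_pow_left₀ (norm_nonneg _) (h i j) 2
    _ = _ := by simp; ring

lemma algebraMap_real_eq (r : ℝ) : algebraMap ℝ (Matrix n n ℂ) r = (r : ℂ) • 1 := by
  ext i j
  simp [Matrix.algebraMap_matrix_apply, Matrix.smul_apply, Matrix.one_apply]

lemma isHermitian_le_norm {A : Matrix n n ℂ} (hA : A.IsHermitian) {t : ℝ} (ht : ‖A‖ ≤ t) :
    A ≤ (t : ℂ) • 1 := by
  rw [← algebraMap_real_eq]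
  refine (IsSelfAdjoint.le_algebraMap_norm_self (a := A) hA).trans ?_
  exact algebraMap_mono _ ht

lemma norm_le_of_le {A : Matrix n n ℂ} (hA : 0 ≤ A) {t : ℝ} (ht : 0 ≤ t)
    (h : A ≤ (t : ℂ) • 1) : ‖A‖ ≤ t := by
  rw [← algebraMap_real_eq] at h
  exact (CStarAlgebra.norm_le_iff_le_algebraMap A ht hA).mpr h

lemma trace_re_mono {A B : Matrix n n ℂ} (h : A ≤ B) : A.trace.re ≤ B.trace.re := by
  have := posSemidef_trace_re_nonneg (Matrix.le_iff.mp h)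
  rw [trace_sub, Complex.sub_re] at this
  linarith

end MatrixTools

section Blocks

open scoped Matrix.Norms.L2Operator MatrixOrder

set_option linter.unusedSectionVars false

variable {ι κ δ : Type*} [Fintype ι] [Fintype κ] [Fintype δ] [DecidableEq ι] [DecidableEq κ]
  [DecidableEq δ]

/-- The matrix `1 ⊗ v`, where `v` is viewed as a `δ × κ` matrix. -/
def Vm (ι : Type*) {κ δ : Type*} [DecidableEq ι] (v : κ × δ → ℂ) : Matrix (ι × δ) (ι × κ) ℂ :=
  fun p q => if p.1 = q.1 then v (q.2, p.2) else 0

/-- Partial trace over the second tensor factor. -/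
def ptr (A : Matrix (ι × δ) (ι × δ) ℂ) : Matrix ι ι ℂ := fun i j => ∑ x, A (i, x) (j, x)

/-- The `(i, j)` block of a block matrix. -/
def blk (A : Matrix (ι × δ) (ι × δ) ℂ) (i j : ι) : Matrix δ δ ℂ := fun x y => A (i, x) (j, y)

/-- The matrix of the quadratic form `v ↦ Tr (S V* A V)`. -/
def Km (S : Matrix (ι × κ) (ι × κ) ℂ) (A : Matrix (ι × δ) (ι × δ) ℂ) :
    Matrix (κ × δ) (κ × δ) ℂ :=
  fun p q => ∑ i, ∑ j, S (j, q.1) (i, p.1) * A (i, p.2) (j, q.2)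

lemma qf_single_kronecker (a b : κ) (C : Matrix δ δ ℂ) (v : κ × δ → ℂ) :
    qf (Matrix.single a b (1 : ℂ) ⊗ₖ C) v = ∑ x, ∑ y, star (v (a, x)) * C x y * v (b, y) := by
  simp only [qf, dotProduct, mulVec, kroneckerMap_apply, Pi.star_apply, Fintype.sum_prod_type,
    Matrix.single_apply]
  rw [Finset.sum_eq_single a]
  · refine Finset.sum_congr rfl fun x _ => ?_
    rw [Finset.mul_sum, Finset.sum_eq_single b]
    · rw [Finset.mul_sum]
      exact Finset.sum_congr rfl fun y _ => by simp [mul_assoc]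
    · intro b' _ hb'
      simp [hb'.symm]
    · simp
  · intro a' _ ha'
    simp [ha'.symm]
  · simp

lemma trace_single_kronecker (a b : κ) (C : Matrix δ δ ℂ) :
    (Matrix.single a b (1 : ℂ) ⊗ₖ C).trace = if a = b then C.trace else 0 := by
  rw [trace_kronecker]
  split_ifs with h
  · subst h; simp
  · simp [Matrix.trace_single_eq_of_ne _ _ _ h]

lemma frob2_single_kronecker (a b : κ) (C : Matrix δ δ ℂ) :
    frob2 (Matrix.single a b (1 : ℂ) ⊗ₖ C) = frob2 C := by
  simp only [frob2, kroneckerMap_apply, Fintype.sum_prod_type, Matrix.single_apply]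
  rw [Finset.sum_eq_single a]
  · refine Finset.sum_congr rfl fun x _ => ?_
    rw [Finset.sum_eq_single b]
    · simp
    · intro b' _ hb'
      simp [hb'.symm]
    · simp
  · intro a' _ ha'
    simp [ha'.symm]
  · simp

lemma mul_Vm_apply (A : Matrix (ι × δ) (ι × δ) ℂ) (v : κ × δ → ℂ) (p : ι × δ) (j : ι) (b : κ) :
    (A * Vm ι v) p (j, b) = ∑ y, A p (j, y) * v (b, y) := by
  simp only [Matrix.mul_apply, Vm, Fintype.sum_prod_type]
  rw [Finset.sum_eq_single j]
  · simp
  · intro j' _ hj'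
    simp [hj']
  · simp

lemma Vm_conjTranspose_mul_apply (A : Matrix (ι × δ) (ι × δ) ℂ) (v : κ × δ → ℂ) (p : ι × δ)
    (i : ι) (a : κ) : ((Vm ι v)ᴴ * A) (i, a) p = ∑ x, star (v (a, x)) * A (i, x) p := by
  simp only [Matrix.mul_apply, Vm, Fintype.sum_prod_type, conjTranspose_apply]
  rw [Finset.sum_eq_single i]
  · simp
  · intro j' _ hj'
    simp [hj']
  · simp

lemma Vm_gram_apply (A : Matrix (ι × δ) (ι × δ) ℂ) (v : κ × δ → ℂ) (i j : ι) (a b : κ) :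
    ((Vm ι v)ᴴ * (A * Vm ι v)) (i, a) (j, b) =
      qf (Matrix.single a b (1 : ℂ) ⊗ₖ blk A i j) v := by
  rw [qf_single_kronecker]
  have : ((Vm ι v)ᴴ * (A * Vm ι v)) (i, a) (j, b) =
      ∑ x, star (v (a, x)) * (A * Vm ι v) (i, x) (j, b) := by
    simp only [Matrix.mul_apply (M := (Vm ι v)ᴴ), Vm, Fintype.sum_prod_type, conjTranspose_apply]
    rw [Finset.sum_eq_single i]
    · simp
    · intro j' _ hj'
      simp [hj']
    · simp
  rw [this]
  refine Finset.sum_congr rfl fun x _ => ?_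
  rw [mul_Vm_apply, Finset.mul_sum]
  exact Finset.sum_congr rfl fun y _ => by rw [blk, mul_assoc]

lemma trace_mul_gram (S : Matrix (ι × κ) (ι × κ) ℂ) (A : Matrix (ι × δ) (ι × δ) ℂ)
    (v : κ × δ → ℂ) : (S * ((Vm ι v)ᴴ * (A * Vm ι v))).trace = qf (Km S A) v := by
  have h1 : (S * ((Vm ι v)ᴴ * (A * Vm ι v))).trace =
      ∑ j, ∑ b, ∑ i, ∑ a, ∑ x, ∑ y,
        S (j, b) (i, a) * (star (v (a, x)) * A (i, x) (j, y) * v (b, y)) := by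
    simp only [Matrix.trace, diag_apply, Matrix.mul_apply (M := S), Fintype.sum_prod_type,
      Vm_gram_apply, qf_single_kronecker, Finset.mul_sum, blk]
  have h2 : qf (Km S A) v = ∑ a, ∑ x, ∑ b, ∑ y, ∑ i, ∑ j,
        S (j, b) (i, a) * (star (v (a, x)) * A (i, x) (j, y) * v (b, y)) := by
    simp only [qf, dotProduct, mulVec, Km, Fintype.sum_prod_type, Pi.star_apply, Finset.mul_sum,
      Finset.sum_mul]
    refine Finset.sum_congr rfl fun a _ => Finset.sum_congr rfl fun x _ =>
      Finset.sum_congr rfl fun b _ => Finset.sum_congr rfl fun y _ =>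
      Finset.sum_congr rfl fun i _ => Finset.sum_congr rfl fun j _ => by ring
  rw [h1, h2]
  simp only [← Fintype.sum_prod_type']
  exact Fintype.sum_equiv
    ⟨fun (j, b, i, a, x, y) => (a, x, b, y, i, j), fun (a, x, b, y, i, j) => (j, b, i, a, x, y),
      fun _ => rfl, fun _ => rfl⟩ _ _ fun _ => rfl

lemma trace_Km (S : Matrix (ι × κ) (ι × κ) ℂ) (A : Matrix (ι × δ) (ι × δ) ℂ) :
    (Km S A).trace = (ptr S * ptr A).trace := by
  have h1 : (Km S A).trace = ∑ a, ∑ x, ∑ i, ∑ j, S (j, a) (i, a) * A (i, x) (j, x) := by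
    simp only [Matrix.trace, diag_apply, Km, Fintype.sum_prod_type]
  have h2 : (ptr S * ptr A).trace = ∑ j, ∑ i, ∑ a, ∑ x, S (j, a) (i, a) * A (i, x) (j, x) := by
    simp only [Matrix.trace, diag_apply, Matrix.mul_apply, ptr, Finset.sum_mul_sum]
  rw [h1, h2]
  simp only [← Fintype.sum_prod_type']
  exact Fintype.sum_equiv
    ⟨fun (a, x, i, j) => (j, i, a, x), fun (j, i, a, x) => (a, x, i, j),
      fun _ => rfl, fun _ => rfl⟩ _ _ fun _ => rfl

lemma Km_isHermitian {S : Matrix (ι × κ) (ι × κ) ℂ} {A : Matrix (ι × δ) (ι × δ) ℂ}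
    (hS : S.IsHermitian) (hA : A.IsHermitian) : (Km S A).IsHermitian := by
  ext p q
  simp only [conjTranspose_apply, Km, star_sum, star_mul', hS.apply, hA.apply]
  exact Finset.sum_comm

lemma ptr_add (A B : Matrix (ι × δ) (ι × δ) ℂ) : ptr (A + B) = ptr A + ptr B := by
  ext i j; simp [ptr, Finset.sum_add_distrib]

lemma ptr_sub (A B : Matrix (ι × δ) (ι × δ) ℂ) : ptr (A - B) = ptr A - ptr B := by
  ext i j; simp [ptr, Finset.sum_sub_distrib]

lemma ptr_smul (r : ℂ) (A : Matrix (ι × δ) (ι × δ) ℂ) : ptr (r • A) = r • ptr A := by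
  ext i j; simp [ptr, Finset.mul_sum]

lemma ptr_one : ptr (1 : Matrix (ι × δ) (ι × δ) ℂ) = (Fintype.card δ : ℂ) • 1 := by
  ext i j
  by_cases h : i = j <;> simp [ptr, Matrix.one_apply, h]

lemma trace_ptr (A : Matrix (ι × δ) (ι × δ) ℂ) : (ptr A).trace = A.trace := by
  simp [Matrix.trace, ptr, Fintype.sum_prod_type]

lemma ptr_isHermitian {A : Matrix (ι × δ) (ι × δ) ℂ} (hA : A.IsHermitian) :
    (ptr A).IsHermitian := by
  ext i j
  simp [ptr, hA.apply, star_sum]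

lemma ptr_posSemidef {A : Matrix (ι × δ) (ι × δ) ℂ} (hA : A.PosSemidef) :
    (ptr A).PosSemidef := by
  have h : ptr A = ∑ x, A.submatrix (fun i => (i, x)) (fun i => (i, x)) := by
    ext i j; simp [ptr, Matrix.sum_apply]
  rw [h]
  exact Matrix.posSemidef_sum _ fun x _ => hA.submatrix _

lemma ptr_mono {A B : Matrix (ι × δ) (ι × δ) ℂ} (h : A ≤ B) : ptr A ≤ ptr B := by
  rw [Matrix.le_iff] at h ⊢
  rw [← ptr_sub]
  exact ptr_posSemidef h

lemma Km_one_posSemidef {A : Matrix (ι × δ) (ι × δ) ℂ} (hA : A.PosSemidef) :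
    (Km (1 : Matrix (ι × κ) (ι × κ) ℂ) A).PosSemidef := by
  have h : Km (1 : Matrix (ι × κ) (ι × κ) ℂ) A =
      (1 : Matrix κ κ ℂ) ⊗ₖ ∑ i, A.submatrix (fun x => (i, x)) (fun x => (i, x)) := by
    ext ⟨a, x⟩ ⟨b, y⟩
    simp only [Km, kroneckerMap_apply, Matrix.sum_apply, submatrix_apply, Finset.mul_sum]
    refine Finset.sum_congr rfl fun i _ => ?_
    rw [Finset.sum_eq_single i]
    · simp [Matrix.one_apply, eq_comm]
    · intro j _ hj
      simp [hj]
    · simp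
  rw [h]
  exact PosSemidef.one.kronecker (Matrix.posSemidef_sum _ fun x _ => hA.submatrix _)

lemma trace_Km_one (A : Matrix (ι × δ) (ι × δ) ℂ) :
    (Km (1 : Matrix (ι × κ) (ι × κ) ℂ) A).trace = Fintype.card κ * A.trace := by
  rw [trace_Km, ptr_one, smul_mul_assoc, Matrix.one_mul, trace_smul, trace_ptr, smul_eq_mul]

lemma frob2_blk_le (A : Matrix (ι × δ) (ι × δ) ℂ) (i j : ι) : frob2 (blk A i j) ≤ frob2 A := by
  simp only [frob2, blk, Fintype.sum_prod_type]
  refine le_trans ?_ (Finset.single_le_sum (f := fun i => ∑ x, ∑ j, ∑ y, ‖A (i, x) (j, y)‖ ^ 2)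
    (fun i _ => by positivity) (Finset.mem_univ i))
  refine Finset.sum_le_sum fun x _ => ?_
  exact Finset.single_le_sum (f := fun j => ∑ y, ‖A (i, x) (j, y)‖ ^ 2)
    (fun i _ => by positivity) (Finset.mem_univ j)

lemma frob2_single_kronecker_mul_le (q p : ι) (A : Matrix (ι × δ) (ι × δ) ℂ) :
    frob2 ((Matrix.single q p (1 : ℂ) ⊗ₖ (1 : Matrix δ δ ℂ)) * A) ≤ frob2 A := by
  have h : ∀ k z c, ((Matrix.single q p (1 : ℂ) ⊗ₖ (1 : Matrix δ δ ℂ)) * A) (k, z) c =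
      if k = q then A (p, z) c else 0 := by
    intro k z c
    simp only [Matrix.mul_apply, kroneckerMap_apply, Fintype.sum_prod_type, Matrix.single_apply,
      Matrix.one_apply]
    rw [Finset.sum_eq_single p]
    · rcases eq_or_ne k q with rfl | hk
      · simp
      · simp [hk, hk.symm]
    · intro p' _ hp'
      simp [hp'.symm]
    · simp
  simp only [frob2, Fintype.sum_prod_type (f := fun i : ι × δ => ∑ j, _), h]
  rw [Finset.sum_eq_single q]
  · simp only [if_true]
    exact Finset.single_le_sum (f := fun i => ∑ x, ∑ j, ‖A (i, x) j‖ ^ 2)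
      (fun i _ => by positivity) (Finset.mem_univ p)
  · intro k _ hk
    simp [hk]
  · simp

lemma norm_trace_mul_le_frob2 {m : Type*} [Fintype m] (A B : Matrix m m ℂ) :
    ‖(A * B).trace‖ ≤ (frob2 A + frob2 B) / 2 := by
  have h2 : frob2 B = ∑ i, ∑ j, ‖B j i‖ ^ 2 := Finset.sum_comm
  rw [h2, frob2, ← Finset.sum_add_distrib, Finset.sum_div]
  simp only [Matrix.trace, diag_apply, Matrix.mul_apply]
  refine (norm_sum_le _ _).trans (Finset.sum_le_sum fun i _ => ?_)
  rw [← Finset.sum_add_distrib, Finset.sum_div]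
  refine (norm_sum_le _ _).trans (Finset.sum_le_sum fun j _ => ?_)
  rw [norm_mul]
  nlinarith [sq_nonneg (‖A i j‖ - ‖B j i‖)]

lemma frob2_blk_mul_blk_le {R : Matrix (ι × δ) (ι × δ) ℂ} (hR : R.IsHermitian) (j q p i : ι) :
    frob2 (blk R j q * blk R p i) ≤ pw R 4 := by
  set M : Matrix (ι × δ) (ι × δ) ℂ := Matrix.single q p (1 : ℂ) ⊗ₖ (1 : Matrix δ δ ℂ) with hM
  have h1 : blk R j q * blk R p i = blk (R * (M * R)) j i := by
    ext x y
    have hMR : ∀ k z c, (M * R) (k, z) c = if k = q then R (p, z) c else 0 := by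
      intro k z c
      simp only [hM, Matrix.mul_apply, kroneckerMap_apply, Fintype.sum_prod_type,
        Matrix.single_apply, Matrix.one_apply]
      rw [Finset.sum_eq_single p]
      · rcases eq_or_ne k q with rfl | hk
        · simp
        · simp [hk, hk.symm]
      · intro p' _ hp'
        simp [hp'.symm]
      · simp
    simp only [blk, Matrix.mul_apply (M := R), Fintype.sum_prod_type, hMR]
    rw [Finset.sum_eq_single q]
    · simp [Matrix.mul_apply, blk]
    · intro k _ hk
      simp [hk]
    · simp
  have hMH : Mᴴ = Matrix.single p q (1 : ℂ) ⊗ₖ (1 : Matrix δ δ ℂ) := by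
    rw [hM, conjTranspose_kronecker]; simp
  rw [h1]
  refine (frob2_blk_le _ _ _).trans ?_
  rw [frob2_eq_trace]
  have h2 : (R * (M * R) * (R * (M * R))ᴴ).trace = ((M * R ^ 2) * (Mᴴ * R ^ 2)).trace := by
    rw [conjTranspose_mul, conjTranspose_mul, hR.eq]
    have : R * (M * R) * (R * Mᴴ * R) = R * (M * R ^ 2 * Mᴴ * R) := by
      simp only [sq, Matrix.mul_assoc]
    rw [this, Matrix.trace_mul_comm]
    simp only [sq, Matrix.mul_assoc]
  rw [h2]
  refine (Complex.re_le_norm _).trans ((norm_trace_mul_le_frob2 _ _).trans ?_)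
  have h3 := frob2_single_kronecker_mul_le q p (R ^ 2)
  have h4 := frob2_single_kronecker_mul_le p q (R ^ 2)
  rw [← hM] at h3
  rw [← hMH] at h4
  rw [frob2_pow_eq_pw hR] at h3 h4
  linarith

lemma ptr_sandwich_apply (A : Matrix (ι × δ) (ι × δ) ℂ) (S : Matrix (ι × κ) (ι × κ) ℂ)
    (v : κ × δ → ℂ) (p q : ι) :
    ptr (A * Vm ι v * S * ((Vm ι v)ᴴ * A)) p q =
      ∑ s : ι × κ, ∑ t : ι × κ, S s t *
        qf (Matrix.single t.2 s.2 (1 : ℂ) ⊗ₖ (blk A t.1 q * blk A p s.1)) v := by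
  have h1 : ptr (A * Vm ι v * S * ((Vm ι v)ᴴ * A)) p q = ∑ z, ∑ t : ι × κ, ∑ s : ι × κ,
      ∑ x, ∑ y, S s t * (star (v (t.2, y)) * (A (t.1, y) (q, z) * A (p, z) (s.1, x)) *
        v (s.2, x)) := by
    simp only [ptr]
    refine Finset.sum_congr rfl fun z _ => ?_
    rw [Matrix.mul_apply]
    refine Finset.sum_congr rfl fun t _ => ?_
    rw [Matrix.mul_apply, Finset.sum_mul]
    refine Finset.sum_congr rfl fun s _ => ?_
    rw [show s = (s.1, s.2) from rfl, show t = (t.1, t.2) from rfl, mul_Vm_apply,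
      Vm_conjTranspose_mul_apply]
    simp only [Finset.sum_mul, Finset.mul_sum]
    rw [Finset.sum_comm]
    exact Finset.sum_congr rfl fun x _ => Finset.sum_congr rfl fun y _ => by ring
  have h2 : ∑ s : ι × κ, ∑ t : ι × κ, S s t *
        qf (Matrix.single t.2 s.2 (1 : ℂ) ⊗ₖ (blk A t.1 q * blk A p s.1)) v =
      ∑ s : ι × κ, ∑ t : ι × κ, ∑ y, ∑ x, ∑ z,
       S s t * (star (v (t.2, y)) * (A (t.1, y) (q, z) * A (p, z) (s.1, x)) *
        v (s.2, x)) := by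
    simp only [qf_single_kronecker, Finset.mul_sum, Finset.sum_mul, Matrix.mul_apply, blk]
  rw [h1, h2]
  simp only [← Fintype.sum_prod_type']
  exact Fintype.sum_equiv
    ⟨fun (z, t, s, x, y) => (s, t, y, x, z), fun (s, t, y, x, z) => (z, t, s, x, y),
      fun _ => rfl, fun _ => rfl⟩ _ _ fun _ => rfl

lemma ptr_kronecker_sandwich_apply (A : Matrix (ι × δ) (ι × δ) ℂ) (S : Matrix (ι × κ) (ι × κ) ℂ)
    (p q : ι) :
    ptr (A * (ptr S ⊗ₖ (1 : Matrix δ δ ℂ)) * A) p q =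
      ∑ s : ι × κ, ∑ t : ι × κ, S s t *
        (Matrix.single t.2 s.2 (1 : ℂ) ⊗ₖ (blk A t.1 q * blk A p s.1)).trace := by
  have h1 : ptr (A * (ptr S ⊗ₖ (1 : Matrix δ δ ℂ)) * A) p q =
      ∑ z, ∑ j, ∑ x, ∑ i, ∑ a, S (i, a) (j, a) * (A (j, x) (q, z) * A (p, z) (i, x)) := by
    simp only [ptr]
    refine Finset.sum_congr rfl fun z _ => ?_
    rw [Matrix.mul_apply, Fintype.sum_prod_type]
    refine Finset.sum_congr rfl fun j _ => Finset.sum_congr rfl fun x _ => ?_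
    rw [Matrix.mul_apply, Fintype.sum_prod_type, Finset.sum_mul]
    refine Finset.sum_congr rfl fun i _ => ?_
    rw [Finset.sum_eq_single x]
    · simp only [kroneckerMap_apply, Matrix.one_apply_eq, mul_one, ptr, Finset.mul_sum,
        Finset.sum_mul]
      exact Finset.sum_congr rfl fun a _ => by ring
    · intro x' _ hx'
      simp [hx']
    · simp
  have h2 : ∑ s : ι × κ, ∑ t : ι × κ, S s t *
        (Matrix.single t.2 s.2 (1 : ℂ) ⊗ₖ (blk A t.1 q * blk A p s.1)).trace =
      ∑ i, ∑ a, ∑ j, ∑ x, ∑ z, S (i, a) (j, a) * (A (j, x) (q, z) * A (p, z) (i, x)) := by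
    simp only [Fintype.sum_prod_type, trace_single_kronecker]
    refine Finset.sum_congr rfl fun i _ => Finset.sum_congr rfl fun a _ =>
      Finset.sum_congr rfl fun j _ => ?_
    rw [Finset.sum_eq_single a]
    · simp only [if_true, Matrix.trace, diag_apply, Matrix.mul_apply, blk, Finset.mul_sum]
    · intro b _ hb
      simp [hb]
    · simp
  rw [h1, h2]
  simp only [← Fintype.sum_prod_type']
  exact Fintype.sum_equiv
    ⟨fun (z, j, x, i, a) => (i, a, j, x, z), fun (i, a, j, x, z) => (z, j, x, i, a),
      fun _ => rfl, fun _ => rfl⟩ _ _ fun _ => rfl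

end Blocks

section Update

open scoped Matrix.Norms.L2Operator MatrixOrder

set_option linter.unusedSectionVars false

lemma neumann_inverse {m : Type*} [Fintype m] [DecidableEq m] {A S E : Matrix m m ℂ} {C e : ℝ}
    (hS : A * S = 1) (hSC : ‖S‖ ≤ C) (hE : ‖E‖ ≤ e) (he : C * e ≤ 1 / 2) :
    ∃ S', (A + E) * S' = 1 ∧ ‖S'‖ ≤ 2 * C ∧ ‖S' - S‖ ≤ 2 * C ^ 2 * e := by
  have hSA : S * A = 1 := mul_eq_one_comm.mp hS
  have hC : 0 ≤ C := (norm_nonneg _).trans hSC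
  have hSE : ‖S * E‖ ≤ 1 / 2 :=
    (norm_mul_le _ _).trans ((mul_le_mul hSC hE (norm_nonneg _) hC).trans he)
  have hu : IsUnit (1 - (-(S * E))) :=
    isUnit_one_sub_of_norm_lt_one (by rw [norm_neg]; linarith)
  obtain ⟨u, hu⟩ := hu
  have hmul : (1 + S * E) * (↑u⁻¹ : Matrix m m ℂ) = 1 := by
    rw [show 1 + S * E = (u : Matrix m m ℂ) by rw [hu]; abel]
    exact u.mul_inv
  set S' := (↑u⁻¹ : Matrix m m ℂ) * S with hS'
  have h1 : (A + E) * S' = 1 := by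
    have : A + E = A * (1 + S * E) := by
      rw [mul_add, mul_one, ← mul_assoc, hS, one_mul]
    rw [this, hS', mul_assoc, ← mul_assoc (1 + S * E), hmul, one_mul, hS]
  have h1' : S' * (A + E) = 1 := mul_eq_one_comm.mp h1
  have h2 : S' - S = -(S' * E * S) := by
    have : S' * (A + E) * S = S := by rw [h1', one_mul]
    rw [mul_add, add_mul, mul_assoc S' A, hS, mul_one] at this
    rw [eq_neg_iff_add_eq_zero]
    calc S' - S + S' * E * S = (S' + S' * E * S) - S := by abel
      _ = 0 := by rw [this, sub_self]
  have h3 : ‖S' - S‖ ≤ ‖S'‖ * e * C := by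
    rw [h2, norm_neg]
    have he0 : 0 ≤ e := (norm_nonneg _).trans hE
    refine (norm_mul_le _ _).trans ?_
    refine mul_le_mul ((norm_mul_le _ _).trans ?_) hSC (norm_nonneg _) (by positivity)
    exact mul_le_mul_of_nonneg_left hE (norm_nonneg _)
  have h4 : ‖S'‖ ≤ 2 * C := by
    have : ‖S'‖ ≤ ‖S‖ + ‖S' - S‖ := by
      calc ‖S'‖ = ‖S + (S' - S)‖ := by congr 1; abel
        _ ≤ _ := norm_add_le _ _
    nlinarith [norm_nonneg S']
  refine ⟨S', h1, h4, h3.trans ?_⟩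
  have he0 : 0 ≤ e := (norm_nonneg _).trans hE
  nlinarith [mul_le_mul_of_nonneg_right h4 (mul_nonneg he0 hC)]

lemma norm_entry_le_l2 {m : Type*} [Fintype m] [DecidableEq m] (A : Matrix m m ℂ) (i j : m) :
    ‖A i j‖ ≤ ‖A‖ := by
  have h := l2_opNorm_mulVec A (EuclideanSpace.single j (1 : ℂ))
  rw [PiLp.norm_single, norm_one, mul_one] at h
  refine le_trans ?_ h
  refine le_trans (le_of_eq ?_) (PiLp.norm_apply_le _ i)
  simp

lemma isHermitian_inv_of_mul {m : Type*} [Fintype m] [DecidableEq m] {A S : Matrix m m ℂ}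
    (hA : A.IsHermitian) (hS : A * S = 1) : S.IsHermitian := by
  rw [← Matrix.inv_eq_right_inv hS]
  exact hA.inv

lemma trace_sub_cube {m : Type*} [Fintype m] [DecidableEq m] (R Z : Matrix m m ℂ) :
    ((R - Z) ^ 3).trace = (R ^ 3).trace - 3 * (R ^ 2 * Z).trace + 3 * (R * Z * Z).trace -
      (Z ^ 3).trace := by
  have h : (R - Z) ^ 3 = R ^ 3 - (R * R * Z + R * Z * R + Z * R * R) +
      (R * Z * Z + Z * R * Z + Z * Z * R) - Z ^ 3 := by noncomm_ring
  rw [h]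
  simp only [trace_sub, trace_add]
  have h1 : (R * Z * R).trace = (R ^ 2 * Z).trace := by
    rw [trace_mul_comm, ← mul_assoc, sq]
  have h2 : (Z * R * R).trace = (R ^ 2 * Z).trace := by
    rw [mul_assoc, trace_mul_comm, sq]
  have h3 : (Z * R * Z).trace = (R * Z * Z).trace := by
    rw [mul_assoc, trace_mul_comm]
  have h4 : (Z * Z * R).trace = (R * Z * Z).trace := by
    rw [trace_mul_comm, ← mul_assoc]
  rw [h1, h2, h3, h4, ← sq]
  ring

variable {ι κ δ : Type*} [Fintype ι] [Fintype κ] [Fintype δ] [DecidableEq ι] [DecidableEq κ]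
  [DecidableEq δ]

/-- Hypotheses on the signature matrix `F` under which the barrier argument runs. -/
structure BarrierData (F : Matrix (ι × κ) (ι × κ) ℂ) (f s C₀ k₀ : ℝ) : Prop where
  herm : F.IsHermitian
  sq : F * F = 1
  f_nonneg : 0 ≤ f
  lower : (F + (f : ℂ) • 1).PosSemidef
  s_pos : 0 < s
  fs : f * s < 1
  C₀_pos : 0 < C₀
  res : ∀ T : Matrix ι ι ℂ, 0 ≤ T → T ≤ (s : ℂ) • 1 →
    ∃ S, (F + T ⊗ₖ (1 : Matrix κ κ ℂ)) * S = 1 ∧ ‖S‖ ≤ C₀ ∧ (k₀ : ℂ) • 1 ≤ ptr S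

lemma smul_posSemidef {m : Type*} [Fintype m] {A : Matrix m m ℂ} (hA : A.PosSemidef) {r : ℝ}
    (hr : 0 ≤ r) : ((r : ℂ) • A).PosSemidef :=
  hA.smul (by exact_mod_cast hr : (0 : ℂ) ≤ r)

lemma posDef_update {m k : Type*} [Fintype m] [Fintype k] [DecidableEq m] [DecidableEq k]
    {B R : Matrix m m ℂ} (hB : B.PosDef) (hBR : B * R = 1) (V : Matrix m k ℂ)
    {F : Matrix k k ℂ} {f y : ℝ} (hf : 0 ≤ f) (hF : (F + (f : ℂ) • 1).PosSemidef) (hy : 0 < y)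
    (hfy : f * y < 1) (hY : ((y : ℂ) • 1 - Vᴴ * (R * V)).PosSemidef) :
    (B + V * F * Vᴴ).PosDef := by
  have hRB : R * B = 1 := mul_eq_one_comm.mp hBR
  have hRh : Rᴴ = R := isHermitian_inv_of_mul hB.1 hBR
  have hyC : (y : ℂ) ≠ 0 := by exact_mod_cast hy.ne'
  have hy' : star (y : ℂ) = y := Complex.conj_ofReal y
  set M : Matrix m m ℂ := 1 - (y : ℂ)⁻¹ • (R * V * Vᴴ) with hM
  have hMh : Mᴴ = 1 - (y : ℂ)⁻¹ • (V * Vᴴ * R) := by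
    simp only [hM, conjTranspose_sub, conjTranspose_one, conjTranspose_smul, conjTranspose_mul,
      conjTranspose_conjTranspose, hRh, star_inv₀, hy', Matrix.mul_assoc]
  have hBM : B * M = B - (y : ℂ)⁻¹ • (V * Vᴴ) := by
    rw [hM, mul_sub, mul_one, mul_smul_comm]
    congr 2
    rw [← Matrix.mul_assoc, ← Matrix.mul_assoc, hBR, Matrix.one_mul]
  have hMBM : Mᴴ * B * M = B - (2 * (y : ℂ)⁻¹) • (V * Vᴴ) +
      ((y : ℂ)⁻¹ * (y : ℂ)⁻¹) • (V * (Vᴴ * (R * V)) * Vᴴ) := by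
    rw [Matrix.mul_assoc, hBM, hMh, sub_mul, one_mul, mul_sub, smul_mul_assoc, smul_mul_assoc,
      mul_smul_comm, smul_smul]
    have h1 : V * Vᴴ * R * B = V * Vᴴ := by rw [Matrix.mul_assoc, hRB, Matrix.mul_one]
    have h2 : V * Vᴴ * R * (V * Vᴴ) = V * (Vᴴ * (R * V)) * Vᴴ := by
      simp only [Matrix.mul_assoc]
    rw [h1, h2, two_mul, add_smul]
    abel
  have h1 : (B - (y : ℂ)⁻¹ • (V * Vᴴ)).PosSemidef := by
    have heq : B - (y : ℂ)⁻¹ • (V * Vᴴ) = Mᴴ * B * M +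
        V * ((((y⁻¹ * y⁻¹ : ℝ)) : ℂ) • ((y : ℂ) • 1 - Vᴴ * (R * V))) * Vᴴ := by
      rw [hMBM]
      push_cast
      simp only [Matrix.mul_sub, Matrix.sub_mul, smul_sub, smul_smul, Matrix.mul_smul, Matrix.smul_mul,
        Matrix.mul_one]
      rw [show (y : ℂ)⁻¹ * (y : ℂ)⁻¹ * (y : ℂ) = (y : ℂ)⁻¹ by field_simp, two_mul, add_smul]
      abel
    rw [heq]
    refine (hB.posSemidef.conjTranspose_mul_mul_same M).add ?_
    exact (smul_posSemidef hY (by positivity)).mul_mul_conjTranspose_same V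
  have heq : B + V * F * Vᴴ = (((1 - f * y : ℝ)) : ℂ) • B +
      ((((f * y : ℝ)) : ℂ) • (B - (y : ℂ)⁻¹ • (V * Vᴴ)) + V * (F + (f : ℂ) • 1) * Vᴴ) := by
    push_cast
    simp only [Matrix.mul_add, Matrix.add_mul, smul_sub, smul_smul, Matrix.mul_smul, Matrix.smul_mul,
      Matrix.mul_one, sub_smul, one_smul]
    rw [show (f : ℂ) * y * (y : ℂ)⁻¹ = f by field_simp]
    abel
  rw [heq]
  refine PosDef.add_posSemidef ?_ ?_
  · exact hB.smul (by exact_mod_cast sub_pos.mpr hfy)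
  · exact (smul_posSemidef h1 (by positivity)).add (hF.mul_mul_conjTranspose_same V)

lemma inverse_update {m k : Type*} [Fintype m] [Fintype k] [DecidableEq m] [DecidableEq k]
    {B R : Matrix m m ℂ} (hBR : B * R = 1) (V : Matrix m k ℂ) {F S : Matrix k k ℂ}
    (hF : F * F = 1) (hS : (F + Vᴴ * (R * V)) * S = 1) :
    (B + V * F * Vᴴ) * (R - R * V * S * (Vᴴ * R)) = 1 := by
  have h1 : F * (Vᴴ * (R * V)) * S = F - S := by
    have : F * ((F + Vᴴ * (R * V)) * S) = F := by rw [hS, mul_one]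
    rw [add_mul, mul_add, ← mul_assoc, hF, one_mul, ← mul_assoc] at this
    rw [eq_sub_iff_add_eq, add_comm]; exact this
  calc (B + V * F * Vᴴ) * (R - R * V * S * (Vᴴ * R))
      = B * R + V * F * Vᴴ * R - (B * R) * V * S * (Vᴴ * R) -
          V * (F * (Vᴴ * (R * V)) * S) * (Vᴴ * R) := by
        simp only [Matrix.mul_sub, Matrix.add_mul, Matrix.mul_assoc]
        abel
    _ = 1 := by
        rw [h1, hBR]
        simp only [Matrix.mul_sub, Matrix.sub_mul, Matrix.mul_assoc, Matrix.one_mul]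
        abel

lemma trace_inverse_update_cube {m k : Type*} [Fintype m] [Fintype k] [DecidableEq m]
    [DecidableEq k] (R : Matrix m m ℂ) (V : Matrix m k ℂ) (S : Matrix k k ℂ) :
    ((R - R * V * S * (Vᴴ * R)) ^ 3).trace = (R ^ 3).trace - 3 * (S * (Vᴴ * (R ^ 4 * V))).trace +
      3 * (S * (Vᴴ * (R ^ 2 * V)) * S * (Vᴴ * (R ^ 3 * V))).trace -
      ((S * (Vᴴ * (R ^ 2 * V))) ^ 2 * S * (Vᴴ * (R ^ 2 * V))).trace := by
  rw [trace_sub_cube]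
  have h1 : (R ^ 2 * (R * V * S * (Vᴴ * R))).trace = (S * (Vᴴ * (R ^ 4 * V))).trace := by
    rw [show R ^ 2 * (R * V * S * (Vᴴ * R)) = (R * R * R * V) * (S * Vᴴ * R) by
      simp only [sq, Matrix.mul_assoc], trace_mul_comm]
    simp only [pow_succ, pow_zero, one_mul, Matrix.mul_assoc]
  have h2 : (R * (R * V * S * (Vᴴ * R)) * (R * V * S * (Vᴴ * R))).trace =
      (S * (Vᴴ * (R ^ 2 * V)) * S * (Vᴴ * (R ^ 3 * V))).trace := by
    rw [show R * (R * V * S * (Vᴴ * R)) * (R * V * S * (Vᴴ * R)) =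
        (R * R * V) * (S * Vᴴ * R * R * V * S * Vᴴ * R) by
      simp only [Matrix.mul_assoc], trace_mul_comm]
    simp only [pow_succ, pow_zero, one_mul, Matrix.mul_assoc]
  have h3 : ((R * V * S * (Vᴴ * R)) ^ 3).trace =
      ((S * (Vᴴ * (R ^ 2 * V))) ^ 2 * S * (Vᴴ * (R ^ 2 * V))).trace := by
    rw [show (R * V * S * (Vᴴ * R)) ^ 3 =
        (R * V) * (S * Vᴴ * R * R * V * S * Vᴴ * R * R * V * S * Vᴴ * R) by
      simp only [pow_succ, pow_zero, one_mul, Matrix.mul_assoc], trace_mul_comm]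
    simp only [pow_succ, pow_zero, one_mul, Matrix.mul_assoc]
  rw [h1, h2, h3]

end Update

section UpdateGood

open scoped Matrix.Norms.L2Operator MatrixOrder

set_option linter.unusedSectionVars false

variable {ι κ δ : Type*} [Fintype ι] [Fintype κ] [Fintype δ] [DecidableEq ι] [DecidableEq κ]
  [DecidableEq δ]

/-- The vectors for which the quadratic forms entering the update are close to their means. -/
def goodSet (κ : Type*) [Fintype κ] [DecidableEq κ] (R : Matrix (ι × δ) (ι × δ) ℂ) (e θ : ℝ) :
    Set (κ × δ → ℂ) :=
  {v | (∀ i j : ι, ∀ a b : κ, ‖qf (Matrix.single a b (1 : ℂ) ⊗ₖ blk R i j) v -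
        (Matrix.single a b (1 : ℂ) ⊗ₖ blk R i j).trace‖ < e) ∧
    ∀ j q p i : ι, ∀ a b : κ,
      ‖qf (Matrix.single a b (1 : ℂ) ⊗ₖ (blk R j q * blk R p i)) v -
        (Matrix.single a b (1 : ℂ) ⊗ₖ (blk R j q * blk R p i)).trace‖ < θ}

lemma norm_one_matrix_le {m : Type*} [Fintype m] [DecidableEq m] : ‖(1 : Matrix m m ℂ)‖ ≤ 1 :=
  norm_le_one_of_conjTranspose_mul_self (by simp)

lemma gram_sub_norm_le {R : Matrix (ι × δ) (ι × δ) ℂ} {e θ : ℝ} (he : 0 ≤ e) {v : κ × δ → ℂ}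
    (hv : v ∈ goodSet κ R e θ) :
    ‖(Vm ι v)ᴴ * (R * Vm ι v) - ptr R ⊗ₖ (1 : Matrix κ κ ℂ)‖ ≤ Fintype.card (ι × κ) * e := by
  refine norm_le_of_entry_le _ he ?_
  rintro ⟨i, a⟩ ⟨j, b⟩
  have h := (hv.1 i j a b).le
  rw [Matrix.sub_apply, Vm_gram_apply]
  rw [trace_single_kronecker] at h
  have h2 : (ptr R ⊗ₖ (1 : Matrix κ κ ℂ)) (i, a) (j, b) =
      if a = b then (blk R i j).trace else 0 := by
    simp only [kroneckerMap_apply, Matrix.one_apply, mul_ite, mul_one, mul_zero]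
    rfl
  rw [h2]
  convert h using 3

lemma ptr_sandwich_sub_norm_le {R : Matrix (ι × δ) (ι × δ) ℂ} {e θ c : ℝ} (hθ : 0 ≤ θ)
    (hc : 0 ≤ c) {v : κ × δ → ℂ} (hv : v ∈ goodSet κ R e θ) {S : Matrix (ι × κ) (ι × κ) ℂ}
    (hS : ‖S‖ ≤ c) :
    ‖ptr (R * (ptr S ⊗ₖ (1 : Matrix δ δ ℂ)) * R) - ptr (R * Vm ι v * S * ((Vm ι v)ᴴ * R))‖ ≤
      Fintype.card ι * ((Fintype.card (ι × κ)) ^ 2 * c * θ) := by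
  refine norm_le_of_entry_le _ (by positivity) fun p q => ?_
  rw [Matrix.sub_apply, ptr_sandwich_apply, ptr_kronecker_sandwich_apply, ← Finset.sum_sub_distrib]
  simp only [← Finset.sum_sub_distrib, ← mul_sub]
  refine (norm_sum_le _ _).trans ?_
  calc ∑ s : ι × κ, ‖∑ t : ι × κ, S s t *
          ((Matrix.single t.2 s.2 (1 : ℂ) ⊗ₖ (blk R t.1 q * blk R p s.1)).trace -
          qf (Matrix.single t.2 s.2 (1 : ℂ) ⊗ₖ (blk R t.1 q * blk R p s.1)) v)‖
      ≤ ∑ s : ι × κ, ∑ t : ι × κ, c * θ := by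
        refine Finset.sum_le_sum fun s _ => (norm_sum_le _ _).trans
          (Finset.sum_le_sum fun t _ => ?_)
        rw [norm_mul]
        refine mul_le_mul ((norm_entry_le_l2 _ _ _).trans hS) ?_ (norm_nonneg _) hc
        rw [norm_sub_rev]
        exact (hv.2 _ _ _ _ _ _).le
    _ = _ := by simp; ring

lemma conj_mono {m k : Type*} [Fintype m] [Fintype k] {A B : Matrix k k ℂ} (h : A ≤ B)
    (V : Matrix m k ℂ) : V * A * Vᴴ ≤ V * B * Vᴴ := by
  rw [Matrix.le_iff] at h ⊢
  rw [← Matrix.sub_mul, ← Matrix.mul_sub]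
  exact h.mul_mul_conjTranspose_same V

lemma kronecker_one_mono {A B : Matrix ι ι ℂ} (h : A ≤ B) :
    A ⊗ₖ (1 : Matrix δ δ ℂ) ≤ B ⊗ₖ (1 : Matrix δ δ ℂ) := by
  rw [Matrix.le_iff] at h ⊢
  have : B ⊗ₖ (1 : Matrix δ δ ℂ) - A ⊗ₖ (1 : Matrix δ δ ℂ) = (B - A) ⊗ₖ (1 : Matrix δ δ ℂ) := by
    ext ⟨i, a⟩ ⟨j, b⟩
    simp [sub_mul]
  rw [this]
  exact h.kronecker PosSemidef.one

lemma smul_one_kronecker_one (r : ℂ) :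
    (r • (1 : Matrix ι ι ℂ)) ⊗ₖ (1 : Matrix δ δ ℂ) = r • 1 := by
  rw [smul_kronecker, one_kronecker_one]

lemma kronecker_one_isHermitian {A : Matrix ι ι ℂ} (h : A.IsHermitian) :
    (A ⊗ₖ (1 : Matrix δ δ ℂ)).IsHermitian := by
  rw [IsHermitian, conjTranspose_kronecker, h.eq, conjTranspose_one]

lemma gram_posSemidef {A : Matrix (ι × δ) (ι × δ) ℂ} (hA : A.PosSemidef) (v : κ × δ → ℂ) :
    ((Vm ι v)ᴴ * (A * Vm ι v)).PosSemidef := by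
  rw [← Matrix.mul_assoc]
  exact hA.conjTranspose_mul_mul_same _

lemma trace_gram_re (A : Matrix (ι × δ) (ι × δ) ℂ) (v : κ × δ → ℂ) :
    ((Vm ι v)ᴴ * (A * Vm ι v)).trace.re = (qf (Km (1 : Matrix (ι × κ) (ι × κ) ℂ) A) v).re := by
  rw [← trace_mul_gram, Matrix.one_mul]

lemma norm_trace_update_terms_le {m : Type*} [Fintype m] [DecidableEq m]
    {S' Y2 Y3 : Matrix m m ℂ} {C y2 y3 : ℝ} (hC : 0 < C) (hS'C : ‖S'‖ ≤ 2 * C)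
    (hP2 : Y2.PosSemidef) (hP3 : Y3.PosSemidef)
    (ht2 : Y2.trace.re = y2) (ht3 : Y3.trace.re = y3) :
    ‖(S' * Y2 * S' * Y3).trace‖ ≤ 4 * C ^ 2 * y2 * y3 ∧
    ‖((S' * Y2) ^ 2 * S' * Y2).trace‖ ≤ 8 * C ^ 3 * y2 ^ 3 := by
  have hy20 : 0 ≤ y2 := ht2 ▸ posSemidef_trace_re_nonneg hP2
  have hy30 : 0 ≤ y3 := ht3 ▸ posSemidef_trace_re_nonneg hP3
  have hn2 : ‖Y2‖ ≤ y2 := ht2 ▸ norm_le_trace hP2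
  have hC2 : 0 ≤ 2 * C * y2 := by positivity
  have hSY2 : ‖S' * Y2‖ ≤ 2 * C * y2 :=
    (norm_mul_le _ _).trans (mul_le_mul hS'C hn2 (norm_nonneg _) (by positivity))
  refine ⟨?_, ?_⟩
  · have h1 := norm_trace_mul_le (S' * Y2 * S') hP3
    have h2 : ‖S' * Y2 * S'‖ ≤ 2 * C * y2 * (2 * C) :=
      (norm_mul_le _ _).trans (mul_le_mul hSY2 hS'C (norm_nonneg _) hC2)
    rw [ht3] at h1
    have h3 := mul_le_mul_of_nonneg_right h2 hy30
    linarith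
  · have h1 := norm_trace_mul_le ((S' * Y2) ^ 2 * S') hP2
    have h2 : ‖(S' * Y2) ^ 2‖ ≤ (2 * C * y2) ^ 2 := by
      rw [sq, sq]
      exact (norm_mul_le _ _).trans (mul_le_mul hSY2 hSY2 (norm_nonneg _) hC2)
    have h3 : ‖(S' * Y2) ^ 2 * S'‖ ≤ (2 * C * y2) ^ 2 * (2 * C) :=
      (norm_mul_le _ _).trans (mul_le_mul h2 hS'C (norm_nonneg _) (by positivity))
    rw [ht2] at h1
    have h4 := mul_le_mul_of_nonneg_right h3 hy20
    linarith

lemma pw_three_update_bounds {R : Matrix (ι × δ) (ι × δ) ℂ} (hRp : R.PosSemidef)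
    {S S' : Matrix (ι × κ) (ι × κ) ℂ} {C₀ g : ℝ} (hC : 0 < C₀) (v : κ × δ → ℂ)
    (hS'C : ‖S'‖ ≤ 2 * C₀) (hS'S : ‖S' - S‖ ≤ 2 * C₀ ^ 2 * g) :
    pw (R - R * Vm ι v * S' * ((Vm ι v)ᴴ * R)) 3 ≤ pw R 3 - 3 * (qf (Km S (R ^ 4)) v).re +
        6 * C₀ ^ 2 * g * (qf (Km (1 : Matrix (ι × κ) (ι × κ) ℂ) (R ^ 4)) v).re +
        (12 * C₀ ^ 2 * (qf (Km (1 : Matrix (ι × κ) (ι × κ) ℂ) (R ^ 2)) v).re *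
          (qf (Km (1 : Matrix (ι × κ) (ι × κ) ℂ) (R ^ 3)) v).re +
        8 * C₀ ^ 3 * (qf (Km (1 : Matrix (ι × κ) (ι × κ) ℂ) (R ^ 2)) v).re ^ 3) := by
  have hP2 := gram_posSemidef (κ := κ) (hRp.pow 2) v
  have hP3 := gram_posSemidef (κ := κ) (hRp.pow 3) v
  have hP4 := gram_posSemidef (κ := κ) (hRp.pow 4) v
  have ht2 := trace_gram_re (R ^ 2) v
  have ht3 := trace_gram_re (R ^ 3) v
  have ht4 := trace_gram_re (R ^ 4) v
  obtain ⟨hb1, hb2⟩ := norm_trace_update_terms_le hC hS'C hP2 hP3 ht2 ht3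
  have hb4 := norm_trace_mul_le (S' - S) hP4
  rw [ht4, Matrix.sub_mul, trace_sub, trace_mul_gram S (R ^ 4) v] at hb4
  have hb5 := hb4.trans (mul_le_mul_of_nonneg_right hS'S
    (ht4 ▸ posSemidef_trace_re_nonneg hP4))
  have hmain := congrArg Complex.re (trace_inverse_update_cube R (Vm ι v) S')
  rw [Complex.sub_re, Complex.add_re, Complex.sub_re] at hmain
  simp only [Complex.mul_re, Complex.re_ofNat, Complex.im_ofNat, zero_mul, sub_zero] at hmain
  have a1 := abs_le.mp ((Complex.abs_re_le_norm _).trans hb1)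
  have a2 := abs_le.mp ((Complex.abs_re_le_norm _).trans hb2)
  have a4 := abs_le.mp ((Complex.abs_re_le_norm _).trans hb5)
  rw [Complex.sub_re] at a4
  simp only [pw]
  rw [hmain]
  linarith

lemma update_good {F : Matrix (ι × κ) (ι × κ) ℂ} {f s C₀ k₀ : ℝ}
    (hD : BarrierData F f s C₀ k₀) {B R : Matrix (ι × δ) (ι × δ) ℂ} (hB : B.PosDef)
    (hBR : B * R = 1) (hT : ptr R ≤ (s : ℂ) • 1) {e θ η g : ℝ} (he0 : 0 < e) (hθ : 0 ≤ θ)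
    (hg : g = Fintype.card (ι × κ) * e)
    (he : C₀ * g ≤ 1 / 2) (hfs : f * (s + g) < 1)
    (hη : Fintype.card κ * (2 * C₀ ^ 2 * g) ≤ η) {S : Matrix (ι × κ) (ι × κ) ℂ}
    (hS : (F + ptr R ⊗ₖ (1 : Matrix κ κ ℂ)) * S = 1) (hSC : ‖S‖ ≤ C₀)
    (hSk : (k₀ : ℂ) • 1 ≤ ptr S) {v : κ × δ → ℂ} (hv : v ∈ goodSet κ R e θ) :
    ∃ R', (B + Vm ι v * F * (Vm ι v)ᴴ).PosDef ∧ (B + Vm ι v * F * (Vm ι v)ᴴ) * R' = 1 ∧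
      ptr R' ≤ ptr R - ((k₀ - η : ℝ) : ℂ) • ptr (R ^ 2) +
        ((Fintype.card ι * ((Fintype.card (ι × κ)) ^ 2 * (2 * C₀) * θ) : ℝ) : ℂ) • 1 ∧
      pw R' 3 ≤ pw R 3 - 3 * (qf (Km S (R ^ 4)) v).re +
        6 * C₀ ^ 2 * g * (qf (Km (1 : Matrix (ι × κ) (ι × κ) ℂ) (R ^ 4)) v).re +
        (12 * C₀ ^ 2 * (qf (Km (1 : Matrix (ι × κ) (ι × κ) ℂ) (R ^ 2)) v).re *
          (qf (Km (1 : Matrix (ι × κ) (ι × κ) ℂ) (R ^ 3)) v).re +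
        8 * C₀ ^ 3 * (qf (Km (1 : Matrix (ι × κ) (ι × κ) ℂ) (R ^ 2)) v).re ^ 3) := by
  have hg0 : 0 ≤ g := by rw [hg]; positivity
  have hC := hD.C₀_pos
  have hRh : R.IsHermitian := isHermitian_inv_of_mul hB.1 hBR
  have hRp : R.PosSemidef := by
    rw [← Matrix.inv_eq_right_inv hBR]; exact hB.inv.posSemidef
  set V := Vm ι v with hV
  set Y := Vᴴ * (R * V) with hYdef
  have hYh : Y.IsHermitian := (gram_posSemidef hRp v).1
  have hTh : (ptr R ⊗ₖ (1 : Matrix κ κ ℂ)).IsHermitian :=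
    kronecker_one_isHermitian (ptr_isHermitian hRh)
  have hE : ‖Y - ptr R ⊗ₖ (1 : Matrix κ κ ℂ)‖ ≤ g := hg ▸ gram_sub_norm_le he0.le hv
  have hSh : S.IsHermitian := isHermitian_inv_of_mul (hD.herm.add hTh) hS
  obtain ⟨S', hS', hS'C, hS'S⟩ := neumann_inverse hS hSC hE he
  rw [show F + ptr R ⊗ₖ (1 : Matrix κ κ ℂ) + (Y - ptr R ⊗ₖ (1 : Matrix κ κ ℂ)) = F + Y by abel]
    at hS'
  have hS'h : S'.IsHermitian := isHermitian_inv_of_mul (hD.herm.add hYh) hS'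
  have hYle : Y ≤ ((s + g : ℝ) : ℂ) • 1 := by
    have h1 := isHermitian_le_norm (hYh.sub hTh) hE
    have h2 : ptr R ⊗ₖ (1 : Matrix κ κ ℂ) ≤ (s : ℂ) • 1 := by
      have := kronecker_one_mono (δ := κ) hT
      rwa [smul_one_kronecker_one] at this
    have h3 := add_le_add h1 h2
    rw [sub_add_cancel, ← add_smul, add_comm (g : ℂ)] at h3
    push_cast
    exact h3
  have hinv := inverse_update hBR V hD.sq hS'
  refine ⟨R - R * V * S' * (Vᴴ * R), ?_, hinv, ?_, ?_⟩
  · exact posDef_update hB hBR V hD.f_nonneg hD.lower (by linarith [hD.s_pos]) hfs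
      (Matrix.le_iff.mp hYle)
  · set η' := 2 * C₀ ^ 2 * g with hη'
    have hη'0 : 0 ≤ η' := by positivity
    set S₁ := S - (η' : ℂ) • 1 with hS₁
    have hS₁le : S₁ ≤ S' := by
      have h1 := isHermitian_le_norm (t := η') (hSh.sub hS'h) (by rw [norm_sub_rev]; exact hS'S)
      rw [hS₁, sub_le_comm]; exact h1
    have hS₁h : S₁.IsHermitian := by
      refine hSh.sub ?_
      rw [IsHermitian, conjTranspose_smul, conjTranspose_one]
      congr 1
      exact Complex.conj_ofReal _
    have hS₁C : ‖S₁‖ ≤ 2 * C₀ := by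
      have hη'C : η' ≤ C₀ := by rw [hη']; nlinarith
      have h1 : ‖(η' : ℂ) • (1 : Matrix (ι × κ) (ι × κ) ℂ)‖ ≤ η' := by
        rw [norm_smul, Complex.norm_real, Real.norm_of_nonneg hη'0]
        exact mul_le_of_le_one_right hη'0 norm_one_matrix_le
      calc ‖S₁‖ ≤ ‖S‖ + ‖(η' : ℂ) • (1 : Matrix (ι × κ) (ι × κ) ℂ)‖ := norm_sub_le _ _
        _ ≤ 2 * C₀ := by linarith
    have hsand : ∀ W : Matrix (ι × κ) (ι × κ) ℂ, R * V * W * (Vᴴ * R) = (R * V) * W * (R * V)ᴴ := by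
      intro W
      rw [conjTranspose_mul, hRh.eq]
    have h1 : ptr (R * V * S₁ * (Vᴴ * R)) ≤ ptr (R * V * S' * (Vᴴ * R)) := by
      refine ptr_mono ?_
      rw [hsand, hsand]
      exact conj_mono hS₁le _
    have h2 := ptr_sandwich_sub_norm_le hθ (by positivity : (0 : ℝ) ≤ 2 * C₀) hv hS₁C
    have hherm1 : (ptr (R * (ptr S₁ ⊗ₖ (1 : Matrix δ δ ℂ)) * R)).IsHermitian := by
      refine ptr_isHermitian ?_
      have := isHermitian_mul_mul_conjTranspose R
        (kronecker_one_isHermitian (δ := δ) (ptr_isHermitian hS₁h))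
      rwa [hRh.eq] at this
    have hherm2 : (ptr (R * V * S₁ * (Vᴴ * R))).IsHermitian := by
      refine ptr_isHermitian ?_
      rw [hsand]
      exact isHermitian_mul_mul_conjTranspose _ hS₁h
    have h3 := isHermitian_le_norm (hherm1.sub hherm2) h2
    have h4 : ((k₀ - η : ℝ) : ℂ) • 1 ≤ ptr S₁ := by
      rw [hS₁, ptr_sub, ptr_smul, ptr_one, smul_smul]
      have h5 : ((η' : ℂ) * (Fintype.card κ : ℂ)) • (1 : Matrix ι ι ℂ) ≤ (η : ℂ) • 1 := by
        have := algebraMap_mono (Matrix ι ι ℂ) hη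
        rw [algebraMap_real_eq, algebraMap_real_eq] at this
        push_cast at this ⊢
        rw [mul_comm]
        exact this
      push_cast
      rw [sub_smul]
      exact sub_le_sub hSk h5
    have h5 : ((k₀ - η : ℝ) : ℂ) • ptr (R ^ 2) ≤ ptr (R * (ptr S₁ ⊗ₖ (1 : Matrix δ δ ℂ)) * R) := by
      have h6 := conj_mono (kronecker_one_mono (δ := δ) h4) R
      rw [smul_one_kronecker_one, hRh.eq, Matrix.mul_smul, Matrix.mul_one, Matrix.smul_mul] at h6
      have h7 := ptr_mono h6
      rwa [ptr_smul, ← sq] at h7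
    rw [ptr_sub]
    have h6 := add_le_add (add_le_add h3 h5) h1
    have h7 := sub_nonneg.mpr h6
    rw [← sub_nonneg]
    convert h7 using 1
    abel
  · exact pw_three_update_bounds hRp hC v hS'C hS'S

end UpdateGood

section UpdateIntegral

open scoped Matrix.Norms.L2Operator MatrixOrder

lemma one_add_pow_eight_le (u : ℝ) : (1 + u) ^ 8 ≤ 1 + 8 * u + 28 * u ^ 2 * (1 + |u|) ^ 6 := by
  set a := |u| with ha
  have ha0 : 0 ≤ a := abs_nonneg u
  have h2 : u ^ 2 = a ^ 2 := (sq_abs u).symm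
  have h3 : u ^ 3 ≤ a ^ 3 := by
    rw [ha, ← abs_pow]; exact le_abs_self _
  have h5 : u ^ 5 ≤ a ^ 5 := by
    rw [ha, ← abs_pow]; exact le_abs_self _
  have h7 : u ^ 7 ≤ a ^ 7 := by
    rw [ha, ← abs_pow]; exact le_abs_self _
  have h4 : u ^ 4 = a ^ 4 := by rw [show 4 = 2 * 2 from rfl, pow_mul, pow_mul, h2]
  have h6 : u ^ 6 = a ^ 6 := by rw [show 6 = 2 * 3 from rfl, pow_mul, pow_mul, h2]
  have h8 : u ^ 8 = a ^ 8 := by rw [show 8 = 2 * 4 from rfl, pow_mul, pow_mul, h2]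
  have hL : (1 + u) ^ 8 = 1 + 8 * u + 28 * u ^ 2 + 56 * u ^ 3 + 70 * u ^ 4 + 56 * u ^ 5 +
      28 * u ^ 6 + 8 * u ^ 7 + u ^ 8 := by ring
  have hR : 28 * u ^ 2 * (1 + a) ^ 6 = 28 * u ^ 2 + 56 * a ^ 3 + 70 * a ^ 4 + 56 * a ^ 5 +
      28 * a ^ 6 + 8 * a ^ 7 + a ^ 8 + (112 * a ^ 3 + 350 * a ^ 4 + 504 * a ^ 5 + 392 * a ^ 6 +
      160 * a ^ 7 + 27 * a ^ 8) := by rw [h2]; ring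
  have hpos : 0 ≤ 112 * a ^ 3 + 350 * a ^ 4 + 504 * a ^ 5 + 392 * a ^ 6 +
      160 * a ^ 7 + 27 * a ^ 8 := by positivity
  rw [hL, hR, h4, h6, h8]
  linarith

/-- The constant in the eighth power estimate. -/
def potC (C₀ K : ℝ) : ℝ :=
  8 * (6 * C₀ + 12 * C₀ ^ 2 + 8 * C₀ ^ 3 * K) +
    28 * (6 * C₀ + 12 * C₀ ^ 2 + 8 * C₀ ^ 3 * K) ^ 2 *
      (1 + (6 * C₀ + 12 * C₀ ^ 2 + 8 * C₀ ^ 3 * K)) ^ 6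

lemma eighth_power_bound {C₀ K g p2 p3 p4 z q : ℝ} (hC : 0 < C₀) (hK : 0 ≤ K)
    (hg : C₀ * g ≤ 1 / 2) (hg0 : 0 ≤ g) (hp2 : 0 < p2) (hp21 : p2 ≤ 1) (hp3 : 0 < p3)
    (hp4 : 0 < p4) (h43 : p4 ^ 2 ≤ p3 ^ 2 * p2) (h23 : p2 ^ 2 ≤ K * p3) {y2 y3 y4 : ℝ}
    (hy2 : 0 ≤ y2) (hy3 : 0 ≤ y3) (hy4 : 0 ≤ y4)
    (hz2 : y2 ≤ p2 * z) (hz3 : y3 ≤ p3 * z) (hz4 : y4 ≤ p4 * z) (hq : |q| ≤ C₀ * y4) :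
    (p3 - 3 * q + 6 * C₀ ^ 2 * g * y4 + (12 * C₀ ^ 2 * y2 * y3 + 8 * C₀ ^ 3 * y2 ^ 3)) ^ 8 ≤
      p3 ^ 8 + 8 * p3 ^ 7 * (-3 * q + 6 * C₀ ^ 2 * g * y4) +
        potC C₀ K * p2 * p3 ^ 8 * (1 + z) ^ 24 := by
  have hz : 0 ≤ z := by
    by_contra h
    push Not at h
    nlinarith
  set L := 6 * C₀ + 12 * C₀ ^ 2 + 8 * C₀ ^ 3 * K with hL
  have hL0 : 0 ≤ L := by positivity
  set r := √p2 with hr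
  have hr0 : 0 ≤ r := Real.sqrt_nonneg _
  have hL6 : 6 * C₀ ≤ L := by
    have : 0 ≤ 12 * C₀ ^ 2 + 8 * C₀ ^ 3 * K := by positivity
    linarith
  have hrr : r ^ 2 = p2 := Real.sq_sqrt hp2.le
  have hr1 : r ≤ 1 := by rw [hr]; exact Real.sqrt_le_one.mpr hp21
  have hp2r : p2 ≤ r := by nlinarith
  have hp4r : p4 ≤ p3 * r := by
    refine (pow_le_pow_iff_left₀ hp4.le (by positivity) two_ne_zero).mp ?_
    rw [mul_pow, hrr]; exact h43
  set w := 1 + z with hw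
  have hw1 : 1 ≤ w := by linarith
  have hw0 : 0 ≤ w := by linarith
  have hzw : z ≤ w := by linarith
  clear_value w r L
  have hzw3 : z ≤ w ^ 3 := hzw.trans (le_self_pow₀ hw1 (by norm_num))
  have hz2w3 : z ^ 2 ≤ w ^ 3 := (pow_le_pow_left₀ hz hzw 2).trans
    (pow_le_pow_right₀ hw1 (by norm_num))
  have hz3w3 : z ^ 3 ≤ w ^ 3 := pow_le_pow_left₀ hz hzw 3
  set E2 := 12 * C₀ ^ 2 * y2 * y3 + 8 * C₀ ^ 3 * y2 ^ 3 with hE2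
  have hE20 : 0 ≤ E2 := by positivity
  have hE2b : E2 ≤ (12 * C₀ ^ 2 + 8 * C₀ ^ 3 * K) * (p2 * p3 * w ^ 3) := by
    have h1 : y2 * y3 ≤ p2 * p3 * w ^ 3 := by
      calc y2 * y3 ≤ (p2 * z) * (p3 * z) := mul_le_mul hz2 hz3 hy3 (by positivity)
        _ = p2 * p3 * z ^ 2 := by ring
        _ ≤ _ := by gcongr
    have h2 : y2 ^ 3 ≤ K * (p2 * p3 * w ^ 3) := by
      calc y2 ^ 3 ≤ (p2 * z) ^ 3 := pow_le_pow_left₀ hy2 hz2 3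
        _ = p2 * p2 ^ 2 * z ^ 3 := by ring
        _ ≤ p2 * (K * p3) * w ^ 3 := by gcongr
        _ = _ := by ring
    calc E2 = 12 * C₀ ^ 2 * (y2 * y3) + 8 * C₀ ^ 3 * y2 ^ 3 := by rw [hE2]; ring
      _ ≤ 12 * C₀ ^ 2 * (p2 * p3 * w ^ 3) + 8 * C₀ ^ 3 * (K * (p2 * p3 * w ^ 3)) := by gcongr
      _ = _ := by ring
  have hE2L : E2 ≤ L * (p2 * p3 * w ^ 24) := by
    refine hE2b.trans (mul_le_mul ?_ ?_ (by positivity) hL0)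
    · rw [hL]; linarith
    · gcongr
      norm_num
  set Δ := -3 * q + 6 * C₀ ^ 2 * g * y4 + E2 with hΔ
  have hΔ1 : |Δ| ≤ 6 * C₀ * y4 + E2 := by
    have hgy : 6 * C₀ ^ 2 * g * y4 ≤ 3 * (C₀ * y4) := by
      have : 6 * C₀ ^ 2 * g * y4 = 6 * (C₀ * g) * (C₀ * y4) := by ring
      rw [this]
      have : 0 ≤ C₀ * y4 := by positivity
      nlinarith
    have hgy0 : 0 ≤ 6 * C₀ ^ 2 * g * y4 := by positivity
    have := abs_le.mp hq
    exact abs_le.mpr ⟨by rw [hΔ]; linarith, by rw [hΔ]; linarith⟩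
  have hΔ2 : |Δ| ≤ p3 * (L * r * w ^ 3) := by
    refine hΔ1.trans ?_
    have h1 : y4 ≤ p3 * r * w ^ 3 := by
      calc y4 ≤ p4 * z := hz4
        _ ≤ p3 * r * w ^ 3 := mul_le_mul hp4r hzw3 hz (by positivity)
    have h2 : p2 * p3 * w ^ 3 ≤ p3 * r * w ^ 3 := by
      rw [mul_comm p2]; gcongr
    calc 6 * C₀ * y4 + E2 ≤ 6 * C₀ * (p3 * r * w ^ 3) +
          (12 * C₀ ^ 2 + 8 * C₀ ^ 3 * K) * (p3 * r * w ^ 3) :=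
          add_le_add (by gcongr) (hE2b.trans (by gcongr))
      _ = _ := by rw [hL]; ring
  set u := Δ / p3 with hu
  have hΔu : Δ = p3 * u := by rw [hu]; field_simp
  have hua : |u| ≤ L * r * w ^ 3 := by
    rw [hu, abs_div, abs_of_pos hp3, div_le_iff₀ hp3, mul_comm]; exact hΔ2
  have hu2 : u ^ 2 ≤ L ^ 2 * p2 * w ^ 6 := by
    calc u ^ 2 = |u| ^ 2 := (sq_abs u).symm
      _ ≤ (L * r * w ^ 3) ^ 2 := pow_le_pow_left₀ (abs_nonneg _) hua 2
      _ = L ^ 2 * r ^ 2 * w ^ 6 := by ring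
      _ = _ := by rw [hrr]
  have hu6 : (1 + |u|) ^ 6 ≤ (1 + L) ^ 6 * w ^ 18 := by
    have h1 : 1 + |u| ≤ (1 + L) * w ^ 3 := by
      have h2 : (1 : ℝ) ≤ w ^ 3 := one_le_pow₀ hw1
      have h3 : L * r * w ^ 3 ≤ L * w ^ 3 := by
        have : L * r ≤ L := mul_le_of_le_one_right hL0 hr1
        gcongr
      linarith
    calc (1 + |u|) ^ 6 ≤ ((1 + L) * w ^ 3) ^ 6 := pow_le_pow_left₀ (by positivity) h1 6
      _ = _ := by rw [mul_pow, ← pow_mul]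
  have hmain := one_add_pow_eight_le u
  have hpot : potC C₀ K = 8 * L + 28 * L ^ 2 * (1 + L) ^ 6 := by rw [potC, ← hL]
  have hP0 : 0 ≤ (1 + L) ^ 6 := by positivity
  generalize (1 + L) ^ 6 = P at *
  have hmul : u ^ 2 * (1 + |u|) ^ 6 ≤ L ^ 2 * P * p2 * w ^ 24 := by
    calc u ^ 2 * (1 + |u|) ^ 6 ≤ (L ^ 2 * p2 * w ^ 6) * (P * w ^ 18) :=
          mul_le_mul hu2 hu6 (by positivity) (by positivity)
      _ = _ := by ring
  have hp38 : 0 < p3 ^ 8 := by positivity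
  calc (p3 - 3 * q + 6 * C₀ ^ 2 * g * y4 + E2) ^ 8 = p3 ^ 8 * (1 + u) ^ 8 := by
        rw [← mul_pow]; congr 1; rw [mul_add, ← hΔu, hΔ]; ring
    _ ≤ p3 ^ 8 * (1 + 8 * u + 28 * (L ^ 2 * P * p2 * w ^ 24)) := by
        refine mul_le_mul_of_nonneg_left ?_ hp38.le
        linarith
    _ = p3 ^ 8 + 8 * p3 ^ 7 * (p3 * u) + 28 * L ^ 2 * P * p2 * p3 ^ 8 * w ^ 24 := by ring
    _ = p3 ^ 8 + 8 * p3 ^ 7 * (-3 * q + 6 * C₀ ^ 2 * g * y4) + 8 * p3 ^ 7 * E2 +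
        28 * L ^ 2 * P * p2 * p3 ^ 8 * w ^ 24 := by rw [← hΔu, hΔ]; ring
    _ ≤ p3 ^ 8 + 8 * p3 ^ 7 * (-3 * q + 6 * C₀ ^ 2 * g * y4) +
        8 * p3 ^ 7 * (L * (p2 * p3 * w ^ 24)) +
        28 * L ^ 2 * P * p2 * p3 ^ 8 * w ^ 24 := by gcongr
    _ = _ := by rw [hpot]; ring

variable {ι κ δ : Type} [Fintype ι] [Fintype κ] [Fintype δ] [DecidableEq ι] [DecidableEq κ]
  [DecidableEq δ]

lemma abs_qf_Km_le {S : Matrix (ι × κ) (ι × κ) ℂ} {C : ℝ} (hS : ‖S‖ ≤ C)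
    {A : Matrix (ι × δ) (ι × δ) ℂ} (hA : A.PosSemidef) (v : κ × δ → ℂ) :
    |(qf (Km S A) v).re| ≤ C * (qf (Km (1 : Matrix (ι × κ) (ι × κ) ℂ) A) v).re := by
  have hP := gram_posSemidef (κ := κ) hA v
  have h := norm_trace_mul_le S hP
  rw [trace_mul_gram, trace_gram_re] at h
  refine (Complex.abs_re_le_norm _).trans (h.trans (mul_le_mul_of_nonneg_right hS ?_))
  exact posSemidef_qf_nonneg (Km_one_posSemidef hA) v

lemma le_integral_qf_Km {S : Matrix (ι × κ) (ι × κ) ℂ} {k₀ : ℝ} (hSh : S.IsHermitian)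
    (hk : (k₀ : ℂ) • 1 ≤ ptr S) {A : Matrix (ι × δ) (ι × δ) ℂ} (hA : A.PosSemidef) :
    k₀ * A.trace.re ≤ ∫ v, (qf (Km S A) v).re ∂(gvec (κ × δ)) := by
  rw [gvec_integral_herm (Km_isHermitian hSh hA.1), trace_Km]
  have h1 : 0 ≤ ((ptr S - (k₀ : ℂ) • 1) * ptr A).trace.re := by
    obtain ⟨Q, hQ⟩ := CStarAlgebra.nonneg_iff_eq_star_mul_self.mp (ptr_posSemidef hA).nonneg
    rw [hQ, star_eq_conjTranspose, ← Matrix.mul_assoc, trace_mul_comm, ← Matrix.mul_assoc]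
    exact posSemidef_trace_re_nonneg ((Matrix.le_iff.mp hk).mul_mul_conjTranspose_same Q)
  rw [Matrix.sub_mul, trace_sub, smul_mul_assoc, Matrix.one_mul, trace_smul, trace_ptr,
    Complex.sub_re, smul_eq_mul, Complex.re_ofReal_mul] at h1
  linarith

/-- Expected growth of the eighth power of `Tr R³` under the random update. -/
lemma update_integral (κ : Type) [Fintype κ] [DecidableEq κ] [Nonempty κ]
    {C₀ K : ℝ} (hC : 0 < C₀) (hK : 0 ≤ K) : ∃ C : ℝ, 0 ≤ C ∧
    ∀ (δ : Type) [Fintype δ] [DecidableEq δ] [Nonempty δ] [Nonempty ι]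
      (R : Matrix (ι × δ) (ι × δ) ℂ) (S : Matrix (ι × κ) (ι × κ) ℂ) (k₀ g : ℝ),
      R.PosDef → S.IsHermitian → ‖S‖ ≤ C₀ → (k₀ : ℂ) • 1 ≤ ptr S → pw R 1 ≤ K → pw R 2 ≤ 1 →
      0 ≤ g → C₀ * g ≤ 1 / 2 →
      Integrable (fun v => (pw R 3 - 3 * (qf (Km S (R ^ 4)) v).re +
        6 * C₀ ^ 2 * g * (qf (Km (1 : Matrix (ι × κ) (ι × κ) ℂ) (R ^ 4)) v).re +
        (12 * C₀ ^ 2 * (qf (Km (1 : Matrix (ι × κ) (ι × κ) ℂ) (R ^ 2)) v).re *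
          (qf (Km (1 : Matrix (ι × κ) (ι × κ) ℂ) (R ^ 3)) v).re +
        8 * C₀ ^ 3 * (qf (Km (1 : Matrix (ι × κ) (ι × κ) ℂ) (R ^ 2)) v).re ^ 3)) ^ 8)
        (gvec (κ × δ)) ∧
      ∫ v, (pw R 3 - 3 * (qf (Km S (R ^ 4)) v).re +
        6 * C₀ ^ 2 * g * (qf (Km (1 : Matrix (ι × κ) (ι × κ) ℂ) (R ^ 4)) v).re +
        (12 * C₀ ^ 2 * (qf (Km (1 : Matrix (ι × κ) (ι × κ) ℂ) (R ^ 2)) v).re *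
          (qf (Km (1 : Matrix (ι × κ) (ι × κ) ℂ) (R ^ 3)) v).re +
        8 * C₀ ^ 3 * (qf (Km (1 : Matrix (ι × κ) (ι × κ) ℂ) (R ^ 2)) v).re ^ 3)) ^ 8
        ∂(gvec (κ × δ)) ≤
      pw R 3 ^ 8 - 24 * (k₀ - Fintype.card κ * (2 * C₀ ^ 2 * g)) * pw R 3 ^ 7 * pw R 4 +
        C * pw R 2 * pw R 3 ^ 8 := by
  have hκ : (0 : ℝ) < 3 * Fintype.card κ := by
    have : 0 < Fintype.card κ := Fintype.card_pos
    positivity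
  obtain ⟨Cm, hCm, hmom⟩ := gvec_moment 24 hκ
  have hpC : 0 ≤ potC C₀ K := by unfold potC; positivity
  refine ⟨potC C₀ K * Cm, by positivity, ?_⟩
  intro δ _ _ _ _ R S k₀ g hR hSh hSC hSk hp1 hp2 hg0 hg
  have hRp := hR.posSemidef
  have hp2p := pw_pos hR 2
  have hp3p := pw_pos hR 3
  have hp4p := pw_pos hR 4
  set p2 := pw R 2 with hp2d
  set p3 := pw R 3 with hp3d
  set p4 := pw R 4 with hp4d
  have h43 : p4 ^ 2 ≤ p3 ^ 2 * p2 := pw_four_sq_le hRp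
  have h23 : p2 ^ 2 ≤ K * p3 := (pw_two_sq_le hRp).trans (by gcongr)
  set M2 := Km (1 : Matrix (ι × κ) (ι × κ) ℂ) (R ^ 2) with hM2d
  set M3 := Km (1 : Matrix (ι × κ) (ι × κ) ℂ) (R ^ 3) with hM3d
  set M4 := Km (1 : Matrix (ι × κ) (ι × κ) ℂ) (R ^ 4) with hM4d
  set MS := Km S (R ^ 4) with hMSd
  have hM2 : M2.PosSemidef := Km_one_posSemidef (hRp.pow 2)
  have hM3 : M3.PosSemidef := Km_one_posSemidef (hRp.pow 3)
  have hM4 : M4.PosSemidef := Km_one_posSemidef (hRp.pow 4)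
  have hMS : MS.IsHermitian := Km_isHermitian hSh (hRp.pow 4).1
  have htr : ∀ k, (Km (1 : Matrix (ι × κ) (ι × κ) ℂ) (R ^ k)).trace.re =
      Fintype.card κ * pw R k := by
    intro k
    rw [trace_Km_one, ← Complex.ofReal_natCast, Complex.re_ofReal_mul, pw]
  clear_value p2 p3 p4 M2 M3 M4 MS
  set M := ((p2⁻¹ : ℝ) : ℂ) • M2 + ((p3⁻¹ : ℝ) : ℂ) • M3 + ((p4⁻¹ : ℝ) : ℂ) • M4 with hM
  have hMp : M.PosSemidef := ((smul_posSemidef hM2 (by positivity)).add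
    (smul_posSemidef hM3 (by positivity))).add (smul_posSemidef hM4 (by positivity))
  have hMt : M.trace.re ≤ 3 * Fintype.card κ := by
    rw [hM, trace_add, trace_add, trace_smul, trace_smul, trace_smul]
    simp only [Complex.add_re, smul_eq_mul, Complex.re_ofReal_mul]
    rw [hM2d, hM3d, hM4d, htr, htr, htr, ← hp2d, ← hp3d, ← hp4d]
    refine le_of_eq ?_
    field_simp
    norm_num
  obtain ⟨hintegrable, hle⟩ := hmom (κ × δ) M hMp hMt
  have hMq : ∀ v, (qf M v).re = p2⁻¹ * (qf M2 v).re + p3⁻¹ * (qf M3 v).re +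
      p4⁻¹ * (qf M4 v).re := by
    intro v
    rw [hM, qf_add, qf_add, qf_smul, qf_smul, qf_smul]
    simp only [Complex.add_re, Complex.re_ofReal_mul]
  have hqS : ∀ v, |(qf MS v).re| ≤ C₀ * (qf M4 v).re := by
    intro v
    rw [hMSd, hM4d]
    exact abs_qf_Km_le hSC (hRp.pow 4) v
  clear_value M
  have hpt : ∀ v, (p3 - 3 * (qf MS v).re + 6 * C₀ ^ 2 * g * (qf M4 v).re +
        (12 * C₀ ^ 2 * (qf M2 v).re * (qf M3 v).re + 8 * C₀ ^ 3 * (qf M2 v).re ^ 3)) ^ 8 ≤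
      p3 ^ 8 + 8 * p3 ^ 7 * (-3 * (qf MS v).re + 6 * C₀ ^ 2 * g * (qf M4 v).re) +
        potC C₀ K * p2 * p3 ^ 8 * (1 + (qf M v).re) ^ 24 := by
    intro v
    have hy2 := posSemidef_qf_nonneg hM2 v
    have hy3 := posSemidef_qf_nonneg hM3 v
    have hy4 := posSemidef_qf_nonneg hM4 v
    have hi2 : 0 ≤ p2⁻¹ * (qf M2 v).re := by positivity
    have hi3 : 0 ≤ p3⁻¹ * (qf M3 v).re := by positivity
    have hi4 : 0 ≤ p4⁻¹ * (qf M4 v).re := by positivity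
    refine eighth_power_bound hC hK hg hg0 hp2p hp2 hp3p hp4p h43 h23 hy2 hy3 hy4 ?_ ?_ ?_
      (hqS v)
    · rw [← inv_mul_le_iff₀ hp2p, hMq]; linarith
    · rw [← inv_mul_le_iff₀ hp3p, hMq]; linarith
    · rw [← inv_mul_le_iff₀ hp4p, hMq]; linarith
  have hmS : Measurable fun v => (qf MS v).re := Complex.measurable_re.comp (measurable_qf _)
  have hm2 : Measurable fun v => (qf M2 v).re := Complex.measurable_re.comp (measurable_qf _)
  have hm3 : Measurable fun v => (qf M3 v).re := Complex.measurable_re.comp (measurable_qf _)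
  have hm4 : Measurable fun v => (qf M4 v).re := Complex.measurable_re.comp (measurable_qf _)
  have hiS := gvec_integrable_herm hMS
  have hi4 := gvec_integrable_herm hM4.1
  have hI1 : Integrable (fun v => 8 * p3 ^ 7 * (-3 * (qf MS v).re +
      6 * C₀ ^ 2 * g * (qf M4 v).re)) (gvec (κ × δ)) :=
    ((hiS.const_mul _).add (hi4.const_mul _)).const_mul _
  have hI2 : Integrable (fun v => potC C₀ K * p2 * p3 ^ 8 * (1 + (qf M v).re) ^ 24)
      (gvec (κ × δ)) := hintegrable.const_mul _
  have hI0 : Integrable (fun _ : κ × δ → ℂ => p3 ^ 8) (gvec (κ × δ)) := integrable_const _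
  have hI01 : Integrable (fun v => p3 ^ 8 + 8 * p3 ^ 7 * (-3 * (qf MS v).re +
      6 * C₀ ^ 2 * g * (qf M4 v).re)) (gvec (κ × δ)) := hI0.add hI1
  have hI : Integrable (fun v => p3 ^ 8 + 8 * p3 ^ 7 * (-3 * (qf MS v).re +
      6 * C₀ ^ 2 * g * (qf M4 v).re) + potC C₀ K * p2 * p3 ^ 8 * (1 + (qf M v).re) ^ 24)
      (gvec (κ × δ)) := hI01.add hI2
  have hG : Integrable (fun v => (p3 - 3 * (qf MS v).re + 6 * C₀ ^ 2 * g * (qf M4 v).re +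
        (12 * C₀ ^ 2 * (qf M2 v).re * (qf M3 v).re + 8 * C₀ ^ 3 * (qf M2 v).re ^ 3)) ^ 8)
      (gvec (κ × δ)) := by
    refine hI.mono' (by fun_prop) (Eventually.of_forall fun v => ?_)
    rw [Real.norm_of_nonneg (Even.pow_nonneg (by decide) _)]
    exact hpt v
  refine ⟨hG, (integral_mono hG hI hpt).trans ?_⟩
  rw [integral_add hI01 hI2, integral_add hI0 hI1, integral_const_mul, integral_const_mul,
    integral_add (hiS.const_mul _) (hi4.const_mul _), integral_const_mul, integral_const_mul,
    gvec_integral_herm hM4.1, hM4d, htr, ← hp4d, integral_const, probReal_univ, one_smul]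
  have h1 := le_integral_qf_Km (δ := δ) hSh hSk (hRp.pow 4)
  have h2 : potC C₀ K * p2 * p3 ^ 8 * ∫ v, (1 + (qf M v).re) ^ 24 ∂(gvec (κ × δ)) ≤
      potC C₀ K * p2 * p3 ^ 8 * Cm := by gcongr
  have h3 : k₀ * p4 ≤ ∫ v, (qf MS v).re ∂(gvec (κ × δ)) := by rw [hp4d, hMSd]; exact h1
  have h4 := mul_le_mul_of_nonneg_left h3 (by positivity : (0 : ℝ) ≤ 24 * p3 ^ 7)
  linarith

end UpdateIntegral

section Step

open scoped Matrix.Norms.L2Operator MatrixOrder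

set_option linter.unusedSectionVars false

lemma shift_inverse {m : Type*} [Fintype m] [DecidableEq m] {B R : Matrix m m ℂ} (hR : R.PosDef)
    (hBR : B * R = 1) {β l : ℝ} (hl : ∀ i, hR.1.eigenvalues i ≤ l) (hβ : |β| * l ≤ 1 / 5) :
    ∃ R', (B - (β : ℂ) • 1).PosDef ∧ (B - (β : ℂ) • 1) * R' = 1 ∧ R'.PosDef ∧
      pw R' 3 ≤ 2 * pw R 3 ∧ pw R' 2 ≤ 2 * pw R 2 ∧ pw R' 3 ≤ pw R 3 + 3 * β * pw R' 4 ∧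
      R' ≤ R + (β : ℂ) • R' ^ 2 := by
  set lam := hR.1.eigenvalues with hlam
  set U : Matrix m m ℂ := (hR.1.eigenvectorUnitary : Matrix m m ℂ) with hU
  have hpos : ∀ i, 0 < lam i := hR.eigenvalues_pos
  have hx : ∀ i, |β * lam i| ≤ 1 / 5 := by
    intro i
    rw [abs_mul, abs_of_pos (hpos i)]
    exact (mul_le_mul_of_nonneg_left (hl i) (abs_nonneg β)).trans hβ
  set r : m → ℝ := fun i => lam i / (1 - β * lam i) with hr
  have hden : ∀ i, 4 / 5 ≤ 1 - β * lam i := fun i => by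
    have := (abs_le.mp (hx i)).2; linarith
  have hrpos : ∀ i, 0 < r i := fun i => div_pos (hpos i) (by linarith [hden i])
  have hrlam : ∀ i, r i ≤ 5 / 4 * lam i := by
    intro i
    rw [hr, div_le_iff₀ (by linarith [hden i])]
    nlinarith [hden i, hpos i]
  have hr1 : ∀ i, lam i = r i * (1 - β * lam i) := fun i =>
    (div_mul_cancel₀ _ (ne_of_gt (by linarith [hden i]))).symm
  have hRU : R = U * diagonal (fun i => (lam i : ℂ)) * Uᴴ := isHermitian_eq_conj hR.1
  have hUl : Uᴴ * U = 1 := eigenvectorUnitary_left hR.1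
  have hUr : U * Uᴴ = 1 := eigenvectorUnitary_right hR.1
  have hBU : B = U * diagonal (fun i => ((lam i)⁻¹ : ℂ)) * Uᴴ := by
    have h1 : R * (U * diagonal (fun i => ((lam i)⁻¹ : ℂ)) * Uᴴ) = 1 := by
      rw [hRU]
      calc U * diagonal (fun i => (lam i : ℂ)) * Uᴴ * (U * diagonal (fun i => ((lam i)⁻¹ : ℂ)) * Uᴴ)
          = U * diagonal (fun i => (lam i : ℂ)) * (Uᴴ * U) *
            diagonal (fun i => ((lam i)⁻¹ : ℂ)) * Uᴴ := by simp only [Matrix.mul_assoc]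
        _ = U * (diagonal (fun i => (lam i : ℂ)) * diagonal (fun i => ((lam i)⁻¹ : ℂ))) * Uᴴ := by
            rw [hUl, Matrix.mul_one, Matrix.mul_assoc U]
        _ = 1 := by
            rw [diagonal_mul_diagonal]
            have : (fun i => (lam i : ℂ) * (lam i : ℂ)⁻¹) = fun _ => 1 := by
              funext i
              exact mul_inv_cancel₀ (by exact_mod_cast (hpos i).ne')
            rw [this, diagonal_one, Matrix.mul_one, hUr]
    calc B = B * (R * (U * diagonal (fun i => ((lam i)⁻¹ : ℂ)) * Uᴴ)) := by rw [h1, Matrix.mul_one]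
      _ = _ := by rw [← Matrix.mul_assoc, hBR, Matrix.one_mul]
  set R' := U * diagonal (fun i => (r i : ℂ)) * Uᴴ with hR'
  have hBβ : B - (β : ℂ) • 1 = U * diagonal (fun i => (((r i)⁻¹ : ℝ) : ℂ)) * Uᴴ := by
    have h1 : (β : ℂ) • (1 : Matrix m m ℂ) = U * diagonal (fun _ => (β : ℂ)) * Uᴴ := by
      rw [← smul_one_eq_diagonal, Matrix.mul_smul, Matrix.mul_one, Matrix.smul_mul, hUr]
    rw [h1, hBU, ← Matrix.sub_mul, ← Matrix.mul_sub, diagonal_sub]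
    congr 3
    funext i
    rw [hr, inv_div, sub_div, mul_div_assoc, div_self (hpos i).ne']
    push_cast
    ring
  have hpd : ∀ t : m → ℝ, (∀ i, 0 < t i) → (U * diagonal (fun i => (t i : ℂ)) * Uᴴ).PosDef := by
    intro t ht
    have h1 : (diagonal (fun i => (t i : ℂ))).PosDef :=
      PosDef.diagonal fun i => by exact_mod_cast ht i
    refine h1.mul_mul_conjTranspose_same ?_
    intro x y hxy
    have := congrArg (fun z => z ᵥ* Uᴴ) hxy
    simpa [vecMul_vecMul, hUr] using this
  have hpw : ∀ k, pw R' k = ∑ i, r i ^ k := by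
    intro k
    rw [pw, hR', conj_diagonal_pow hUl hUr, trace_conj_diagonal hUl]
    simp [← Complex.ofReal_pow]
  have hpwR : ∀ k, pw R k = ∑ i, lam i ^ k := pw_eq hR.1
  clear_value r lam
  refine ⟨R', ?_, ?_, hpd r hrpos, ?_, ?_, ?_, ?_⟩
  · rw [hBβ]; exact hpd _ fun i => inv_pos.mpr (hrpos i)
  · rw [hBβ, hR']
    calc U * diagonal (fun i => (((r i)⁻¹ : ℝ) : ℂ)) * Uᴴ * (U * diagonal (fun i => (r i : ℂ)) * Uᴴ)
        = U * diagonal (fun i => (((r i)⁻¹ : ℝ) : ℂ)) * (Uᴴ * U) *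
          diagonal (fun i => (r i : ℂ)) * Uᴴ := by simp only [Matrix.mul_assoc]
      _ = U * (diagonal (fun i => (((r i)⁻¹ : ℝ) : ℂ)) * diagonal (fun i => (r i : ℂ))) * Uᴴ := by
          rw [hUl, Matrix.mul_one, Matrix.mul_assoc U]
      _ = 1 := by
          rw [diagonal_mul_diagonal]
          have : (fun i => (((r i)⁻¹ : ℝ) : ℂ) * (r i : ℂ)) = fun _ => 1 := by
            funext i
            rw [← Complex.ofReal_mul, inv_mul_cancel₀ (hrpos i).ne', Complex.ofReal_one]
          rw [this, diagonal_one, Matrix.mul_one, hUr]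
  · rw [hpw, hpwR, Finset.mul_sum]
    refine Finset.sum_le_sum fun i _ => ?_
    calc r i ^ 3 ≤ (5 / 4 * lam i) ^ 3 := pow_le_pow_left₀ (hrpos i).le (hrlam i) 3
      _ = 125 / 64 * lam i ^ 3 := by ring
      _ ≤ _ := by have := hpos i; gcongr; norm_num
  · rw [hpw, hpwR, Finset.mul_sum]
    refine Finset.sum_le_sum fun i _ => ?_
    calc r i ^ 2 ≤ (5 / 4 * lam i) ^ 2 := pow_le_pow_left₀ (hrpos i).le (hrlam i) 2
      _ = 25 / 16 * lam i ^ 2 := by ring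
      _ ≤ _ := by have := hpos i; gcongr; norm_num
  · rw [hpw, hpw, hpwR, Finset.mul_sum, ← Finset.sum_add_distrib]
    refine Finset.sum_le_sum fun i _ => ?_
    have hd : 0 < 1 - β * lam i := by linarith [hden i]
    have h1 := hr1 i
    have h2 : lam i * (1 + β * r i) = r i := by linear_combination h1
    have h3 : 0 < 1 + β * r i := by
      have := hrpos i; rw [← h2] at this; exact pos_of_mul_pos_right this (hpos i).le
    have h4 : lam i = r i / (1 + β * r i) := by rw [eq_div_iff h3.ne']; exact h2
    rw [h4]
    have h5 : r i ^ 3 + -(3 * β * r i ^ 4) ≤ (r i / (1 + β * r i)) ^ 3 := by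
      rw [div_pow, le_div_iff₀ (by positivity)]
      set y := β * r i with hy
      have h6 : r i ^ 3 + -(3 * β * r i ^ 4) = r i ^ 3 * (1 - 3 * y) := by rw [hy]; ring
      rw [h6, mul_assoc]
      refine mul_le_of_le_one_right (by have := hrpos i; positivity) ?_
      have h7 : 0 ≤ 3 * (1 + y) ^ 2 + 2 * (1 + y) + 1 := by positivity
      nlinarith [mul_nonneg (sq_nonneg y) h7]
    linarith
  · rw [Matrix.le_iff]
    have h1 : R + (β : ℂ) • R' ^ 2 - R' =
        U * diagonal (fun i => ((lam i + β * r i ^ 2 - r i : ℝ) : ℂ)) * Uᴴ := by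
      rw [hR', conj_diagonal_pow hUl hUr, hRU, ← Matrix.smul_mul, ← Matrix.mul_smul,
        ← Matrix.add_mul, ← Matrix.mul_add, ← Matrix.sub_mul, ← Matrix.mul_sub, ← diagonal_smul,
        diagonal_add, diagonal_sub]
      congr 3
      funext i
      simp
    rw [h1]
    refine PosSemidef.mul_mul_conjTranspose_same (PosSemidef.diagonal fun i => ?_) _
    have h2 : 0 ≤ lam i + β * r i ^ 2 - r i := by
      have hd : 0 < 1 - β * lam i := by linarith [hden i]
      have h1 := hr1 i
      have h3 : lam i + β * r i ^ 2 - r i = (β * r i) ^ 2 * lam i := by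
        have h4 : r i - lam i = β * lam i * r i := by linear_combination -h1
        linear_combination (β * r i - 1) * h4
      rw [h3]
      have := hpos i
      positivity
    change (0 : ℂ) ≤ _
    exact_mod_cast h2

end Step

section StepProb

open scoped Matrix.Norms.L2Operator MatrixOrder

set_option linter.unusedSectionVars false

variable {ι κ δ : Type} [Fintype ι] [Fintype κ] [Fintype δ] [DecidableEq ι] [DecidableEq κ]
  [DecidableEq δ]

lemma goodSet_eq (R : Matrix (ι × δ) (ι × δ) ℂ) (e θ : ℝ) : (goodSet κ R e θ)ᶜ =
    (⋃ x : ι × ι × κ × κ, {v | e ≤ ‖qf (Matrix.single x.2.2.1 x.2.2.2 (1 : ℂ) ⊗ₖ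
      blk R x.1 x.2.1) v - (Matrix.single x.2.2.1 x.2.2.2 (1 : ℂ) ⊗ₖ blk R x.1 x.2.1).trace‖}) ∪
    ⋃ x : ι × ι × ι × ι × κ × κ, {v | θ ≤ ‖qf (Matrix.single x.2.2.2.2.1 x.2.2.2.2.2 (1 : ℂ) ⊗ₖ
      (blk R x.1 x.2.1 * blk R x.2.2.1 x.2.2.2.1)) v -
      (Matrix.single x.2.2.2.2.1 x.2.2.2.2.2 (1 : ℂ) ⊗ₖ
      (blk R x.1 x.2.1 * blk R x.2.2.1 x.2.2.2.1)).trace‖} := by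
  ext v
  simp only [goodSet, Set.mem_compl_iff, Set.mem_ofPred_eq, Set.mem_union, Set.mem_iUnion,
    Prod.exists, not_and_or, not_forall, not_lt]

lemma measurableSet_tail {J : Type*} [Fintype J] (C : Matrix J J ℂ) (a : ℂ) (t : ℝ) :
    MeasurableSet {v | t ≤ ‖qf C v - a‖} :=
  measurableSet_le measurable_const ((measurable_qf C).sub_const a).norm

lemma measurableSet_goodSet (R : Matrix (ι × δ) (ι × δ) ℂ) (e θ : ℝ) :
    MeasurableSet (goodSet κ R e θ) := by
  rw [← MeasurableSet.compl_iff, goodSet_eq]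
  exact (MeasurableSet.iUnion fun _ => measurableSet_tail _ _ _).union
    (MeasurableSet.iUnion fun _ => measurableSet_tail _ _ _)

lemma goodSet_compl_le {R : Matrix (ι × δ) (ι × δ) ℂ} (hR : R.IsHermitian) {e θ F2 F4 : ℝ}
    (hF2 : 0 < F2) (hF4 : 0 < F4) (h2 : pw R 2 ≤ F2 ^ 2) (h4 : pw R 4 ≤ F4 ^ 2) :
    (gvec (κ × δ)).real (goodSet κ R e θ)ᶜ ≤
      Fintype.card (ι × ι × κ × κ) * (8 * Real.exp (-(e / (4 * F2)))) +
      Fintype.card (ι × ι × ι × ι × κ × κ) * (8 * Real.exp (-(θ / (4 * F4)))) := by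
  rw [goodSet_eq]
  refine (measureReal_union_le _ _).trans (add_le_add ?_ ?_)
  · refine (measureReal_iUnion_fintype_le _).trans ?_
    rw [← nsmul_eq_mul]
    refine Finset.sum_le_card_nsmul _ _ _ fun x _ => ?_
    refine gvec_tail _ hF2 ?_
    rw [frob2_single_kronecker]
    have h := frob2_pow_eq_pw hR 1
    rw [pow_one] at h
    exact (frob2_blk_le _ _ _).trans (h.le.trans h2)
  · refine (measureReal_iUnion_fintype_le _).trans ?_
    rw [← nsmul_eq_mul]
    refine Finset.sum_le_card_nsmul _ _ _ fun x _ => ?_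
    refine gvec_tail _ hF4 ?_
    rw [frob2_single_kronecker]
    exact (frob2_blk_mul_blk_le hR _ _ _ _).trans h4

lemma pw_one_ptr (R : Matrix (ι × δ) (ι × δ) ℂ) : pw R 1 = (ptr R).trace.re := by
  rw [pw, pow_one, trace_ptr]

lemma eigenvalues_le_of_pw_three {m : Type*} [Fintype m] [DecidableEq m] {R : Matrix m m ℂ}
    (hR : R.PosDef) {l : ℝ} (hl : 0 ≤ l) (h : pw R 3 ≤ l ^ 3) (i : m) :
    hR.1.eigenvalues i ≤ l := by
  rw [pw_eq hR.1] at h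
  have h1 := Finset.single_le_sum (f := fun j => hR.1.eigenvalues j ^ 3)
    (fun j _ => pow_nonneg (hR.eigenvalues_pos j).le 3) (Finset.mem_univ i)
  exact (pow_le_pow_iff_left₀ (hR.eigenvalues_pos i).le hl three_ne_zero).mp (h1.trans h)

lemma smul_le_trace_smul {A : Matrix ι ι ℂ} (hA : A.PosSemidef) (β : ℝ) :
    (β : ℂ) • A ≤ ((|β| * A.trace.re : ℝ) : ℂ) • 1 := by
  refine isHermitian_le_norm ?_ ?_
  · rw [IsHermitian, conjTranspose_smul, hA.1.eq]
    congr 1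
    exact Complex.conj_ofReal _
  · rw [norm_smul, Complex.norm_real, Real.norm_eq_abs]
    exact mul_le_mul_of_nonneg_left (norm_le_trace hA) (abs_nonneg _)

lemma pow_eight_sub_le {x y : ℝ} (hx : 0 ≤ x) (hy : 0 ≤ y) :
    x ^ 8 ≤ y ^ 8 + 8 * x ^ 7 * (x - y) := by
  have h : y ^ 8 + 8 * x ^ 7 * (x - y) - x ^ 8 = (x - y) ^ 2 *
      (7 * x ^ 6 + 6 * x ^ 5 * y + 5 * x ^ 4 * y ^ 2 + 4 * x ^ 3 * y ^ 3 + 3 * x ^ 2 * y ^ 4 +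
        2 * x * y ^ 5 + y ^ 6) := by ring
  have : 0 ≤ (x - y) ^ 2 *
      (7 * x ^ 6 + 6 * x ^ 5 * y + 5 * x ^ 4 * y ^ 2 + 4 * x ^ 3 * y ^ 3 + 3 * x ^ 2 * y ^ 4 +
        2 * x * y ^ 5 + y ^ 6) := by positivity
  linarith

end StepProb

section BarrierStep

open scoped Matrix.Norms.L2Operator MatrixOrder

set_option linter.unusedSectionVars false

variable {ι κ δ : Type} [Fintype ι] [Fintype κ] [Fintype δ] [DecidableEq ι] [DecidableEq κ]
  [DecidableEq δ]

lemma barrier_shift {m : Type*} [Fintype m] [DecidableEq m] {B R : Matrix m m ℂ} (hR : R.PosDef)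
    (hBR : B * R = 1) {β u a : ℝ} (hu0 : 0 < u) (hu1 : u ≤ 1) (h3 : pw R 3 ≤ u ^ 21)
    (ha : 0 ≤ a) (h1 : pw R 1 ≤ a ^ 2) (hβ : |β| * u ≤ 1 / 5) :
    ∃ R', (B - (β : ℂ) • 1).PosDef ∧ (B - (β : ℂ) • 1) * R' = 1 ∧ R'.PosDef ∧
      pw R' 2 ≤ 2 * a * u ^ 10 ∧ pw R' 4 ≤ (2 * u ^ 14) ^ 2 ∧ pw R' 3 ≤ 2 * pw R 3 ∧
      pw R' 3 ≤ pw R 3 + 3 * β * pw R' 4 ∧ R' ≤ R + (β : ℂ) • R' ^ 2 := by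
  have hu7 : u ^ 7 ≤ u := pow_le_of_le_one hu0.le hu1 (by norm_num)
  have hl := eigenvalues_le_of_pw_three hR (l := u ^ 7) (by positivity)
    (h3.trans_eq (by ring))
  obtain ⟨R', hP, hinv, hR', hp3, hp2, hp34, hle⟩ := shift_inverse hR hBR hl
    ((mul_le_mul_of_nonneg_left hu7 (abs_nonneg β)).trans hβ)
  refine ⟨R', hP, hinv, hR', ?_, ?_, hp3, hp34, hle⟩
  · have h2 : pw R 2 ≤ a * u ^ 10 := by
      refine le_of_sq_le_sq ?_ (by positivity)
      calc pw R 2 ^ 2 ≤ pw R 1 * pw R 3 := pw_two_sq_le hR.posSemidef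
        _ ≤ a ^ 2 * u ^ 21 := mul_le_mul h1 h3 (pw_nonneg hR.posSemidef 3) (by positivity)
        _ ≤ a ^ 2 * u ^ 20 := mul_le_mul_of_nonneg_left
            (pow_le_pow_of_le_one hu0.le hu1 (by norm_num)) (by positivity)
        _ = (a * u ^ 10) ^ 2 := by ring
    linarith
  · refine le_of_pow_le_pow_left₀ three_ne_zero (by positivity) ?_
    have h3' : pw R' 3 ≤ 2 * u ^ 21 := by linarith
    calc pw R' 4 ^ 3 ≤ pw R' 3 ^ 4 := pw_four_cube_le hR'.posSemidef
      _ ≤ (2 * u ^ 21) ^ 4 := pow_le_pow_left₀ (pw_nonneg hR'.posSemidef 3) h3' 4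
      _ = 16 * u ^ 84 := by ring
      _ ≤ 64 * u ^ 84 := by gcongr; norm_num
      _ = ((2 * u ^ 14) ^ 2) ^ 3 := by ring

lemma real_smul_one_mono {a b : ℝ} (h : a ≤ b) : (a : ℂ) • (1 : Matrix ι ι ℂ) ≤ (b : ℂ) • 1 := by
  rw [Matrix.le_iff, ← sub_smul, ← Complex.ofReal_sub]
  exact smul_posSemidef PosSemidef.one (sub_nonneg.mpr h)

lemma trace_re_le_of_le {T : Matrix ι ι ℂ} {s : ℝ} (h : T ≤ (s : ℂ) • 1) :
    T.trace.re ≤ Fintype.card ι * s := by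
  have h1 := trace_re_mono h
  simpa [mul_comm] using h1

lemma exp_tail_le {c a u p q : ℝ} (hu0 : 0 < u) (ha : 0 < a) (hc : c ≤ q / a)
    (hq : 0 < q) (hp : p ≤ u) (hp0 : 0 < p) : Real.exp (-(q / (a * p))) ≤ Real.exp (-(c / u)) := by
  rw [Real.exp_le_exp, neg_le_neg_iff, ← div_div]
  calc c / u ≤ (q / a) / u := by gcongr
    _ ≤ (q / a) / p := by gcongr

lemma goodSet_compl_le_exp {R : Matrix (ι × δ) (ι × δ) ℂ} (hR : R.IsHermitian) {e u a c : ℝ}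
    (he : 0 < e) (hu0 : 0 < u) (hu1 : u ≤ 1) (ha : 1 ≤ a) (h2 : pw R 2 ≤ a * u ^ 10)
    (h4 : pw R 4 ≤ (2 * u ^ 14) ^ 2) (hc : c ≤ e / (4 * a)) (hc' : c ≤ 1 / 8) :
    (gvec (κ × δ)).real (goodSet κ R e (u ^ 13))ᶜ ≤
      (Fintype.card (ι × ι × κ × κ) * 8 + Fintype.card (ι × ι × ι × ι × κ × κ) * 8) *
        Real.exp (-(c / u)) := by
  have h2' : pw R 2 ≤ (a * u ^ 5) ^ 2 := by
    refine h2.trans ?_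
    calc a * u ^ 10 ≤ (a * a) * u ^ 10 := by gcongr; nlinarith
      _ = (a * u ^ 5) ^ 2 := by ring
  refine (goodSet_compl_le hR (by positivity) (by positivity) h2' h4).trans ?_
  have e1 : Real.exp (-(e / (4 * (a * u ^ 5)))) ≤ Real.exp (-(c / u)) := by
    rw [← mul_assoc]
    exact exp_tail_le hu0 (by positivity) hc he
      (pow_le_of_le_one hu0.le hu1 (by norm_num)) (by positivity)
  have e2 : Real.exp (-(u ^ 13 / (4 * (2 * u ^ 14)))) ≤ Real.exp (-(c / u)) := by
    rw [show u ^ 13 / (4 * (2 * u ^ 14)) = 1 / (8 * u) by field_simp; norm_num]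
    exact exp_tail_le hu0 (by norm_num) hc' one_pos le_rfl hu0
  have e1' := mul_le_mul_of_nonneg_left e1 (by positivity :
    (0 : ℝ) ≤ Fintype.card (ι × ι × κ × κ) * 8)
  have e2' := mul_le_mul_of_nonneg_left e2 (by positivity :
    (0 : ℝ) ≤ Fintype.card (ι × ι × ι × ι × κ × κ) * 8)
  linarith

/-- Scalar bookkeeping: the drift terms of the update compensate those of the shift. -/
lemma potential_drift {p p' q r k β C K₀ x : ℝ} (hp' : 0 ≤ p') (hp : 0 ≤ p) (h2 : p' ≤ 2 * p)
    (hs : p' ≤ p + 3 * β * q) (hq : 0 ≤ q) (hk : β ≤ k) (hr : 0 ≤ r) (hC : 0 ≤ C)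
    (hx : x ≤ p' ^ 8 - 24 * k * p' ^ 7 * q + C * r * p' ^ 8) (hK : 256 * C ≤ K₀) :
    x ≤ p ^ 8 * Real.exp (K₀ * r) := by
  have h8 := pow_eight_sub_le hp' hp
  have h7 : 8 * p' ^ 7 * (p' - p) ≤ 8 * p' ^ 7 * (3 * β * q) := by gcongr; linarith
  have hk' : 24 * β * (p' ^ 7 * q) ≤ 24 * k * (p' ^ 7 * q) := by gcongr
  have h256 : p' ^ 8 ≤ 256 * p ^ 8 := by
    calc p' ^ 8 ≤ (2 * p) ^ 8 := by gcongr
      _ = 256 * p ^ 8 := by ring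
  have h3 : C * r * p' ^ 8 ≤ K₀ * r * p ^ 8 := by
    calc C * r * p' ^ 8 ≤ C * r * (256 * p ^ 8) := by gcongr
      _ = 256 * C * (r * p ^ 8) := by ring
      _ ≤ K₀ * (r * p ^ 8) := by gcongr
      _ = K₀ * r * p ^ 8 := by ring
  have h4 : p ^ 8 * (K₀ * r + 1) ≤ p ^ 8 * Real.exp (K₀ * r) := by
    gcongr
    exact Real.add_one_le_exp _
  nlinarith

lemma exists_small_parameter {C₀ f s ε N k : ℝ} (hC : 0 < C₀) (hf : 0 ≤ f) (hfs : f * s < 1)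
    (hε : 0 < ε) (hN : 0 < N) (hk : 0 < k) : ∃ e : ℝ, 0 < e ∧ C₀ * (N * e) ≤ 1 / 2 ∧
      f * (s + N * e) < 1 ∧ k * (2 * C₀ ^ 2 * (N * e)) ≤ ε := by
  have hd : 0 < 1 - f * s := by linarith
  set g := min (1 / (2 * C₀)) (min ((1 - f * s) / (2 * (f + 1))) (ε / (k * (2 * C₀ ^ 2)))) with hg
  have hg0 : 0 < g := by positivity
  have g1 : g ≤ 1 / (2 * C₀) := min_le_left _ _
  have g2 : g ≤ (1 - f * s) / (2 * (f + 1)) := (min_le_right _ _).trans (min_le_left _ _)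
  have g3 : g ≤ ε / (k * (2 * C₀ ^ 2)) := (min_le_right _ _).trans (min_le_right _ _)
  clear_value g
  refine ⟨g / N, by positivity, ?_, ?_, ?_⟩ <;> rw [mul_div_cancel₀ _ hN.ne']
  · rw [le_div_iff₀ (by positivity)] at g1; linarith
  · rw [le_div_iff₀ (by positivity)] at g2; nlinarith
  · rw [le_div_iff₀ (by positivity)] at g3; linarith

end BarrierStep

section BarrierStepMain

open scoped Matrix.Norms.L2Operator MatrixOrder

set_option linter.unusedSectionVars false

variable {ι κ : Type} [Fintype ι] [Fintype κ] [DecidableEq ι] [DecidableEq κ]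

/-- The potential controlling the barrier argument. -/
def pot {m : Type*} [Fintype m] [DecidableEq m] (K : ℝ) (R : Matrix m m ℂ) : ℝ :=
  pw R 3 ^ 8 * Real.exp (K * pw R 1)

lemma pot_nonneg {m : Type*} [Fintype m] [DecidableEq m] (K : ℝ) {R : Matrix m m ℂ} :
    0 ≤ pot K R :=
  mul_nonneg (by positivity) (Real.exp_pos _).le

lemma ptr_update_le {δ : Type} [Fintype δ] [DecidableEq δ] {R Rt R' : Matrix (ι × δ) (ι × δ) ℂ}
    {β k ε t : ℝ} (hε : k - β = ε) (h1 : Rt ≤ R + (β : ℂ) • Rt ^ 2)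
    (h2 : ptr R' ≤ ptr Rt - (k : ℂ) • ptr (Rt ^ 2) + (t : ℂ) • 1) :
    ptr R' ≤ ptr R - (ε : ℂ) • ptr (Rt ^ 2) + (t : ℂ) • 1 := by
  refine h2.trans ?_
  have h3 := ptr_mono h1
  rw [ptr_add, ptr_smul] at h3
  calc ptr Rt - (k : ℂ) • ptr (Rt ^ 2) + (t : ℂ) • 1
      ≤ ptr R + (β : ℂ) • ptr (Rt ^ 2) - (k : ℂ) • ptr (Rt ^ 2) + (t : ℂ) • 1 := by gcongr
    _ = ptr R - (ε : ℂ) • ptr (Rt ^ 2) + (t : ℂ) • 1 := by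
      rw [← hε, Complex.ofReal_sub, sub_smul]; abel

/-- One step of the barrier argument: subtract `β` and add one random block rank-one update. -/
lemma barrier_step [Nonempty ι] [Nonempty κ] {F : Matrix (ι × κ) (ι × κ) ℂ} {f s C₀ k₀ s' β : ℝ}
    (hD : BarrierData F f s C₀ k₀) (hs' : s' < s) (hβ : β < k₀) :
    ∃ K C c u₀ A : ℝ, 0 ≤ K ∧ 0 ≤ C ∧ 0 < c ∧ 0 < u₀ ∧ 0 ≤ A ∧
    ∀ (δ : Type) [Fintype δ] [DecidableEq δ] [Nonempty δ] (u : ℝ), 0 < u → u ≤ u₀ →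
    ∀ B R : Matrix (ι × δ) (ι × δ) ℂ, B.PosDef → B * R = 1 → ptr R ≤ (s' : ℂ) • 1 →
    pw R 3 ≤ u ^ 21 → ∃ (Ω : Set (κ × δ → ℂ)) (G : (κ × δ → ℂ) → ℝ), MeasurableSet Ω ∧
      (gvec (κ × δ)).real Ωᶜ ≤ C * Real.exp (-(c / u)) ∧ Integrable G (gvec (κ × δ)) ∧ 0 ≤ G ∧
      ∫ v, G v ∂(gvec (κ × δ)) ≤ pot K R * Real.exp (A * u ^ 13) ∧
      ∀ v ∈ Ω, ∃ R', (B - (β : ℂ) • 1 + Vm ι v * F * (Vm ι v)ᴴ).PosDef ∧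
        (B - (β : ℂ) • 1 + Vm ι v * F * (Vm ι v)ᴴ) * R' = 1 ∧
        ptr R' ≤ ptr R + ((A * u ^ 13 : ℝ) : ℂ) • 1 ∧ pot K R' ≤ G v := by
  have hC := hD.C₀_pos
  have hs := hD.s_pos
  have hcι : (0 : ℝ) < Fintype.card ι := by exact_mod_cast Fintype.card_pos
  have hcκ : (0 : ℝ) < Fintype.card κ := by exact_mod_cast Fintype.card_pos
  have hcικ : (0 : ℝ) < Fintype.card (ι × κ) := by exact_mod_cast Fintype.card_pos
  obtain ⟨ε, hε⟩ : ∃ ε, ε = (k₀ - β) / 2 := ⟨_, rfl⟩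
  have hε0 : 0 < ε := by linarith
  obtain ⟨e, he0, heC, hef, heη⟩ := exists_small_parameter hC hD.f_nonneg hD.fs hε0 hcικ hcκ
  obtain ⟨C, hC0, hintegrable⟩ := update_integral (ι := ι) κ hC
    (by positivity : (0 : ℝ) ≤ Fintype.card ι * s)
  obtain ⟨a, ha⟩ : ∃ a : ℝ, a = Fintype.card ι * s + 1 := ⟨_, rfl⟩
  have ha1 : 1 ≤ a := by rw [ha]; linarith [mul_pos hcι hs]
  have ha2 : Fintype.card ι * s ≤ a ^ 2 := by nlinarith [mul_pos hcι hs]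
  obtain ⟨K, hK⟩ : ∃ K : ℝ, K = 256 * C / ε := ⟨_, rfl⟩
  have hK0 : 0 ≤ K := by rw [hK]; positivity
  have hKε : 256 * C ≤ K * ε := by rw [hK, div_mul_cancel₀ _ hε0.ne']
  obtain ⟨A₁, hA₁⟩ : ∃ A₁ : ℝ, A₁ = Fintype.card ι * ((Fintype.card (ι × κ)) ^ 2 * (2 * C₀)) :=
    ⟨_, rfl⟩
  have hA₁0 : 0 ≤ A₁ := by rw [hA₁]; positivity
  refine ⟨K, Fintype.card (ι × ι × κ × κ) * 8 + Fintype.card (ι × ι × ι × ι × κ × κ) * 8,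
    min (e / (4 * (2 * a))) (1 / 8),
    min 1 (min (1 / (5 * (|β| + 1))) (min ((s - s') / (2 * a * (|β| + 1))) (1 / (2 * a)))),
    A₁ * (1 + K * Fintype.card ι), hK0, by positivity, by positivity, ?_, by positivity, ?_⟩
  · have : 0 < s - s' := by linarith
    positivity
  intro δ _ _ _ u hu0 hu B R hB hBR hT h3
  have hu1 : u ≤ 1 := hu.trans (min_le_left _ _)
  have hu2 : |β| * u ≤ 1 / 5 := by
    have := hu.trans ((min_le_right _ _).trans (min_le_left _ _))
    rw [le_div_iff₀ (by positivity)] at this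
    nlinarith [abs_nonneg β]
  have hu3 : |β| * (2 * a * u) ≤ s - s' := by
    have := hu.trans ((min_le_right _ _).trans ((min_le_right _ _).trans (min_le_left _ _)))
    rw [le_div_iff₀ (by positivity)] at this
    have : 0 ≤ u * a := by positivity
    nlinarith [abs_nonneg β]
  have hu4 : 2 * a * u ≤ 1 := by
    have := hu.trans ((min_le_right _ _).trans ((min_le_right _ _).trans (min_le_right _ _)))
    rw [le_div_iff₀ (by positivity)] at this
    linarith
  clear hu
  have hR : R.PosDef := by rw [← Matrix.inv_eq_right_inv hBR]; exact hB.inv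
  have hp1 : pw R 1 ≤ a ^ 2 := by
    rw [pw_one_ptr]
    exact (trace_re_le_of_le (hT.trans (real_smul_one_mono hs'.le))).trans ha2
  obtain ⟨Rt, hBt, hBRt, hRt, ht2, ht4, ht3, ht34, htle⟩ :=
    barrier_shift hR hBR hu0 hu1 h3 (by linarith) hp1 hu2
  have hu10 : u ^ 10 ≤ u := pow_le_of_le_one hu0.le hu1 (by norm_num)
  have ht2u : pw Rt 2 ≤ 2 * a * u := ht2.trans (by gcongr)
  have ht20 := pw_nonneg hRt.posSemidef 2
  have htT : ptr Rt ≤ (s : ℂ) • 1 := by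
    have h := ptr_mono htle
    rw [ptr_add, ptr_smul] at h
    have h' := smul_le_trace_smul (ptr_posSemidef (hRt.posSemidef.pow 2)) β
    rw [trace_ptr] at h'
    refine h.trans ((add_le_add hT h').trans ?_)
    rw [← add_smul, ← Complex.ofReal_add]
    refine real_smul_one_mono ?_
    have : |β| * pw Rt 2 ≤ |β| * (2 * a * u) := by gcongr
    rw [pw] at this
    linarith
  obtain ⟨S, hS, hSC, hSk⟩ := hD.res (ptr Rt)
    (Matrix.nonneg_iff_posSemidef.mpr (ptr_posSemidef hRt.posSemidef)) htT
  have hSh : S.IsHermitian := isHermitian_inv_of_mul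
    (hD.herm.add (kronecker_one_isHermitian (ptr_isHermitian hRt.1))) hS
  obtain ⟨hGi, hG⟩ := hintegrable δ Rt S k₀ (Fintype.card (ι × κ) * e) hRt hSh hSC hSk
    (by rw [pw_one_ptr]; exact trace_re_le_of_le htT) (ht2u.trans hu4) (by positivity) heC
  have hdrift := potential_drift (pw_nonneg hRt.posSemidef 3) (pw_nonneg hR.posSemidef 3) ht3 ht34
    (pw_nonneg hRt.posSemidef 4) (by linarith) ht20 hC0 hG hKε
  refine ⟨goodSet κ Rt e (u ^ 13), fun v => _ ^ 8 * Real.exp (K * (pw R 1 - ε * pw Rt 2 +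
    Fintype.card ι * (A₁ * u ^ 13))), measurableSet_goodSet _ _ _,
    goodSet_compl_le_exp hRt.1 he0 hu0 hu1 (by linarith) ht2 ht4 (min_le_left _ _)
      (min_le_right _ _), hGi.mul_const _, ?_, ?_, ?_⟩
  · intro v
    exact mul_nonneg (Even.pow_nonneg (by decide) _) (Real.exp_pos _).le
  · rw [integral_mul_const]
    refine (mul_le_mul_of_nonneg_right hdrift (Real.exp_pos _).le).trans ?_
    rw [pot, mul_assoc (pw R 3 ^ 8), mul_assoc (pw R 3 ^ 8), ← Real.exp_add, ← Real.exp_add]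
    refine mul_le_mul_of_nonneg_left ?_ (pow_nonneg (pw_nonneg hR.posSemidef 3) 8)
    rw [Real.exp_le_exp]
    have : 0 ≤ A₁ * u ^ 13 := by positivity
    linarith
  · intro v hv
    obtain ⟨R', hP, hinv, hp, hpw⟩ := update_good hD hBt hBRt htT he0 (by positivity) rfl heC hef
      heη hS hSC hSk hv
    have hR' : R'.PosDef := by rw [← Matrix.inv_eq_right_inv hinv]; exact hP.inv
    have hp' := ptr_update_le (ε := ε) (by rw [hε]; ring) htle hp
    rw [show (Fintype.card ι : ℝ) * ((Fintype.card (ι × κ)) ^ 2 * (2 * C₀) * u ^ 13) =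
      A₁ * u ^ 13 by rw [hA₁]; ring] at hp'
    refine ⟨R', hP, hinv, hp'.trans ?_, ?_⟩
    · have h0 : 0 ≤ (ε : ℂ) • ptr (Rt ^ 2) := Matrix.nonneg_iff_posSemidef.mpr
        (smul_posSemidef (ptr_posSemidef (hRt.posSemidef.pow 2)) hε0.le)
      refine add_le_add (sub_le_self _ h0) (real_smul_one_mono ?_)
      have : 0 ≤ A₁ * u ^ 13 * (K * Fintype.card ι) := by positivity
      linarith
    · have htr : pw R' 1 ≤ pw R 1 - ε * pw Rt 2 + Fintype.card ι * (A₁ * u ^ 13) := by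
        have := trace_re_mono hp'
        rw [trace_add, trace_sub, trace_smul, trace_smul, trace_ptr, trace_ptr, trace_ptr,
          trace_one, smul_eq_mul, smul_eq_mul, Complex.add_re, Complex.sub_re,
          Complex.re_ofReal_mul, Complex.re_ofReal_mul, Complex.natCast_re] at this
        simp only [pw, pow_one] at this ⊢
        linarith
      rw [pot]
      refine mul_le_mul (pow_le_pow_left₀ (pw_nonneg hR'.posSemidef 3) hpw 8)
        (Real.exp_le_exp.mpr (mul_le_mul_of_nonneg_left htr hK0)) (Real.exp_pos _).le
        (Even.pow_nonneg (by decide) _)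

end BarrierStepMain

section BarrierIterate

open scoped Matrix.Norms.L2Operator MatrixOrder

set_option linter.unusedSectionVars false

lemma isClosed_posSemidef {m : Type*} [Fintype m] :
    IsClosed {A : Matrix m m ℂ | A.PosSemidef} := by
  have h : {A : Matrix m m ℂ | A.PosSemidef} =
      {A | Aᴴ = A} ∩ ⋂ x : m → ℂ, {A | 0 ≤ star x ⬝ᵥ A *ᵥ x} := by
    ext A
    simp only [Set.mem_ofPred_eq, Set.mem_inter_iff, Set.mem_iInter]
    exact posSemidef_iff_dotProduct_mulVec
  rw [h]
  refine (isClosed_eq (by fun_prop) continuous_id).inter (isClosed_iInter fun x => ?_)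
  exact isClosed_le continuous_const (by fun_prop)

variable {ι κ : Type} [Fintype ι] [Fintype κ] [DecidableEq ι] [DecidableEq κ]

/-- The random block update attached to a vector `v`. -/
def upd {δ : Type} (F : Matrix (ι × κ) (ι × κ) ℂ) (v : κ × δ → ℂ) :
    Matrix (ι × δ) (ι × δ) ℂ :=
  Vm ι v * F * (Vm ι v)ᴴ

lemma continuous_Vm {δ : Type} : Continuous (fun v : κ × δ → ℂ => Vm ι v) := by
  refine continuous_matrix fun i j => ?_
  unfold Vm
  split_ifs <;> fun_prop

lemma continuous_upd {δ : Type} (F : Matrix (ι × κ) (ι × κ) ℂ) :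
    Continuous (fun v : κ × δ → ℂ => upd F v) := by
  have := continuous_Vm (ι := ι) (κ := κ) (δ := δ)
  unfold upd
  fun_prop

lemma pi_succ_apply {X : Type} [MeasurableSpace X] (ν : Measure X) [IsProbabilityMeasure ν] {r : ℕ}
    (i : Fin (r + 1)) {E : Set (Fin (r + 1) → X)} (hE : MeasurableSet E) :
    Measure.pi (fun _ : Fin (r + 1) => ν) E =
      ∫⁻ v, Measure.pi (fun _ : Fin r => ν) {w | i.insertNth v w ∈ E} ∂ν := by
  have h := (measurePreserving_piFinSuccAbove (fun _ : Fin (r + 1) => ν) i).symm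
  rw [← h.measure_preimage hE.nullMeasurableSet, Measure.prod_apply (h.measurable hE)]
  rfl

/-- Failure event of the iterated barrier argument. -/
def failSet {δ : Type} [Fintype δ] [DecidableEq δ] (F : Matrix (ι × κ) (ι × κ) ℂ) (β : ℝ) (r : ℕ)
    (B : Matrix (ι × δ) (ι × δ) ℂ) : Set (Fin r → κ × δ → ℂ) :=
  {w | ¬ (B - ((r * β : ℝ) : ℂ) • 1 + ∑ k, upd F (w k)).PosSemidef}

variable {δ : Type} [Fintype δ] [DecidableEq δ]

lemma measurableSet_failSet (F : Matrix (ι × κ) (ι × κ) ℂ) (β : ℝ) (r : ℕ)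
    (B : Matrix (ι × δ) (ι × δ) ℂ) : MeasurableSet (failSet F β r B) := by
  have h : Continuous fun w : Fin r → κ × δ → ℂ =>
      B - ((r * β : ℝ) : ℂ) • 1 + ∑ k, upd F (w k) := by
    have := continuous_upd (δ := δ) F
    fun_prop
  exact ((isClosed_posSemidef.preimage h).measurableSet).compl

lemma failSet_succ (F : Matrix (ι × κ) (ι × κ) ℂ) (β : ℝ) (r : ℕ)
    (B : Matrix (ι × δ) (ι × δ) ℂ) (v : κ × δ → ℂ) :
    {w : Fin r → κ × δ → ℂ | (0 : Fin (r + 1)).insertNth v w ∈ failSet F β (r + 1) B} =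
      failSet F β r (B - (β : ℂ) • 1 + upd F v) := by
  ext w
  simp only [failSet, Set.mem_ofPred_eq, Fin.insertNth_zero', Fin.sum_univ_succ, Fin.cons_zero,
    Fin.cons_succ]
  rw [show B - (((r + 1 : ℕ) * β : ℝ) : ℂ) • 1 + (upd F v + ∑ k, upd F (w k)) =
    B - (β : ℂ) • 1 + upd F v - ((r * β : ℝ) : ℂ) • 1 + ∑ k, upd F (w k) by
      push_cast; rw [add_mul, one_mul, add_smul]; abel]

lemma barrier_iterate {F : Matrix (ι × κ) (ι × κ) ℂ} {K β s' u a ε₁ : ℝ} (hK : 0 ≤ K) (hu : 0 < u)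
    (ha : 0 ≤ a) (hε₁ : 0 ≤ ε₁)
    (hstep : ∀ B R : Matrix (ι × δ) (ι × δ) ℂ, B.PosDef → B * R = 1 → ptr R ≤ (s' : ℂ) • 1 →
      pw R 3 ≤ u ^ 21 → ∃ (Ω : Set (κ × δ → ℂ)) (G : (κ × δ → ℂ) → ℝ), MeasurableSet Ω ∧
        (gvec (κ × δ)).real Ωᶜ ≤ ε₁ ∧ Integrable G (gvec (κ × δ)) ∧ 0 ≤ G ∧
        ∫ v, G v ∂(gvec (κ × δ)) ≤ pot K R * Real.exp a ∧
        ∀ v ∈ Ω, ∃ R', (B - (β : ℂ) • 1 + upd F v).PosDef ∧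
          (B - (β : ℂ) • 1 + upd F v) * R' = 1 ∧
          ptr R' ≤ ptr R + (a : ℂ) • 1 ∧ pot K R' ≤ G v) (r : ℕ) :
    ∀ B R : Matrix (ι × δ) (ι × δ) ℂ, B.PosDef → B * R = 1 →
      ptr R ≤ ((s' - r * a : ℝ) : ℂ) • 1 →
      Measure.pi (fun _ : Fin r => gvec (κ × δ)) (failSet F β r B) ≤
        ENNReal.ofReal (r * ε₁ + (u ^ 168)⁻¹ * Real.exp (r * a) * pot K R) := by
  induction r with
  | zero =>
    intro B R hB _ _
    have : failSet F β 0 B = ∅ := by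
      ext w
      simp [failSet, hB.posSemidef]
    rw [this, measure_empty]
    exact zero_le
  | succ r ih =>
    intro B R hB hBR hT
    have hR : R.PosDef := by rw [← Matrix.inv_eq_right_inv hBR]; exact hB.inv
    by_cases h3 : pw R 3 ≤ u ^ 21
    swap
    · refine prob_le_one.trans ?_
      rw [← ENNReal.ofReal_one]
      refine ENNReal.ofReal_le_ofReal ?_
      push Not at h3
      have h1 : u ^ 168 ≤ pot K R := by
        calc u ^ 168 = (u ^ 21) ^ 8 * 1 := by ring
          _ ≤ pw R 3 ^ 8 * Real.exp (K * pw R 1) := by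
            gcongr
            exact Real.one_le_exp (mul_nonneg hK (pw_nonneg hR.posSemidef 1))
      have h2 : 1 ≤ Real.exp ((r + 1 : ℕ) * a) := Real.one_le_exp (by positivity)
      have h4 : 1 ≤ (u ^ 168)⁻¹ * Real.exp ((r + 1 : ℕ) * a) * pot K R := by
        calc (1 : ℝ) = (u ^ 168)⁻¹ * 1 * u ^ 168 := by field_simp
          _ ≤ _ := by gcongr
      have : 0 ≤ ((r + 1 : ℕ) : ℝ) * ε₁ := by positivity
      linarith
    · have hra : (0 : ℝ) ≤ (r + 1 : ℕ) * a := by positivity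
      obtain ⟨Ω, G, hΩ, hΩp, hGi, hG0, hG, hv⟩ := hstep B R hB hBR
        (hT.trans (real_smul_one_mono (by linarith))) h3
      rw [pi_succ_apply _ 0 (measurableSet_failSet F β _ B)]
      simp only [failSet_succ]
      set H : (κ × δ → ℂ) → ℝ := fun v => r * ε₁ + (u ^ 168)⁻¹ * Real.exp (r * a) * G v with hH
      have hHi : Integrable H (gvec (κ × δ)) := (integrable_const _).add (hGi.const_mul _)
      have hH0 : 0 ≤ H := fun v => by
        have := hG0 v
        simp only [Pi.zero_apply] at this
        simp only [hH, Pi.zero_apply]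
        positivity
      have hpt : ∀ v, Measure.pi (fun _ : Fin r => gvec (κ × δ))
          (failSet F β r (B - (β : ℂ) • 1 + upd F v)) ≤
          Ωᶜ.indicator 1 v + ENNReal.ofReal (H v) := by
        intro v
        by_cases hvΩ : v ∈ Ω
        · obtain ⟨R', hP, hinv, hp, hpo⟩ := hv v hvΩ
          refine le_add_left ((ih _ R' hP hinv (hp.trans ?_)).trans
            (ENNReal.ofReal_le_ofReal ?_))
          · refine (add_le_add hT le_rfl).trans_eq ?_
            rw [← add_smul, ← Complex.ofReal_add]
            congr 2
            push_cast
            ring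
          · simp only [hH]
            gcongr
        · refine le_add_right ?_
          rw [Set.indicator_of_mem (by exact hvΩ)]
          exact prob_le_one
      refine (lintegral_mono hpt).trans ?_
      rw [lintegral_add_left (measurable_one.indicator hΩ.compl), lintegral_indicator_one hΩ.compl,
        ← ofReal_integral_eq_lintegral_ofReal hHi (ae_of_all _ hH0), ← ofReal_measureReal,
        ← ENNReal.ofReal_add measureReal_nonneg (integral_nonneg hH0)]
      refine ENNReal.ofReal_le_ofReal ?_
      simp only [hH]
      rw [integral_add (integrable_const _) (hGi.const_mul _), integral_const, probReal_univ, one_smul,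
        integral_const_mul]
      have h5 : (u ^ 168)⁻¹ * Real.exp (r * a) * ∫ v, G v ∂(gvec (κ × δ)) ≤
          (u ^ 168)⁻¹ * Real.exp (r * a) * (pot K R * Real.exp a) := by gcongr
      have h6 : Real.exp ((r + 1 : ℕ) * a) = Real.exp (r * a) * Real.exp a := by
        rw [← Real.exp_add]; congr 1; push_cast; ring
      rw [h6]
      push_cast
      linarith

end BarrierIterate

section BarrierCore

open scoped Matrix.Norms.L2Operator MatrixOrder

variable {ι κ : Type} [Fintype ι] [Fintype κ] [DecidableEq ι] [DecidableEq κ]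

lemma pw_smul_one {m : Type*} [Fintype m] [DecidableEq m] (r : ℝ) (k : ℕ) :
    pw ((r : ℂ) • (1 : Matrix m m ℂ)) k = Fintype.card m * r ^ k := by
  rw [pw, _root_.smul_pow, one_pow, trace_smul, trace_one, smul_eq_mul, ← Complex.ofReal_pow,
    Complex.re_ofReal_mul, Complex.natCast_re, mul_comm]

lemma exp_neg_div_le {c u : ℝ} (hc : 0 < c) (hu : 0 < u) (k : ℕ) :
    Real.exp (-(c / u)) ≤ k.factorial / c ^ k * u ^ k := by
  have h := Real.pow_div_factorial_le_exp (c / u) (by positivity) k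
  rw [Real.exp_neg, inv_le_comm₀ (Real.exp_pos _) (by positivity)]
  refine le_trans (le_of_eq ?_) h
  rw [div_pow]
  have := k.factorial_ne_zero
  field_simp

/-- With probability `1 - O(D⁻²)` the sum of `m = O(D)` random block updates is bounded below by
`(m β - D / s₀)`. -/
lemma barrier_core [Nonempty ι] [Nonempty κ] {F : Matrix (ι × κ) (ι × κ) ℂ}
    {f s C₀ k₀ s₀ β M : ℝ} (hD : BarrierData F f s C₀ k₀) (hs₀ : 0 < s₀) (hs : s₀ < s)
    (hβ : β < k₀) (hM : 0 ≤ M) : ∃ C : ℝ, 0 ≤ C ∧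
    ∀ (δ : Type) [Fintype δ] [DecidableEq δ] [Nonempty δ] (m : ℕ), (m : ℝ) ≤ M * Fintype.card δ →
      (Measure.pi (fun _ : Fin m => gvec (κ × δ))).real
        (failSet F β m (((Fintype.card δ / s₀ : ℝ) : ℂ) • 1)) ≤ C / (Fintype.card δ : ℝ) ^ 2 := by
  obtain ⟨s', hs'1, hs'2⟩ := exists_between hs
  obtain ⟨K, C, c, u₀, A, hK, hC, hc, hu₀, hA, hstep⟩ := barrier_step hD hs'2 hβ
  set u₁ := min u₀ (min ((s' - s₀) / (M * A + 1)) (1 / (M * A + 1))) with hu₁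
  have hss : 0 < s' - s₀ := by linarith
  have hu₁0 : 0 < u₁ := by positivity
  have hu₁a : u₁ ≤ u₀ := min_le_left _ _
  have hu₁b : u₁ ≤ (s' - s₀) / (M * A + 1) := (min_le_right _ _).trans (min_le_left _ _)
  have hu₁c : u₁ ≤ 1 / (M * A + 1) := (min_le_right _ _).trans (min_le_right _ _)
  clear_value u₁
  rw [le_div_iff₀ (by positivity)] at hu₁b hu₁c
  set P := (Fintype.card ι * s₀ ^ 3) ^ 8 * Real.exp (K * (Fintype.card ι * s₀)) with hP
  have hP0 : 0 ≤ P := by positivity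
  refine ⟨(u₁ ^ 24)⁻¹ + (M * C * ((36).factorial / c ^ 36) + Real.exp 1 * P), by positivity, ?_⟩
  intro δ _ _ _ m hm
  have hD0 : (0 : ℝ) < Fintype.card δ := by exact_mod_cast Fintype.card_pos
  set D : ℝ := (Fintype.card δ : ℝ) with hDdef
  obtain ⟨u, hu0, hDu⟩ : ∃ u : ℝ, 0 < u ∧ D * u ^ 12 = 1 := by
    refine ⟨D ^ (-(1 / 12 : ℝ)), Real.rpow_pos_of_pos hD0 _, ?_⟩
    rw [← Real.rpow_natCast, ← Real.rpow_mul hD0.le]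
    norm_num
    rw [Real.rpow_neg_one, mul_inv_cancel₀ hD0.ne']
  have hD2 : 1 / D ^ 2 = u ^ 24 := by
    rw [div_eq_iff (by positivity)]
    calc (1 : ℝ) = (D * u ^ 12) ^ 2 := by rw [hDu]; norm_num
      _ = u ^ 24 * D ^ 2 := by ring
  rw [div_eq_mul_one_div _ (D ^ 2), hD2]
  by_cases hu : u ≤ u₁
  swap
  · push Not at hu
    refine measureReal_le_one.trans ?_
    calc (1 : ℝ) = (u₁ ^ 24)⁻¹ * u₁ ^ 24 := by field_simp
      _ ≤ _ := mul_le_mul (le_add_of_nonneg_right (by positivity))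
        (pow_le_pow_left₀ hu₁0.le hu.le 24) (by positivity) (by positivity)
  have hMAu : m * (A * u ^ 13) ≤ M * A * u := by
    calc m * (A * u ^ 13) ≤ M * D * (A * u ^ 13) := by gcongr
      _ = M * A * u * (D * u ^ 12) := by ring
      _ = M * A * u := by rw [hDu, mul_one]
  have hMA1 : M * A * u ≤ s' - s₀ := by
    have : M * A * u ≤ M * A * u₁ := by gcongr
    linarith
  have hMA2 : M * A * u ≤ 1 := by
    have : M * A * u ≤ M * A * u₁ := by gcongr
    linarith
  set R : Matrix (ι × δ) (ι × δ) ℂ := ((s₀ / D : ℝ) : ℂ) • 1 with hR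
  have hBpos : (((D / s₀ : ℝ) : ℂ) • (1 : Matrix (ι × δ) (ι × δ) ℂ)).PosDef :=
    PosDef.one.smul (by exact_mod_cast (by positivity : 0 < D / s₀) : (0 : ℂ) < _)
  have hBR : (((D / s₀ : ℝ) : ℂ) • (1 : Matrix (ι × δ) (ι × δ) ℂ)) * R = 1 := by
    rw [hR, smul_mul_smul_comm, one_mul, ← Complex.ofReal_mul,
      show D / s₀ * (s₀ / D) = 1 by field_simp, Complex.ofReal_one, one_smul]
  have hT : ptr R ≤ ((s' - m * (A * u ^ 13) : ℝ) : ℂ) • 1 := by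
    rw [hR, ptr_smul, ptr_one, smul_smul, ← Complex.ofReal_natCast, ← Complex.ofReal_mul]
    refine real_smul_one_mono ?_
    rw [← hDdef, div_mul_cancel₀ _ hD0.ne']
    linarith
  have hpot : pot K R = P * u ^ 192 := by
    rw [pot, hR, pw_smul_one, pw_smul_one, Fintype.card_prod, Nat.cast_mul, ← hDdef, pow_one,
      show Fintype.card ι * D * (s₀ / D) = Fintype.card ι * s₀ by field_simp,
      show Fintype.card ι * D * (s₀ / D) ^ 3 = Fintype.card ι * s₀ ^ 3 * (1 / D ^ 2) by field_simp,
      hD2, hP]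
    ring
  have hmain := barrier_iterate (F := F) (β := β) (s' := s') hK hu0
    (by positivity : 0 ≤ A * u ^ 13)
    (by positivity : 0 ≤ C * Real.exp (-(c / u)))
    (hstep δ u hu0 (hu.trans hu₁a)) m _ R hBpos hBR hT
  rw [measureReal_def]
  refine (ENNReal.toReal_mono ENNReal.ofReal_ne_top hmain).trans ?_
  rw [ENNReal.toReal_ofReal (by have := pot_nonneg K (R := R); positivity), hpot]
  have h1 : m * (C * Real.exp (-(c / u))) ≤ M * C * ((36).factorial / c ^ 36) * u ^ 24 := by
    calc m * (C * Real.exp (-(c / u)))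
        ≤ M * D * (C * ((36).factorial / c ^ 36 * u ^ 36)) := by
          gcongr; exact exp_neg_div_le hc hu0 36
      _ = M * C * ((36).factorial / c ^ 36) * u ^ 24 * (D * u ^ 12) := by ring
      _ = _ := by rw [hDu, mul_one]
  have h2 : (u ^ 168)⁻¹ * Real.exp (m * (A * u ^ 13)) * (P * u ^ 192) ≤
      Real.exp 1 * P * u ^ 24 := by
    calc (u ^ 168)⁻¹ * Real.exp (m * (A * u ^ 13)) * (P * u ^ 192)
        ≤ (u ^ 168)⁻¹ * Real.exp 1 * (P * u ^ 192) := by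
          gcongr; linarith
      _ = Real.exp 1 * P * u ^ 24 := by field_simp
  have h3 : 0 ≤ (u₁ ^ 24)⁻¹ * u ^ 24 := by positivity
  linarith

end BarrierCore

section BarrierInstances

open scoped Matrix.Norms.L2Operator MatrixOrder

set_option linter.unusedSectionVars false

variable {ι : Type} [Fintype ι] [DecidableEq ι]

/-- The flip (swap) operator. -/
def flipM (ι : Type) [DecidableEq ι] : Matrix (ι × ι) (ι × ι) ℂ :=
  fun p q => if p.2 = q.1 ∧ q.2 = p.1 then 1 else 0

lemma flipM_mul_self : flipM ι * flipM ι = 1 := by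
  ext ⟨i, a⟩ ⟨j, b⟩
  rw [Matrix.mul_apply, Fintype.sum_prod_type, Matrix.one_apply]
  rw [Finset.sum_eq_single a, Finset.sum_eq_single i]
  · simp only [flipM, and_self, if_true, one_mul, Prod.mk.injEq]
    congr 1
    exact propext ⟨fun h => ⟨h.1, h.2.symm⟩, fun h => ⟨h.1, h.2.symm⟩⟩
  · intro x _ hx
    simp [flipM, hx]
  · simp
  · intro x _ hx
    exact Finset.sum_eq_zero fun y _ => by simp [flipM, Ne.symm hx]
  · simp

lemma flipM_isHermitian : (flipM ι).IsHermitian := by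
  ext ⟨i, a⟩ ⟨j, b⟩
  simp only [flipM, conjTranspose_apply]
  by_cases h1 : a = j <;> by_cases h2 : b = i <;> simp [h1, h2]

lemma ptr_flipM : ptr (flipM ι) = 1 := by
  ext i j
  simp only [ptr, flipM, Matrix.one_apply]
  by_cases h : i = j
  · subst h
    simp
  · rw [if_neg h]
    exact Finset.sum_eq_zero fun x _ => by
      rw [if_neg]; rintro ⟨rfl, rfl⟩; exact h rfl

lemma flipM_norm_le : ‖flipM ι‖ ≤ 1 :=
  norm_le_one_of_conjTranspose_mul_self (by rw [flipM_isHermitian.eq, flipM_mul_self])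

/-- Operator monotonicity of `T ↦ -(F + T)⁻¹` in the norm-controlled regime. -/
lemma inverse_sub_posSemidef {m : Type*} [Fintype m] [DecidableEq m] {M₀ Δ S₀ S : Matrix m m ℂ}
    (hM₀ : M₀.IsHermitian) (hΔ : Δ.PosSemidef) (hS₀ : M₀ * S₀ = 1) (hS : (M₀ - Δ) * S = 1)
    (h : ‖Δ‖ * ‖S‖ ≤ 1) : S₀ ≤ S := by
  have hS₀h : S₀.IsHermitian := isHermitian_inv_of_mul hM₀ hS₀
  have hSh : S.IsHermitian := isHermitian_inv_of_mul (hM₀.sub hΔ.1) hS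
  have hS₀' : S₀ * M₀ = 1 := mul_eq_one_comm.mp hS₀
  have hS' : S * (M₀ - Δ) = 1 := mul_eq_one_comm.mp hS
  have e1 : S = S₀ + S₀ * Δ * S := by
    have : S₀ * ((M₀ - Δ) * S) = S₀ := by rw [hS, Matrix.mul_one]
    rw [Matrix.sub_mul, Matrix.mul_sub, ← Matrix.mul_assoc, hS₀', Matrix.one_mul,
      ← Matrix.mul_assoc] at this
    exact sub_eq_iff_eq_add.mp this
  have e2 : S = S₀ + S * Δ * S₀ := by
    have : S * (M₀ - Δ) * S₀ = S₀ := by rw [hS', Matrix.one_mul]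
    rw [Matrix.mul_sub, Matrix.sub_mul, Matrix.mul_assoc, hS₀, Matrix.mul_one] at this
    exact sub_eq_iff_eq_add.mp this
  rw [Matrix.le_iff]
  obtain ⟨Q, hQ⟩ := CStarAlgebra.nonneg_iff_eq_star_mul_self.mp hΔ.nonneg
  rw [star_eq_conjTranspose] at hQ
  have hQn : ‖Q‖ * ‖Q‖ = ‖Δ‖ := by
    rw [hQ, ← star_eq_conjTranspose, CStarRing.norm_star_mul_self]
  have hneg : (1 + Q * S * Qᴴ).PosSemidef := by
    have hh : (-(Q * S * Qᴴ)).IsHermitian := (isHermitian_mul_mul_conjTranspose Q hSh).neg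
    have hn : ‖-(Q * S * Qᴴ)‖ ≤ 1 := by
      rw [norm_neg]
      calc ‖Q * S * Qᴴ‖ ≤ ‖Q‖ * ‖S‖ * ‖Qᴴ‖ := (norm_mul_le _ _).trans
            (mul_le_mul_of_nonneg_right (norm_mul_le _ _) (norm_nonneg _))
        _ = (‖Q‖ * ‖Q‖) * ‖S‖ := by rw [l2_opNorm_conjTranspose]; ring
        _ ≤ 1 := by rwa [hQn]
    have := Matrix.le_iff.mp (isHermitian_le_norm hh hn)
    rwa [Complex.ofReal_one, one_smul, sub_neg_eq_add] at this
  have e3 : S - S₀ = (S₀ * Qᴴ) * (1 + Q * S * Qᴴ) * (S₀ * Qᴴ)ᴴ := by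
    rw [conjTranspose_mul, conjTranspose_conjTranspose, hS₀h.eq]
    calc S - S₀ = S₀ * Δ * S := by
          nth_rewrite 1 [e1]; abel
      _ = S₀ * Δ * (S₀ + S * Δ * S₀) := by rw [← e2]
      _ = _ := by rw [hQ]; noncomm_ring
  rw [e3]
  exact hneg.mul_mul_conjTranspose_same _

lemma neumann_inverse_norm {m : Type*} [Fintype m] [DecidableEq m] {A S : Matrix m m ℂ} {s : ℝ}
    (hAA : A * A = 1) (hA : ‖A‖ ≤ 1) (hs : s < 1) {E : Matrix m m ℂ} (hE : ‖E‖ ≤ s)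
    (hS : (A + E) * S = 1) : ‖S‖ ≤ 1 / (1 - s) := by
  have h1 : S = A - A * E * S := by
    have : A * ((A + E) * S) = A := by rw [hS, Matrix.mul_one]
    rw [Matrix.add_mul, Matrix.mul_add, ← Matrix.mul_assoc, hAA, Matrix.one_mul,
      ← Matrix.mul_assoc] at this
    exact eq_sub_of_add_eq this
  have h2 : ‖S‖ ≤ 1 + s * ‖S‖ := by
    calc ‖S‖ = ‖A - A * E * S‖ := by rw [← h1]
      _ ≤ ‖A‖ + ‖A * E * S‖ := norm_sub_le _ _
      _ ≤ ‖A‖ + ‖A‖ * ‖E‖ * ‖S‖ := by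
        gcongr
        exact (norm_mul_le _ _).trans (mul_le_mul_of_nonneg_right (norm_mul_le _ _) (norm_nonneg _))
      _ ≤ 1 + 1 * s * ‖S‖ := by gcongr
      _ = 1 + s * ‖S‖ := by ring
  rw [le_div_iff₀ (by linarith)]
  linarith

lemma kronecker_one_norm_le {κ : Type*} [Fintype κ] [DecidableEq κ] {T : Matrix ι ι ℂ} {s : ℝ}
    (hs : 0 ≤ s) (hT : 0 ≤ T) (hTs : T ≤ (s : ℂ) • 1) : ‖T ⊗ₖ (1 : Matrix κ κ ℂ)‖ ≤ s := by
  refine norm_le_of_le ?_ hs ?_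
  · exact Matrix.nonneg_iff_posSemidef.mpr
      ((Matrix.nonneg_iff_posSemidef.mp hT).kronecker PosSemidef.one)
  · have := kronecker_one_mono (δ := κ) hTs
    rwa [smul_one_kronecker_one] at this

lemma flip_barrierData {s : ℝ} (hs0 : 0 < s) (hs : s ≤ 1 / 2) :
    BarrierData (flipM ι) 1 s (1 / (1 - s)) ((1 - Fintype.card ι * s) / (1 - s ^ 2)) where
  herm := flipM_isHermitian
  sq := flipM_mul_self
  f_nonneg := zero_le_one
  lower := by
    have := Matrix.le_iff.mp (isHermitian_le_norm (t := 1) (flipM_isHermitian (ι := ι)).neg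
      (by rw [norm_neg]; exact flipM_norm_le))
    rwa [sub_neg_eq_add, add_comm] at this
  s_pos := hs0
  fs := by linarith
  C₀_pos := by have : 0 < 1 - s := by linarith
               positivity
  res := by
    intro T hT hTs
    have h1s : 0 < 1 - s := by linarith
    have h1s2 : 0 < 1 - s ^ 2 := by nlinarith
    have hTn : ‖T ⊗ₖ (1 : Matrix ι ι ℂ)‖ ≤ s := kronecker_one_norm_le hs0.le hT hTs
    obtain ⟨S, hS, -⟩ := neumann_inverse (C := 1) (flipM_mul_self (ι := ι)) flipM_norm_le hTn
      (by linarith)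
    have hSn := neumann_inverse_norm flipM_mul_self flipM_norm_le (by linarith) hTn hS
    refine ⟨S, hS, hSn, ?_⟩
    set S₀ : Matrix (ι × ι) (ι × ι) ℂ := ((1 / (1 - s ^ 2) : ℝ) : ℂ) • (flipM ι - (s : ℂ) • 1)
      with hS₀
    have hS₀i : (flipM ι + (s : ℂ) • 1) * S₀ = 1 := by
      rw [hS₀, mul_smul_comm, Matrix.add_mul, Matrix.mul_sub, Matrix.mul_sub, flipM_mul_self]
      simp only [smul_mul_assoc, mul_smul_comm, Matrix.one_mul, Matrix.mul_one, smul_smul]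
      rw [show (1 : Matrix (ι × ι) (ι × ι) ℂ) - (s : ℂ) • flipM ι +
        ((s : ℂ) • flipM ι - ((s : ℂ) * s) • 1) = ((1 - s ^ 2 : ℝ) : ℂ) • 1 by
          push_cast; rw [sub_smul, one_smul, sq]; abel]
      rw [smul_smul, ← Complex.ofReal_mul, one_div, inv_mul_cancel₀ h1s2.ne', Complex.ofReal_one,
        one_smul]
    have hΔ : ((s : ℂ) • (1 : Matrix (ι × ι) (ι × ι) ℂ) -
        T ⊗ₖ (1 : Matrix ι ι ℂ)).PosSemidef := by
      have := kronecker_one_mono (δ := ι) hTs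
      rwa [smul_one_kronecker_one, Matrix.le_iff] at this
    have hΔn : ‖(s : ℂ) • (1 : Matrix (ι × ι) (ι × ι) ℂ) - T ⊗ₖ (1 : Matrix ι ι ℂ)‖ ≤ s := by
      refine norm_le_of_le hΔ.nonneg hs0.le (sub_le_self _ ?_)
      exact Matrix.nonneg_iff_posSemidef.mpr
        ((Matrix.nonneg_iff_posSemidef.mp hT).kronecker PosSemidef.one)
    have hle : S₀ ≤ S := by
      refine inverse_sub_posSemidef (flipM_isHermitian.add ?_) hΔ hS₀i ?_ ?_
      · rw [IsHermitian, conjTranspose_smul, conjTranspose_one]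
        congr 1
        exact Complex.conj_ofReal s
      · rw [← hS]; congr 1; abel
      · refine (mul_le_mul hΔn hSn (norm_nonneg _) hs0.le).trans ?_
        rw [mul_one_div, div_le_one h1s]
        linarith
    refine le_of_eq_of_le ?_ (ptr_mono hle)
    rw [hS₀, ptr_smul, ptr_sub, ptr_smul, ptr_one, ptr_flipM, smul_smul]
    nth_rewrite 2 [← one_smul ℂ (1 : Matrix ι ι ℂ)]
    rw [← sub_smul, smul_smul]
    congr 1
    push_cast
    ring

lemma eq_smul_one_of_unit (T : Matrix Unit Unit ℂ) (hT : T.IsHermitian) :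
    T = ((T () ()).re : ℂ) • 1 := by
  ext ⟨⟩ ⟨⟩
  have := hT.apply () ()
  simp only [Matrix.smul_apply, Matrix.one_apply_eq, smul_eq_mul, mul_one]
  exact (Complex.conj_eq_iff_re.mp this).symm

lemma smul_one_le_unit {a b : ℝ} (h : (a : ℂ) • (1 : Matrix Unit Unit ℂ) ≤ (b : ℂ) • 1) :
    a ≤ b := by
  have := trace_re_mono h
  simpa using this

lemma unit_barrierData {σ s C k f : ℝ} (hσ : σ * σ = 1) (hf : 0 ≤ f) (hσf : 0 ≤ σ + f)
    (hs : 0 < s) (hfs : f * s < 1) (hC : 0 < C)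
    (h : ∀ t, 0 ≤ t → t ≤ s → σ + t ≠ 0 ∧ |1 / (σ + t)| ≤ C ∧ k ≤ 1 / (σ + t)) :
    BarrierData ((σ : ℂ) • (1 : Matrix (Unit × Unit) (Unit × Unit) ℂ)) f s C k where
  herm := by
    rw [IsHermitian, conjTranspose_smul, conjTranspose_one]
    congr 1
    exact Complex.conj_ofReal σ
  sq := by
    rw [smul_mul_smul_comm, Matrix.one_mul, ← Complex.ofReal_mul, hσ, Complex.ofReal_one, one_smul]
  f_nonneg := hf
  lower := by
    rw [← add_smul, ← Complex.ofReal_add]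
    exact smul_posSemidef PosSemidef.one hσf
  s_pos := hs
  fs := hfs
  C₀_pos := hC
  res := by
    intro T hT hTs
    have hTe := eq_smul_one_of_unit T (Matrix.nonneg_iff_posSemidef.mp hT).1
    set t := (T () ()).re with ht
    rw [hTe] at hTs hT
    have ht0 : 0 ≤ t := smul_one_le_unit (a := 0) (by simpa using hT)
    obtain ⟨h1, h2, h3⟩ := h t ht0 (smul_one_le_unit hTs)
    refine ⟨((1 / (σ + t) : ℝ) : ℂ) • 1, ?_, ?_, ?_⟩
    · rw [hTe, smul_one_kronecker_one, ← add_smul, smul_mul_smul_comm, Matrix.one_mul,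
        ← Complex.ofReal_add, ← Complex.ofReal_mul, mul_one_div, div_self h1, Complex.ofReal_one,
        one_smul]
    · rw [norm_smul, Complex.norm_real, Real.norm_eq_abs]
      calc _ ≤ |1 / (σ + t)| * 1 := by gcongr; exact norm_one_matrix_le
        _ ≤ C := by rwa [mul_one]
    · rw [ptr_smul, ptr_one]
      simpa using real_smul_one_mono (ι := Unit) h3

end BarrierInstances

section Wishart

open scoped Matrix.Norms.L2Operator MatrixOrder

/-- The (unnormalised) Wishart matrix of the sample `w`. -/
def wish {J : Type*} {m : ℕ} (w : Fin m → J → ℂ) : Matrix J J ℂ :=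
  ∑ k, vecMulVec (w k) (star (w k))

lemma upd_smul_one {δ : Type} (σ : ℂ) (v : Unit × δ → ℂ) :
    upd (σ • (1 : Matrix (Unit × Unit) (Unit × Unit) ℂ)) v =
      σ • vecMulVec v (star v) := by
  ext ⟨⟨⟩, x⟩ ⟨⟨⟩, y⟩
  simp [upd, Vm, Matrix.mul_apply, vecMulVec_apply, Fintype.sum_prod_type]
  ring

lemma upd_flipM {n d : ℕ} (v : Fin n × Fin d → ℂ) :
    upd (flipM (Fin n)) v = ptrans (vecMulVec v (star v)) := by
  ext ⟨i, x⟩ ⟨j, y⟩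
  simp only [upd, ptrans, vecMulVec_apply, Pi.star_apply, Matrix.mul_apply, Vm,
    conjTranspose_apply, Fintype.sum_prod_type, flipM]
  simp [ite_and, apply_ite (starRingEnd ℂ)]

lemma mul_vecMulVec_mul {I J : Type*} [Fintype I] [Fintype J] (A : Matrix I J ℂ) (v : J → ℂ) :
    vecMulVec (A *ᵥ v) (star (A *ᵥ v)) = A * vecMulVec v (star v) * Aᴴ := by
  rw [star_mulVec, Matrix.mul_vecMulVec, Matrix.vecMulVec_mul]

lemma mul_wish_mul {I J : Type*} [Fintype I] [Fintype J] {m : ℕ} (A : Matrix I J ℂ)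
    (w : Fin m → J → ℂ) : wish (fun k => A *ᵥ w k) = A * wish w * Aᴴ := by
  simp only [wish, mul_vecMulVec_mul, Matrix.mul_sum, Matrix.sum_mul]

lemma ptrans_sum {n d : ℕ} {K : Type*} (s : Finset K)
    (X : K → Matrix (Fin n × Fin d) (Fin n × Fin d) ℂ) :
    ptrans (∑ k ∈ s, X k) = ∑ k ∈ s, ptrans (X k) := by
  ext p q
  simp [ptrans, Matrix.sum_apply]

/-- Barrier estimate for (compressions of) Wishart matrices. -/
lemma scalar_core {σ f s C₀ k₀ s₀ β M : ℝ}
    (hD : BarrierData ((σ : ℂ) • (1 : Matrix (Unit × Unit) (Unit × Unit) ℂ)) f s C₀ k₀)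
    (hs₀ : 0 < s₀) (hs : s₀ < s) (hβ : β < k₀) (hM : 0 ≤ M) : ∃ C : ℝ, 0 ≤ C ∧
    ∀ (δ J : Type) [Fintype δ] [DecidableEq δ] [Nonempty δ] [Fintype J] (A : Matrix δ J ℂ),
      A * Aᴴ = 1 → ∀ m : ℕ, (m : ℝ) ≤ M * Fintype.card δ →
      (Measure.pi (fun _ : Fin m => gvec J)).real
        {w | ¬ (((Fintype.card δ / s₀ - m * β : ℝ) : ℂ) • 1 +
          (σ : ℂ) • (A * wish w * Aᴴ)).PosSemidef} ≤ C / (Fintype.card δ : ℝ) ^ 2 := by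
  obtain ⟨C, hC, h⟩ := barrier_core hD hs₀ hs hβ hM
  refine ⟨C, hC, fun δ J _ _ _ _ A hA m hm => ?_⟩
  refine le_trans ?_ (h δ m hm)
  set A' : Matrix (Unit × δ) J ℂ := A.submatrix Prod.snd id with hA'
  have hA'1 : A' * A'ᴴ = 1 := by
    ext ⟨⟨⟩, x⟩ ⟨⟨⟩, y⟩
    have := congrFun (congrFun hA x) y
    simpa [Matrix.mul_apply, hA', Matrix.one_apply] using this
  have hmp : MeasurePreserving (fun v : J → ℂ => A' *ᵥ v) (gvec J) (gvec (Unit × δ)) :=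
    ⟨measurable_mulVec A', gvec_map A' hA'1⟩
  have hmpi := measurePreserving_pi (fun _ : Fin m => gvec J) (fun _ => gvec (Unit × δ))
    (fun _ => hmp)
  rw [measureReal_def, measureReal_def,
    ← hmpi.measure_preimage (measurableSet_failSet _ _ _ _).nullMeasurableSet]
  refine ENNReal.toReal_mono (measure_ne_top _ _) (measure_mono fun w hw => ?_)
  simp only [Set.mem_ofPred_eq, Set.mem_preimage, failSet] at hw ⊢
  refine fun hP => hw ?_
  have hsub := hP.submatrix (fun x : δ => ((), x))
  convert hsub using 1
  simp only [upd_smul_one]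
  rw [← Finset.smul_sum, ← mul_wish_mul]
  ext x y
  simp [Matrix.add_apply, Matrix.sub_apply, Matrix.smul_apply, Matrix.one_apply, wish,
    Matrix.sum_apply, vecMulVec_apply, hA', mulVec, dotProduct]
  split_ifs <;> simp

/-- Largest eigenvalue of a compressed Wishart matrix. -/
lemma wishart_upper {ρ η : ℝ} (hρ : 0 < ρ) (hη : 0 < η) : ∃ C : ℝ, 0 ≤ C ∧
    ∀ (δ J : Type) [Fintype δ] [DecidableEq δ] [Nonempty δ] [Fintype J] (A : Matrix δ J ℂ),
      A * Aᴴ = 1 → ∀ m : ℕ, (m : ℝ) ≤ ρ * Fintype.card δ →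
      (Measure.pi (fun _ : Fin m => gvec J)).real
        {w | ¬ A * wish w * Aᴴ ≤ ((Fintype.card δ * ((1 + √ρ) ^ 2 + η) : ℝ) : ℂ) • 1} ≤
          C / (Fintype.card δ : ℝ) ^ 2 := by
  have hq : 0 < √ρ := Real.sqrt_pos.mpr hρ
  have hqq : √ρ * √ρ = ρ := Real.mul_self_sqrt hρ.le
  set s := 1 / (1 + √ρ) with hs
  have hs0 : 0 < s := by positivity
  have hs1 : s < 1 := by rw [hs, div_lt_one (by positivity)]; linarith
  have hinv : 1 / s = 1 + √ρ := by rw [hs]; simp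
  have hinv' : 1 / (1 - s) = (1 + √ρ) / √ρ := by
    have : 1 - s = √ρ / (1 + √ρ) := by rw [hs]; field_simp; ring
    rw [this, one_div_div]
  obtain ⟨s₀, hs₀1, hs₀2⟩ : ∃ s₀, 0 < s₀ ∧ s₀ < s ∧ 1 / s₀ ≤ 1 / s + η / 2 := by
    refine ⟨1 / (1 / s + η / 2), by positivity, ?_, by simp⟩
    rw [div_lt_iff₀ (by positivity), mul_add, mul_one_div, div_self hs0.ne']
    have : 0 < s * (η / 2) := by positivity
    linarith
  have hD : BarrierData (((-1 : ℝ) : ℂ) • (1 : Matrix (Unit × Unit) (Unit × Unit) ℂ)) 1 s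
      (1 / (1 - s)) (-(1 / (1 - s))) := by
    have h1 : 0 < 1 - s := by linarith
    refine unit_barrierData (by norm_num) zero_le_one (by norm_num) hs0 (by linarith)
      (by positivity) fun t ht0 hts => ?_
    have ht1 : 0 < 1 - t := by linarith
    have hle : 1 / (1 - t) ≤ 1 / (1 - s) := by gcongr
    have e : 1 / (-1 + t) = -(1 / (1 - t)) := by
      rw [show -1 + t = -(1 - t) by ring, div_neg]
    refine ⟨by linarith, ?_, ?_⟩
    · rwa [e, abs_neg, abs_of_pos (by positivity)]
    · rw [e]; linarith
  obtain ⟨C, hC, h⟩ := scalar_core hD hs₀1 hs₀2.1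
    (by have : 0 < η / (2 * ρ) := by positivity
        linarith : -(1 / (1 - s)) - η / (2 * ρ) < -(1 / (1 - s))) hρ.le
  refine ⟨C, hC, fun δ J _ _ _ _ A hA m hm => le_trans ?_ (h δ J A hA m hm)⟩
  refine measureReal_mono (fun w hw hP => hw ?_) (measure_ne_top _ _)
  have hD0 : (0 : ℝ) < Fintype.card δ := by exact_mod_cast Fintype.card_pos
  have h1 : A * wish w * Aᴴ ≤
      ((Fintype.card δ / s₀ - m * (-(1 / (1 - s)) - η / (2 * ρ)) : ℝ) : ℂ) • 1 := by
    rw [Complex.ofReal_neg, Complex.ofReal_one, neg_one_smul, ← sub_eq_add_neg] at hP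
    exact Matrix.le_iff.mpr hP
  refine h1.trans (real_smul_one_mono ?_)
  rw [hinv']
  have e1 : Fintype.card δ / s₀ ≤ Fintype.card δ * (1 + √ρ + η / 2) := by
    rw [div_eq_mul_one_div, ← hinv]
    gcongr
    exact hs₀2.2
  have e2 : m * ((1 + √ρ) / √ρ + η / (2 * ρ)) ≤
      ρ * Fintype.card δ * ((1 + √ρ) / √ρ + η / (2 * ρ)) := by gcongr
  have e3 : ρ * ((1 + √ρ) / √ρ + η / (2 * ρ)) = √ρ * (1 + √ρ) + η / 2 := by
    rw [mul_add, ← mul_div_assoc, mul_div_right_comm, Real.div_sqrt]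
    field_simp
  have e4 : ρ * Fintype.card δ * ((1 + √ρ) / √ρ + η / (2 * ρ)) =
      Fintype.card δ * (√ρ * (1 + √ρ) + η / 2) := by rw [← e3]; ring
  nlinarith

/-- Smallest eigenvalue of a Wishart matrix. -/
lemma wishart_lower {ρ η : ℝ} (hρ : 1 < ρ) (hη : 0 < η) : ∃ C : ℝ, 0 ≤ C ∧
    ∀ (δ : Type) [Fintype δ] [DecidableEq δ] [Nonempty δ] (m : ℕ), (m : ℝ) ≤ ρ * Fintype.card δ →
      ρ * Fintype.card δ ≤ m + 1 → 
      (Measure.pi (fun _ : Fin m => gvec δ)).real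
        {w | ¬ ((Fintype.card δ * ((√ρ - 1) ^ 2 - η) - 1 : ℝ) : ℂ) • 1 ≤ wish w} ≤
          C / (Fintype.card δ : ℝ) ^ 2 := by
  have hq : 1 < √ρ := by rw [Real.lt_sqrt zero_le_one]; simpa using hρ
  have hqq : √ρ * √ρ = ρ := Real.mul_self_sqrt (by linarith)
  set s := 1 / (√ρ - 1) with hs
  have hq1 : 0 < √ρ - 1 := by linarith
  have hs0 : 0 < s := by positivity
  have hinv : 1 / s = √ρ - 1 := by rw [hs]; simp
  have hinv' : 1 / (1 + s) = (√ρ - 1) / √ρ := by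
    have : 1 + s = √ρ / (√ρ - 1) := by rw [hs]; field_simp; ring
    rw [this, one_div_div]
  obtain ⟨s₀, hs₀1, hs₀2⟩ : ∃ s₀, 0 < s₀ ∧ s₀ < s ∧ 1 / s₀ ≤ 1 / s + η / 2 := by
    refine ⟨1 / (1 / s + η / 2), by positivity, ?_, by simp⟩
    rw [div_lt_iff₀ (by positivity), mul_add, mul_one_div, div_self hs0.ne']
    have : 0 < s * (η / 2) := by positivity
    linarith
  have hD : BarrierData (((1 : ℝ) : ℂ) • (1 : Matrix (Unit × Unit) (Unit × Unit) ℂ)) 0 s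
      1 (1 / (1 + s)) := by
    refine unit_barrierData (by norm_num) le_rfl (by norm_num) hs0 (by linarith)
      one_pos fun t ht0 hts => ?_
    refine ⟨by linarith, ?_, by gcongr⟩
    rw [abs_of_pos (by positivity), div_le_one (by linarith)]
    linarith
  obtain ⟨C, hC, h⟩ := scalar_core hD hs₀1 hs₀2.1
    (by have : 0 < η / (2 * ρ) := by positivity
        linarith : 1 / (1 + s) - η / (2 * ρ) < 1 / (1 + s)) (by linarith : 0 ≤ ρ)
  refine ⟨C, hC, fun δ _ _ _ m hm hm' => le_trans ?_ (h δ δ 1 (by simp) m hm)⟩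
  refine measureReal_mono (fun w hw hP => hw ?_) (measure_ne_top _ _)
  have hD0 : (0 : ℝ) < Fintype.card δ := by exact_mod_cast Fintype.card_pos
  have h1 : ((m * (1 / (1 + s) - η / (2 * ρ)) - Fintype.card δ / s₀ : ℝ) : ℂ) • 1 ≤ wish w := by
    rw [Complex.ofReal_one, one_smul, conjTranspose_one, Matrix.one_mul, Matrix.mul_one,
      ← neg_sub ((m : ℝ) * _), Complex.ofReal_neg, neg_smul, neg_add_eq_sub] at hP
    exact Matrix.le_iff.mpr hP
  refine le_trans (real_smul_one_mono ?_) h1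
  rw [hinv']
  have e1 : Fintype.card δ / s₀ ≤ Fintype.card δ * (√ρ - 1 + η / 2) := by
    rw [div_eq_mul_one_div, ← hinv]
    gcongr
    exact hs₀2.2
  have e0 : (√ρ - 1) / √ρ ≤ 1 := by rw [div_le_one (by linarith)]; linarith
  have e2 : m * ((√ρ - 1) / √ρ) ≥ ρ * Fintype.card δ * ((√ρ - 1) / √ρ) - 1 := by
    have : 0 ≤ (√ρ - 1) / √ρ := by positivity
    nlinarith
  have e5 : m * (η / (2 * ρ)) ≤ ρ * Fintype.card δ * (η / (2 * ρ)) := by gcongr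
  have e3 : ρ * ((√ρ - 1) / √ρ) = √ρ * (√ρ - 1) := by
    rw [← mul_div_assoc, mul_div_right_comm, Real.div_sqrt]
  have e4 : ρ * Fintype.card δ * ((√ρ - 1) / √ρ) = Fintype.card δ * (√ρ * (√ρ - 1)) := by
    rw [← e3]; ring
  have e6 : ρ * Fintype.card δ * (η / (2 * ρ)) = Fintype.card δ * (η / 2) := by field_simp
  nlinarith

/-- The partial transpose of a Wishart matrix is bounded below. -/
lemma wishart_ptrans {n : ℕ} {c : ℝ} (hn : 2 ≤ n) (hc : 2 ≤ c)
    (hc' : 4 * c * n ^ 2 - 4 < c ^ 2 * n ^ 2) : ∃ κ C : ℝ, 0 < κ ∧ 0 ≤ C ∧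
    ∀ d m : ℕ, 0 < d → (m : ℝ) ≤ c * n * d → c * n * d ≤ m + 1 →
      (Measure.pi (fun _ : Fin m => gvec (Fin n × Fin d))).real
        {w | ¬ ((κ * d - 1 : ℝ) : ℂ) • 1 ≤ ptrans (wish w)} ≤ C / (d : ℝ) ^ 2 := by
  have hn' : (2 : ℝ) ≤ n := by exact_mod_cast hn
  have hcn : 0 < c * n := by positivity
  have hd0 : 0 < c * (n : ℝ) ^ 2 - 1 := by nlinarith
  obtain ⟨s, hsd⟩ : ∃ s : ℝ, s * (2 * (c * n ^ 2 - 1)) = c * n :=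
    ⟨c * n / (2 * (c * n ^ 2 - 1)), by field_simp⟩
  have hs0 : 0 < s := by
    by_contra h
    nlinarith
  have hs : s ≤ 1 / 2 := by
    by_contra h
    push Not at h
    have : c * n < c * n ^ 2 - 1 → False := fun h' => by nlinarith
    apply this
    nlinarith [mul_pos (by linarith : 0 < c) (by linarith : (0 : ℝ) < n)]
  have hs2 : 0 < 1 - s ^ 2 := by nlinarith
  set k₀ := (1 - n * s) / (1 - s ^ 2) with hk₀
  obtain ⟨γ, hγ⟩ : ∃ γ : ℝ, γ = c * n * k₀ - 1 / s := ⟨_, rfl⟩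
  have hγ0 : 0 < γ := by
    have hnum : 0 < c * n * s * (1 - n * s) - (1 - s ^ 2) := by
      have h4 : 2 * (c * n * s * (1 - n * s) - (1 - s ^ 2)) = c * n * s - 2 := by
        linear_combination (-s) * hsd
      have : 0 < (c * n * s - 2) * (2 * (c * n ^ 2 - 1)) := by
        have : (c * n * s - 2) * (2 * (c * n ^ 2 - 1)) =
          c ^ 2 * n ^ 2 - (4 * c * n ^ 2 - 4) := by linear_combination c * n * hsd
        linarith
      have := pos_of_mul_pos_left this (by positivity)
      linarith
    have : γ = (c * n * s * (1 - n * s) - (1 - s ^ 2)) / ((1 - s ^ 2) * s) := by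
      rw [hγ, hk₀]; field_simp
    rw [this]; positivity
  have h1s : 0 < 1 / s := by positivity
  obtain ⟨s₀, hs₀1, hs₀2⟩ : ∃ s₀, 0 < s₀ ∧ s₀ < s ∧ 1 / s₀ ≤ 1 / s + γ / 4 := by
    refine ⟨1 / (1 / s + γ / 4), by positivity, ?_, by simp⟩
    rw [div_lt_iff₀ (by positivity), mul_add, mul_one_div, div_self hs0.ne']
    have : 0 < s * (γ / 4) := by positivity
    linarith
  set β := k₀ - γ / (4 * (c * n)) with hβ
  have hβe : c * n * β = c * n * k₀ - γ / 4 := by rw [hβ]; field_simp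
  have hβ0 : 0 ≤ β := by
    by_contra h
    nlinarith
  have hβ1 : β ≤ 1 := by
    have : k₀ ≤ 1 := by rw [hk₀, div_le_one hs2]; nlinarith
    have : 0 < γ / (4 * (c * n)) := by positivity
    linarith
  have : Nonempty (Fin n) := ⟨⟨0, by omega⟩⟩
  have hD := flip_barrierData (ι := Fin n) hs0 hs
  rw [Fintype.card_fin, ← hk₀] at hD
  obtain ⟨C, hC, h⟩ := barrier_core hD hs₀1 hs₀2.1
    (by have : 0 < γ / (4 * (c * n)) := by positivity
        linarith : β < k₀) hcn.le
  refine ⟨γ / 2, C, by positivity, hC, fun d m hd hm hm' => ?_⟩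
  have : Nonempty (Fin d) := ⟨⟨0, hd⟩⟩
  have hdd : (0 : ℝ) < d := by exact_mod_cast hd
  have h' := h (Fin d) m (by simpa using hm)
  rw [Fintype.card_fin] at h'
  refine le_trans ?_ h'
  refine measureReal_mono (fun w hw hP => hw ?_) (measure_ne_top _ _)
  simp only [upd_flipM] at hP
  rw [← ptrans_sum, ← sub_smul, ← neg_sub, neg_smul, neg_add_eq_sub, ← Complex.ofReal_sub] at hP
  refine le_trans (real_smul_one_mono ?_) (Matrix.le_iff.mpr hP)
  have e1 : d / s₀ ≤ d * (1 / s + γ / 4) := by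
    rw [div_eq_mul_one_div]
    gcongr
    exact hs₀2.2
  have e2 : (c * n * d - 1) * β ≤ m * β := by gcongr; linarith
  have e3 : c * n * d * β = d * (1 / s + γ - γ / 4) := by
    linear_combination d * hβe - d * hγ
  nlinarith

end Wishart

section Resolvent

open scoped Matrix.Norms.L2Operator MatrixOrder

set_option linter.unusedSectionVars false

variable {J : Type*} [Fintype J] [DecidableEq J]

/-- The resolvent `(A + t)⁻¹`. -/
def res (t : ℝ) (A : Matrix J J ℂ) : Matrix J J ℂ := (A + (t : ℂ) • 1)⁻¹

/-- The normalised trace of the resolvent. -/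
def stj (t : ℝ) (A : Matrix J J ℂ) : ℝ := (res t A).trace.re / Fintype.card J

lemma posDef_add_smul_one {A : Matrix J J ℂ} (hA : A.PosSemidef) {t : ℝ} (ht : 0 < t) :
    (A + (t : ℂ) • 1).PosDef :=
  Matrix.PosDef.posSemidef_add hA (PosDef.one.smul (by exact_mod_cast ht : (0 : ℂ) < t))

lemma mul_res {A : Matrix J J ℂ} (hA : A.PosSemidef) {t : ℝ} (ht : 0 < t) :
    (A + (t : ℂ) • 1) * res t A = 1 :=
  Matrix.mul_nonsing_inv _ ((Matrix.isUnit_iff_isUnit_det _).mp (posDef_add_smul_one hA ht).isUnit)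

lemma res_mul {A : Matrix J J ℂ} (hA : A.PosSemidef) {t : ℝ} (ht : 0 < t) :
    res t A * (A + (t : ℂ) • 1) = 1 := mul_eq_one_comm.mp (mul_res hA ht)

lemma res_posSemidef {A : Matrix J J ℂ} (hA : A.PosSemidef) {t : ℝ} (ht : 0 < t) :
    (res t A).PosSemidef := (posDef_add_smul_one hA ht).inv.posSemidef

lemma smul_res_sq_le {A : Matrix J J ℂ} (hA : A.PosSemidef) {t : ℝ} (ht : 0 < t) :
    (t : ℂ) • (res t A * res t A) ≤ res t A := by
  have hR := res_posSemidef hA ht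
  have h : res t A - (t : ℂ) • (res t A * res t A) = res t A * A * (res t A)ᴴ := by
    have : res t A * (A + (t : ℂ) • 1) * res t A = res t A := by
      rw [res_mul hA ht, Matrix.one_mul]
    rw [hR.isHermitian.eq]
    rw [Matrix.mul_add, Matrix.add_mul] at this
    rw [sub_eq_iff_eq_add]
    conv_lhs => rw [← this]
    simp
  rw [Matrix.le_iff, h]
  exact hA.mul_mul_conjTranspose_same _

lemma norm_res_le {A : Matrix J J ℂ} (hA : A.PosSemidef) {t : ℝ} (ht : 0 < t) :
    ‖res t A‖ ≤ 1 / t := by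
  have hR := res_posSemidef hA ht
  have h0 : (0 : Matrix J J ℂ) ≤ (t : ℂ) • (res t A * res t A) := by
    rw [Matrix.nonneg_iff_posSemidef]
    refine smul_posSemidef ?_ ht.le
    have := Matrix.posSemidef_self_mul_conjTranspose (res t A)
    rwa [hR.isHermitian.eq] at this
  have h1 := CStarAlgebra.norm_le_norm_of_nonneg_of_le h0 (smul_res_sq_le hA ht)
  have h2 : ‖res t A * res t A‖ = ‖res t A‖ * ‖res t A‖ := by
    have := CStarRing.norm_star_mul_self (x := res t A)
    rwa [star_eq_conjTranspose, hR.isHermitian.eq] at this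
  rw [norm_smul, h2, Complex.norm_real, Real.norm_of_nonneg ht.le] at h1
  rw [le_div_iff₀ ht]
  by_contra h
  push Not at h
  have h3 : 0 < ‖res t A‖ := by
    by_contra h'
    nlinarith [norm_nonneg (res t A)]
  nlinarith

lemma trace_res_le {A : Matrix J J ℂ} (hA : A.PosSemidef) {t : ℝ} (ht : 0 < t) :
    (res t A).trace.re ≤ Fintype.card J / t := by
  have h := norm_trace_mul_le (res t A) (Matrix.PosSemidef.one (n := J) (R := ℂ))
  rw [Matrix.mul_one, trace_one] at h
  refine (Complex.re_le_norm _).trans (h.trans ?_)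
  have := norm_res_le hA ht
  calc ‖res t A‖ * ((Fintype.card J : ℂ)).re ≤ 1 / t * Fintype.card J := by
        rw [Complex.natCast_re]; gcongr
    _ = _ := by ring

lemma frob2_res_le {A : Matrix J J ℂ} (hA : A.PosSemidef) {t : ℝ} (ht : 0 < t) :
    frob2 (res t A) ≤ (√(Fintype.card J) / t) ^ 2 := by
  have hR := res_posSemidef hA ht
  have h := norm_trace_mul_le (res t A) hR
  rw [frob2_eq_trace, hR.isHermitian.eq, div_pow, Real.sq_sqrt (by positivity)]
  refine (Complex.re_le_norm _).trans (h.trans ?_)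
  calc ‖res t A‖ * (res t A).trace.re ≤ 1 / t * (Fintype.card J / t) := by
        have := norm_res_le hA ht
        have := trace_res_le hA ht
        have := posSemidef_trace_re_nonneg hR
        gcongr
    _ = _ := by field_simp

lemma stj_nonneg {A : Matrix J J ℂ} (hA : A.PosSemidef) {t : ℝ} (ht : 0 < t) : 0 ≤ stj t A :=
  div_nonneg (posSemidef_trace_re_nonneg (res_posSemidef hA ht)) (Nat.cast_nonneg _)

lemma qf_real {R : Matrix J J ℂ} (hR : R.IsHermitian) (v : J → ℂ) : qf R v = ((qf R v).re : ℂ) := by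
  have := qf_conjTranspose R v
  rw [hR.eq] at this
  exact (Complex.conj_eq_iff_re.mp this.symm).symm

lemma trace_mul_vecMulVec (R : Matrix J J ℂ) (v : J → ℂ) :
    (R * vecMulVec v (star v)).trace = qf R v := by
  rw [Matrix.mul_vecMulVec, trace_vecMulVec, dotProduct_comm, qf]

/-- Rank one update of the resolvent. -/
lemma res_update {A : Matrix J J ℂ} (hA : A.PosSemidef) {t y : ℝ} (ht : 0 < t) (hy : 0 ≤ y)
    (v : J → ℂ) :
    let A' := A + (y : ℂ) • vecMulVec v (star v)
    let q := y * (qf (res t A) v).re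
    A'.PosSemidef ∧ 0 ≤ q ∧ y * (qf (res t A') v).re = q / (1 + q) ∧
      |(res t A').trace.re - (res t A).trace.re| ≤ 1 / t := by
  intro A' q
  have hA' : A'.PosSemidef := hA.add (smul_posSemidef (posSemidef_vecMulVec_self_star v) hy)
  have hR := res_posSemidef hA ht
  have hq : 0 ≤ q := mul_nonneg hy (posSemidef_qf_nonneg hR v)
  have h1 : (A' + (t : ℂ) • 1) *ᵥ (res t A *ᵥ v) = ((1 + q : ℝ) : ℂ) • v := by
    have e : A' + (t : ℂ) • 1 = (A + (t : ℂ) • 1) + (y : ℂ) • vecMulVec v (star v) := by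
      simp only [A']; abel
    rw [e, add_mulVec, mulVec_mulVec, mul_res hA ht, one_mulVec, smul_mulVec,
      vecMulVec_mulVec]
    change v + (y : ℂ) • (MulOpposite.op (qf (res t A) v)) • v = _
    rw [qf_real hR.isHermitian, op_smul_eq_smul, smul_smul, Complex.ofReal_add, add_smul,
      Complex.ofReal_one, one_smul, Complex.ofReal_mul]
  have h2 : res t A *ᵥ v = ((1 + q : ℝ) : ℂ) • (res t A' *ᵥ v) := by
    have := congrArg (fun x => res t A' *ᵥ x) h1
    rwa [mulVec_mulVec, res_mul hA' ht, one_mulVec, mulVec_smul] at this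
  have h3 : (qf (res t A) v).re = (1 + q) * (qf (res t A') v).re := by
    rw [qf, h2, dotProduct_smul, smul_eq_mul, Complex.re_ofReal_mul, qf]
  have h4 : y * (qf (res t A') v).re = q / (1 + q) := by
    rw [eq_div_iff (by positivity)]
    simp only [q] at h3 ⊢
    linear_combination (-y) * h3
  refine ⟨hA', hq, h4, ?_⟩
  have hdiff : res t A - res t A' = (y : ℂ) • (res t A' * vecMulVec v (star v) * res t A) := by
    have e : A' + (t : ℂ) • 1 = (A + (t : ℂ) • 1) + (y : ℂ) • vecMulVec v (star v) := by
      simp only [A']; abel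
    calc res t A - res t A' = res t A' * ((A' + (t : ℂ) • 1) - (A + (t : ℂ) • 1)) * res t A := by
          rw [Matrix.mul_sub, Matrix.sub_mul, res_mul hA' ht, Matrix.mul_assoc, mul_res hA ht]
          simp
      _ = _ := by rw [e, add_sub_cancel_left]; simp
  have htr : (res t A).trace.re - (res t A').trace.re =
      y * (qf (res t A * res t A) v).re / (1 + q) := by
    rw [← Complex.sub_re, ← trace_sub, hdiff, trace_smul, Matrix.trace_mul_comm,
      ← Matrix.mul_assoc, trace_mul_vecMulVec, smul_eq_mul, Complex.re_ofReal_mul, mul_div_assoc]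
    congr 1
    rw [eq_div_iff (by positivity), qf, qf, ← mulVec_mulVec v (res t A) (res t A), h2, mulVec_smul,
      dotProduct_smul, smul_eq_mul, Complex.re_ofReal_mul, mulVec_mulVec, mul_comm]
  have h5 : 0 ≤ (qf (res t A * res t A) v).re := by
    refine posSemidef_qf_nonneg ?_ v
    have := Matrix.posSemidef_self_mul_conjTranspose (res t A)
    rwa [hR.isHermitian.eq] at this
  have h6 : t * (qf (res t A * res t A) v).re ≤ (qf (res t A) v).re := by
    have := posSemidef_qf_nonneg (Matrix.le_iff.mp (smul_res_sq_le hA ht)) v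
    rw [qf_sub, qf_smul, Complex.sub_re, Complex.re_ofReal_mul] at this
    linarith
  rw [abs_sub_comm, htr, abs_of_nonneg (by positivity), div_le_div_iff₀ (by positivity) ht]
  have : y * (t * (qf (res t A * res t A) v).re) ≤ q := by
    simp only [q]; gcongr
  nlinarith

lemma abs_div_one_add_sub_le {x y : ℝ} (hx : 0 ≤ x) (hy : 0 ≤ y) :
    |x / (1 + x) - y / (1 + y)| ≤ |x - y| := by
  have : x / (1 + x) - y / (1 + y) = (x - y) / ((1 + x) * (1 + y)) := by
    field_simp; ring
  rw [this, abs_div, abs_of_pos (by positivity : 0 < (1 + x) * (1 + y))]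
  exact div_le_self (abs_nonneg _) (by nlinarith [mul_nonneg hx hy])

lemma continuous_res {Y : Type*} [TopologicalSpace Y] {A : Y → Matrix J J ℂ} (hA : Continuous A)
    (hp : ∀ y, (A y).PosSemidef) {t : ℝ} (ht : 0 < t) : Continuous fun y => res t (A y) := by
  rw [continuous_iff_continuousAt]
  intro y
  simp only [res, Matrix.nonsing_inv_eq_ringInverse]
  obtain ⟨u, hu⟩ := (posDef_add_smul_one (hp y) ht).isUnit
  have h := NormedRing.inverse_continuousAt u
  rw [hu] at h
  exact ContinuousAt.comp (f := fun y => A y + (t : ℂ) • 1) h (by fun_prop)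

end Resolvent

section Bulk

open scoped Matrix.Norms.L2Operator MatrixOrder

/-- The Wishart matrix with the `k`-th sample removed. -/
def wishErase {J : Type*} {m : ℕ} (w : Fin m → J → ℂ) (k : Fin m) : Matrix J J ℂ :=
  ∑ j ∈ Finset.univ.erase k, vecMulVec (w j) (star (w j))

lemma wish_eq_erase {J : Type*} {m : ℕ} (w : Fin m → J → ℂ) (k : Fin m) :
    wish w = wishErase w k + vecMulVec (w k) (star (w k)) :=
  (Finset.sum_erase_add _ _ (Finset.mem_univ k)).symm

lemma wishErase_posSemidef {J : Type*} [Fintype J] {m : ℕ} (w : Fin m → J → ℂ) (k : Fin m) :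
    (wishErase w k).PosSemidef :=
  Matrix.posSemidef_sum _ fun _ _ => posSemidef_vecMulVec_self_star _

lemma wish_posSemidef {J : Type*} [Fintype J] {m : ℕ} (w : Fin m → J → ℂ) :
    (wish w).PosSemidef :=
  Matrix.posSemidef_sum _ fun _ _ => posSemidef_vecMulVec_self_star _

lemma continuous_vecMulVec_self {J : Type*} {m : ℕ} (j : Fin m) :
    Continuous fun w : Fin m → J → ℂ => vecMulVec (w j) (star (w j)) := by
  refine continuous_matrix fun a b => ?_
  simp only [vecMulVec_apply, Pi.star_apply]
  fun_prop

lemma continuous_wishErase {J : Type*} {m : ℕ} (k : Fin m) :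
    Continuous fun w : Fin m → J → ℂ => wishErase w k :=
  continuous_finsetSum _ fun j _ => continuous_vecMulVec_self j

lemma continuous_wish {J : Type*} {m : ℕ} : Continuous fun w : Fin m → J → ℂ => wish w :=
  continuous_finsetSum _ fun j _ => continuous_vecMulVec_self j

lemma wishErase_insertNth {J : Type*} {r : ℕ} (k : Fin (r + 1)) (v : J → ℂ) (w : Fin r → J → ℂ) :
    wishErase (k.insertNth v w : Fin (r + 1) → J → ℂ) k = wish w := by
  have h := wish_eq_erase (k.insertNth v w : Fin (r + 1) → J → ℂ) k
  rw [wish, Fin.sum_univ_succAbove _ k] at h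
  simp only [Fin.insertNth_apply_same, Fin.insertNth_apply_succAbove] at h
  rw [add_comm] at h
  exact (add_right_cancel h).symm

/-- The self-consistent equation for the normalised resolvent trace of a sample covariance matrix. -/
lemma stj_self_consistent {J : Type*} [Fintype J] [DecidableEq J] [Nonempty J] {m : ℕ}
    (w : Fin m → J → ℂ) {t θ : ℝ} (ht : 0 < t)
    (h : ∀ k, |(qf (res t (((1 / Fintype.card J : ℝ) : ℂ) • wishErase w k)) (w k)).re -
      (res t (((1 / Fintype.card J : ℝ) : ℂ) • wishErase w k)).trace.re| ≤ Fintype.card J * θ) :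
    |1 - t * stj t (((1 / Fintype.card J : ℝ) : ℂ) • wish w) - m / Fintype.card J *
      (stj t (((1 / Fintype.card J : ℝ) : ℂ) • wish w) /
        (1 + stj t (((1 / Fintype.card J : ℝ) : ℂ) • wish w)))| ≤
      m / Fintype.card J * (θ + 1 / (Fintype.card J * t)) := by
  set N : ℝ := (Fintype.card J : ℝ) with hN
  have hN0 : 0 < N := by rw [hN]; exact_mod_cast Fintype.card_pos
  set y : ℝ := 1 / N with hy
  have hy0 : 0 ≤ y := by positivity
  set W : Matrix J J ℂ := (y : ℂ) • wish w with hW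
  have hWp : W.PosSemidef := smul_posSemidef (wish_posSemidef w) hy0
  set s := stj t W with hs
  have hs0 : 0 ≤ s := stj_nonneg hWp ht
  have hsum : ∑ k, y * (qf (res t W) (w k)).re = N * (1 - t * s) := by
    have h1 : (res t W * W).trace.re = N * (1 - t * s) := by
      have := res_mul hWp ht
      rw [Matrix.mul_add, ← eq_sub_iff_add_eq] at this
      rw [this, trace_sub, trace_one, Matrix.mul_smul, Matrix.mul_one, trace_smul, Complex.sub_re,
        smul_eq_mul, Complex.re_ofReal_mul, Complex.natCast_re, hs, stj, ← hN]
      field_simp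
    rw [← h1, hW, Matrix.mul_smul, trace_smul, smul_eq_mul, Complex.re_ofReal_mul, ← hW,
      ← Finset.mul_sum]
    congr 1
    rw [wish, Matrix.mul_sum, trace_sum, Complex.re_sum]
    exact Finset.sum_congr rfl fun k _ => by rw [trace_mul_vecMulVec]
  have hk : ∀ k, |y * (qf (res t W) (w k)).re - s / (1 + s)| ≤ θ + 1 / (N * t) := by
    intro k
    have hA := smul_posSemidef (wishErase_posSemidef w k) hy0
    obtain ⟨-, hq, h2, h3⟩ := res_update hA ht hy0 (w k)
    have e : (y : ℂ) • wishErase w k + (y : ℂ) • vecMulVec (w k) (star (w k)) = W := by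
      rw [← smul_add, ← wish_eq_erase]
    rw [e] at h2 h3
    rw [h2]
    refine (abs_div_one_add_sub_le hq hs0).trans ?_
    have hk := h k
    set a := (qf (res t ((y : ℂ) • wishErase w k)) (w k)).re
    set b := (res t ((y : ℂ) • wishErase w k)).trace.re
    have e2 : s = y * (res t W).trace.re := by rw [hs, stj, ← hN, hy]; ring
    have e3 : y * a - s = y * (a - b) - y * ((res t W).trace.re - b) := by rw [e2]; ring
    rw [e3]
    refine (abs_sub _ _).trans ?_
    rw [abs_mul, abs_mul, abs_of_nonneg hy0]
    have e4 : y * |a - b| ≤ y * (N * θ) := by gcongr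
    have e5 : y * |(res t W).trace.re - b| ≤ y * (1 / t) := by gcongr
    have e6 : y * (N * θ) = θ := by rw [hy]; field_simp
    have e7 : y * (1 / t) = 1 / (N * t) := by rw [hy]; field_simp
    linarith
  have hfin : 1 - t * s - m / N * (s / (1 + s)) =
      (1 / N) * ∑ k, (y * (qf (res t W) (w k)).re - s / (1 + s)) := by
    rw [Finset.sum_sub_distrib, hsum]
    simp only [Finset.sum_const, Finset.card_univ, Fintype.card_fin, nsmul_eq_mul]
    field_simp
  rw [hfin, abs_mul, abs_of_nonneg (by positivity)]
  have := (Finset.abs_sum_le_sum_abs (fun k => y * (qf (res t W) (w k)).re - s / (1 + s))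
    Finset.univ).trans (Finset.sum_le_card_nsmul _ _ _ fun k _ => hk k)
  rw [Finset.card_univ, Fintype.card_fin, nsmul_eq_mul] at this
  calc 1 / N * |∑ k, (y * (qf (res t W) (w k)).re - s / (1 + s))|
      ≤ 1 / N * (m * (θ + 1 / (N * t))) := by gcongr
    _ = _ := by ring

/-- Concentration of one quadratic form of the resolvent with that sample removed. -/
lemma wishart_qf_tail {J : Type} [Fintype J] [DecidableEq J] [Nonempty J] {m : ℕ} {t y θ : ℝ}
    (ht : 0 < t) (hy : 0 ≤ y) (k : Fin m) :
    (Measure.pi (fun _ : Fin m => gvec J)).real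
      {w | θ ≤ ‖qf (res t ((y : ℂ) • wishErase w k)) (w k) -
        (res t ((y : ℂ) • wishErase w k)).trace‖} ≤
      8 * Real.exp (-(θ / (4 * (√(Fintype.card J) / t)))) := by
  have hF : 0 < √(Fintype.card J) / t := by
    have : (0 : ℝ) < Fintype.card J := by exact_mod_cast Fintype.card_pos
    positivity
  have hcont : Continuous fun w : Fin m → J → ℂ => res t ((y : ℂ) • wishErase w k) :=
    continuous_res ((continuous_wishErase k).const_smul (y : ℂ))
      (fun w => smul_posSemidef (wishErase_posSemidef w k) hy) ht
  have hmeas : MeasurableSet {w : Fin m → J → ℂ |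
      θ ≤ ‖qf (res t ((y : ℂ) • wishErase w k)) (w k) -
        (res t ((y : ℂ) • wishErase w k)).trace‖} := by
    refine IsClosed.measurableSet (isClosed_le continuous_const (Continuous.norm ?_))
    refine Continuous.sub ?_ hcont.matrix_trace
    exact Continuous.dotProduct (continuous_star.comp (continuous_apply k))
      (hcont.matrix_mulVec (continuous_apply k))
  cases m with
  | zero => exact k.elim0
  | succ r =>
    refine ENNReal.toReal_le_of_le_ofReal (by positivity) ?_
    have h := (measurePreserving_piFinSuccAbove (fun _ : Fin (r + 1) => gvec J) k).symm
    rw [← h.measure_preimage hmeas.nullMeasurableSet, Measure.prod_apply_symm (h.measurable hmeas)]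
    refine (lintegral_mono (g := fun _ =>
      ENNReal.ofReal (8 * Real.exp (-(θ / (4 * (√(Fintype.card J) / t)))))) fun w => ?_).trans ?_
    · have h2 := gvec_tail (θ := θ) (res t ((y : ℂ) • wish w)) hF
        (frob2_res_le (smul_posSemidef (wish_posSemidef w) hy) ht)
      rw [← ofReal_measureReal]
      refine ENNReal.ofReal_le_ofReal (le_trans (le_of_eq ?_) h2)
      congr 1
      ext v
      change θ ≤ ‖qf (res t ((y : ℂ) • wishErase (k.insertNth v w : Fin (r + 1) → J → ℂ) k))
        ((k.insertNth v w : Fin (r + 1) → J → ℂ) k) -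
        (res t ((y : ℂ) • wishErase (k.insertNth v w : Fin (r + 1) → J → ℂ) k)).trace‖ ↔ _
      rw [wishErase_insertNth, Fin.insertNth_apply_same]
      rfl
    · rw [lintegral_const, measure_univ, mul_one]

lemma root_stability {c t s x : ℝ} (hc : 0 ≤ c) (hs : 0 ≤ s) (hx : 0 ≤ x)
    (hroot : 1 - t * s = c * (s / (1 + s))) :
    t * |x - s| ≤ |1 - t * x - c * (x / (1 + x))| := by
  have e : 1 - t * x - c * (x / (1 + x)) = -((x - s) * (t + c / ((1 + x) * (1 + s)))) := by
    have : 1 - t * x - c * (x / (1 + x)) = -(t * (x - s)) - c * (x / (1 + x) - s / (1 + s)) := by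
      linear_combination hroot
    rw [this]
    field_simp
    ring
  rw [e, abs_neg, abs_mul, mul_comm]
  refine mul_le_mul_of_nonneg_left (le_trans ?_ (le_abs_self _)) (abs_nonneg _)
  have : 0 ≤ c / ((1 + x) * (1 + s)) := by positivity
  linarith

/-- Convergence in probability of the normalised resolvent trace. -/
lemma wishart_bulk {c t s η ε : ℝ} (hc : 0 < c) (ht : 0 < t) (hs : 0 ≤ s)
    (hroot : 1 - t * s = c * (s / (1 + s))) (hη : 0 < η) (hε : 0 < ε) :
    ∃ N₀ : ℕ, ∀ (J : Type) [Fintype J] [DecidableEq J] [Nonempty J] (m : ℕ), N₀ ≤ Fintype.card J →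
      (m : ℝ) ≤ c * Fintype.card J → c * Fintype.card J ≤ m + 1 →
      (Measure.pi (fun _ : Fin m => gvec J)).real
        {w | ¬ |stj t (((1 / Fintype.card J : ℝ) : ℂ) • wish w) - s| ≤ η} ≤ ε := by
  set θ := t * η / (2 * c) with hθ
  have hθ0 : 0 < θ := by positivity
  set κ := θ * t / 4 with hκ
  have hκ0 : 0 < κ := by positivity
  obtain ⟨N₀, hN₀⟩ := exists_nat_ge
    ((c / t + 1) / (t * η / 2) + 8 * c * 24 / (κ ^ 4 * ε))
  refine ⟨N₀, fun J _ _ _ m hN hm hm' => ?_⟩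
  set N : ℝ := (Fintype.card J : ℝ) with hNdef
  have hN0 : 0 < N := by rw [hNdef]; exact_mod_cast Fintype.card_pos
  have hNN : ((c / t + 1) / (t * η / 2) + 8 * c * 24 / (κ ^ 4 * ε)) ≤ N :=
    hN₀.trans (by rw [hNdef]; exact_mod_cast hN)
  have hN1 : c / t + 1 ≤ N * (t * η / 2) := by
    rw [← div_le_iff₀ (by positivity)]
    have : 0 ≤ 8 * c * 24 / (κ ^ 4 * ε) := by positivity
    linarith
  have hN2 : 8 * c * 24 ≤ N * (κ ^ 4 * ε) := by
    rw [← div_le_iff₀ (by positivity)]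
    have : 0 ≤ (c / t + 1) / (t * η / 2) := by positivity
    linarith
  set E : Fin m → Set (Fin m → J → ℂ) := fun k =>
    {w | N * θ ≤ ‖qf (res t (((1 / N : ℝ) : ℂ) • wishErase w k)) (w k) -
        (res t (((1 / N : ℝ) : ℂ) • wishErase w k)).trace‖} with hE
  have hsub : {w : Fin m → J → ℂ | ¬ |stj t (((1 / N : ℝ) : ℂ) • wish w) - s| ≤ η} ⊆ ⋃ k, E k := by
    intro w hw
    by_contra hcon
    refine hw ?_
    simp only [Set.mem_iUnion, hE, Set.mem_ofPred_eq, not_exists, not_le] at hcon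
    have h1 := stj_self_consistent w (θ := θ) ht fun k => by
      rw [← Complex.sub_re]
      exact (Complex.abs_re_le_norm _).trans (hcon k).le
    rw [← hNdef] at h1
    set x := stj t (((1 / N : ℝ) : ℂ) • wish w)
    have hx : 0 ≤ x := stj_nonneg (smul_posSemidef (wish_posSemidef w) (by positivity)) ht
    have h2 := root_stability hc.le hs hx hroot
    have h3 : |(c - m / N) * (x / (1 + x))| ≤ 1 / N := by
      have hx1 : x / (1 + x) ≤ 1 := by rw [div_le_one (by positivity)]; linarith
      have hx2 : 0 ≤ x / (1 + x) := by positivity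
      have hm1 : m / N ≤ c := by rw [div_le_iff₀ hN0]; exact hm
      have hm2 : c - m / N ≤ 1 / N := by
        rw [sub_le_iff_le_add, ← add_div, le_div_iff₀ hN0]; linarith
      rw [abs_of_nonneg (mul_nonneg (by linarith) hx2)]
      have : 0 ≤ 1 / N := by positivity
      nlinarith
    have h4 : 1 - t * x - c * (x / (1 + x)) =
      (1 - t * x - m / N * (x / (1 + x))) - (c - m / N) * (x / (1 + x)) := by ring
    rw [h4] at h2
    have h5 := h2.trans (abs_sub _ _)
    have h6 : m / N * (θ + 1 / (N * t)) ≤ c * (θ + 1 / (N * t)) := by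
      have hm1 : m / N ≤ c := by rw [div_le_iff₀ hN0]; exact hm
      gcongr
    have h7 : c * (θ + 1 / (N * t)) + 1 / N ≤ t * η := by
      have e1 : c * θ = t * η / 2 := by rw [hθ]; field_simp
      have e2 : c * (1 / (N * t)) + 1 / N = (c / t + 1) / N := by field_simp
      have e3 : (c / t + 1) / N ≤ t * η / 2 := by rw [div_le_iff₀ hN0]; linarith
      linarith
    exact le_of_mul_le_mul_left (by linarith) ht
  refine (measureReal_mono hsub (measure_ne_top _ _)).trans ?_
  refine (measureReal_iUnion_fintype_le _).trans ?_
  refine (Finset.sum_le_card_nsmul _ _ _ fun k _ => wishart_qf_tail ht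
    (by positivity : 0 ≤ 1 / N) k).trans ?_
  rw [Finset.card_univ, Fintype.card_fin, nsmul_eq_mul, ← hNdef]
  have hsq : √N * √N = N := Real.mul_self_sqrt hN0.le
  have hsq0 : 0 < √N := Real.sqrt_pos.mpr hN0
  have e1 : N * θ / (4 * (√N / t)) = κ * √N := by
    rw [hκ]
    field_simp
    nlinarith
  rw [e1]
  have e2 := Real.pow_div_factorial_le_exp (κ * √N) (by positivity) 4
  have e3 : (κ * √N) ^ 4 / (Nat.factorial 4 : ℝ) = κ ^ 4 * N ^ 2 / 24 := by
    have : (Nat.factorial 4 : ℝ) = 24 := by norm_num [Nat.factorial]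
    rw [this, mul_pow, show √N ^ 4 = (√N * √N) ^ 2 by ring, hsq]
  rw [e3] at e2
  have e4 : Real.exp (-(κ * √N)) ≤ 24 / (κ ^ 4 * N ^ 2) := by
    rw [Real.exp_neg, ← one_div, div_le_div_iff₀ (Real.exp_pos _) (by positivity)]
    linarith
  calc (m : ℝ) * (8 * Real.exp (-(κ * √N))) ≤ (c * N) * (8 * (24 / (κ ^ 4 * N ^ 2))) := by
        gcongr
    _ = 8 * c * 24 / (N * κ ^ 4) := by field_simp
    _ ≤ ε := by rw [div_le_iff₀ (by positivity)]; linarith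

end Bulk

section MarcenkoPastur

lemma integral_sqrt_div_add {z : ℝ} (hz : 1 < z) :
    ∫ u in (-1 : ℝ)..1, √(1 - u ^ 2) / (z + u) = Real.pi * (z - √(z ^ 2 - 1)) := by
  have hz2 : 0 < z ^ 2 - 1 := by nlinarith
  set r := √(z ^ 2 - 1) with hr
  have hr0 : 0 < r := Real.sqrt_pos.mpr hz2
  have hrr : r ^ 2 = z ^ 2 - 1 := Real.sq_sqrt hz2.le
  have hzu : ∀ u ∈ Set.Icc (-1 : ℝ) 1, 0 < z + u := fun u hu => by linarith [hu.1]
  have hcont : ContinuousOn (fun u => √(1 - u ^ 2) + z * Real.arcsin u -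
      r * Real.arcsin ((1 + z * u) / (z + u))) (Set.Icc (-1) 1) := by
    refine ContinuousOn.sub (by fun_prop) (continuousOn_const.mul ?_)
    refine Real.continuous_arcsin.comp_continuousOn (ContinuousOn.div (by fun_prop) (by fun_prop) ?_)
    exact fun u hu => (hzu u hu).ne'
  have hintegrable : IntervalIntegrable (fun u => √(1 - u ^ 2) / (z + u)) volume (-1) 1 := by
    refine ContinuousOn.intervalIntegrable ?_
    rw [Set.uIcc_of_le (by norm_num)]
    exact ContinuousOn.div (by fun_prop) (by fun_prop) fun u hu => (hzu u hu).ne'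
  rw [intervalIntegral.integral_eq_sub_of_hasDerivAt_of_le (by norm_num) hcont (fun u hu => ?_) hintegrable]
  · have e1 : (1 + z * 1) / (z + 1) = 1 := by rw [div_eq_one_iff_eq (by linarith)]; ring
    have e2 : (1 + z * -1) / (z + -1) = -1 := by
      rw [div_eq_iff (by linarith)]; ring
    simp only [e1, e2, Real.arcsin_one, Real.arcsin_neg_one]
    norm_num
    ring
  · have hu1 : 0 < 1 - u ^ 2 := by nlinarith [hu.1, hu.2]
    have hzu0 : 0 < z + u := by linarith [hu.1]
    set q := √(1 - u ^ 2) with hq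
    have hq0 : 0 < q := Real.sqrt_pos.mpr hu1
    have hqq : q ^ 2 = 1 - u ^ 2 := Real.sq_sqrt hu1.le
    have d1 : HasDerivAt (fun u : ℝ => √(1 - u ^ 2)) (-(2 * u) / (2 * q)) u := by
      have : HasDerivAt (fun u : ℝ => 1 - u ^ 2) (-(2 * u)) u := by
        simpa using (hasDerivAt_pow 2 u).const_sub 1
      exact this.sqrt hu1.ne'
    have d2 : HasDerivAt (fun u => z * Real.arcsin u) (z * (1 / q)) u :=
      (Real.hasDerivAt_arcsin hu.1.ne' hu.2.ne).const_mul z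
    have hw : 1 - ((1 + z * u) / (z + u)) ^ 2 = (r * q / (z + u)) ^ 2 := by
      rw [div_pow, div_pow, mul_pow, hrr, hqq]
      field_simp
      ring
    have hw0 : 0 < r * q / (z + u) := by positivity
    have hne1 : (1 + z * u) / (z + u) ≠ -1 := fun h => by rw [h] at hw; nlinarith
    have hne2 : (1 + z * u) / (z + u) ≠ 1 := fun h => by rw [h] at hw; nlinarith
    have d3 : HasDerivAt (fun u => (1 + z * u) / (z + u))
        ((z * (z + u) - (1 + z * u) * 1) / (z + u) ^ 2) u := by
      refine HasDerivAt.fun_div ?_ ?_ hzu0.ne'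
      · simpa using ((hasDerivAt_id u).const_mul z).const_add 1
      · simpa using (hasDerivAt_id u).const_add z
    have d4 := ((Real.hasDerivAt_arcsin hne1 hne2).comp u d3).const_mul r
    rw [hw, Real.sqrt_sq hw0.le] at d4
    refine ((d1.add d2).sub d4).congr_deriv ?_
    field_simp
    linear_combination (-(1 : ℝ)) * hqq + 0 * hrr

/-- The Marčenko–Pastur density. -/
def mpDens (c x : ℝ) : ℝ :=
  Set.indicator (Set.Ioo ((1 - √c) ^ 2) ((1 + √c) ^ 2))
    (fun y => √(((1 + √c) ^ 2 - y) * (y - (1 - √c) ^ 2)) / (2 * Real.pi * y)) x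

lemma mpDens_nonneg (c x : ℝ) : 0 ≤ mpDens c x := by
  refine Set.indicator_nonneg (fun y hy => ?_) x
  have : 0 ≤ y := (sq_nonneg _).trans hy.1.le
  have := Real.pi_pos
  positivity

lemma measurable_mpDens (c : ℝ) : Measurable (mpDens c) := by
  refine Measurable.indicator ?_ measurableSet_Ioo
  fun_prop

lemma MP_eq {c : ℝ} (hc : 1 ≤ c) :
    MP c = volume.withDensity (fun x => ENNReal.ofReal (mpDens c x)) := by
  rw [MP, max_eq_right (by linarith), ENNReal.ofReal_zero, zero_smul, zero_add]
  rfl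

/-- Integration against the Marčenko–Pastur law in the semicircle coordinate. -/
lemma mp_integral {c : ℝ} (hc : 1 < c) (f : ℝ → ℝ) :
    ∫ x, f x ∂(MP c) = √c / Real.pi * ∫ u in (-1 : ℝ)..1,
      f (2 * √c * u + (1 + c)) * (√(1 - u ^ 2) / ((1 + c) / (2 * √c) + u)) := by
  have hq : 0 < √c := Real.sqrt_pos.mpr (by linarith)
  have hqq : √c ^ 2 = c := Real.sq_sqrt (by linarith)
  have hpi := Real.pi_pos
  rw [MP_eq hc.le, integral_withDensity_eq_integral_toReal_smul
    (measurable_mpDens c).ennreal_ofReal (by simp)]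
  have e : ∀ x, (ENNReal.ofReal (mpDens c x)).toReal • f x =
      Set.indicator (Set.Ioo ((1 - √c) ^ 2) ((1 + √c) ^ 2))
        (fun y => √(((1 + √c) ^ 2 - y) * (y - (1 - √c) ^ 2)) / (2 * Real.pi * y) * f y) x := by
    intro x
    rw [ENNReal.toReal_ofReal (mpDens_nonneg c x), smul_eq_mul, mpDens]
    by_cases hx : x ∈ Set.Ioo ((1 - √c) ^ 2) ((1 + √c) ^ 2)
    · simp [hx]
    · simp [hx]
  simp_rw [e]
  rw [integral_indicator measurableSet_Ioo, ← integral_Ioc_eq_integral_Ioo,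
    ← intervalIntegral.integral_of_le (by nlinarith)]
  have ha : (1 - √c) ^ 2 = 2 * √c * (-1) + (1 + c) := by rw [sub_sq, hqq]; ring
  have hb : (1 + √c) ^ 2 = 2 * √c * 1 + (1 + c) := by rw [add_sq, hqq]; ring
  rw [ha, hb, ← intervalIntegral.mul_integral_comp_mul_add, ← intervalIntegral.integral_const_mul,
    ← intervalIntegral.integral_const_mul]
  refine intervalIntegral.integral_congr fun u hu => ?_
  rw [Set.uIcc_of_le (by norm_num)] at hu
  have e1 : (2 * √c * 1 + (1 + c) - (2 * √c * u + (1 + c))) *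
      (2 * √c * u + (1 + c) - (2 * √c * (-1) + (1 + c))) = (2 * √c) ^ 2 * (1 - u ^ 2) := by ring
  have hzu : 0 < (1 + c) / (2 * √c) + u := by
    have : 1 < (1 + c) / (2 * √c) := by
      rw [lt_div_iff₀ (by positivity)]
      have : 1 < √c := by rw [Real.lt_sqrt zero_le_one]; simpa using hc
      nlinarith
    linarith [hu.1]
  have e2 : 2 * √c * u + (1 + c) = 2 * √c * ((1 + c) / (2 * √c) + u) := by field_simp; ring
  rw [e1, Real.sqrt_mul (by positivity), Real.sqrt_sq (by positivity)]
  generalize f (2 * √c * u + (1 + c)) = F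
  rw [e2]
  field_simp

lemma mp_param {c : ℝ} (hc : 1 < c) : 1 < (1 + c) / (2 * √c) := by
  have hq : 0 < √c := Real.sqrt_pos.mpr (by linarith)
  have hqq : √c ^ 2 = c := Real.sq_sqrt (by linarith)
  rw [lt_div_iff₀ (by positivity)]
  have : 1 < √c := by rw [Real.lt_sqrt zero_le_one]; simpa using hc
  nlinarith

lemma mp_param_sqrt {c : ℝ} (hc : 1 < c) :
    √(((1 + c) / (2 * √c)) ^ 2 - 1) = (c - 1) / (2 * √c) := by
  have hq : 0 < √c := Real.sqrt_pos.mpr (by linarith)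
  have hqq : √c ^ 2 = c := Real.sq_sqrt (by linarith)
  rw [Real.sqrt_eq_iff_mul_self_eq (by have := mp_param hc; nlinarith)
    (div_nonneg (by linarith) (by positivity))]
  field_simp
  rw [hqq]
  ring

lemma mp_isProbability {c : ℝ} (hc : 1 < c) : IsProbabilityMeasure (MP c) := by
  have hq : 0 < √c := Real.sqrt_pos.mpr (by linarith)
  have h := mp_integral hc (fun _ => 1)
  simp only [one_mul] at h
  rw [integral_sqrt_div_add (mp_param hc), mp_param_sqrt hc, integral_const, smul_eq_mul,
    mul_one] at h
  have h1 : (MP c).real Set.univ = 1 := by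
    rw [h]
    have := Real.pi_pos
    field_simp
    ring
  refine ⟨?_⟩
  rw [measureReal_def] at h1
  exact (ENNReal.toReal_eq_one_iff _).mp h1

lemma mp_integral_mul {c : ℝ} (hc : 1 < c) (g : ℝ → ℝ) :
    ∫ x, x * g x ∂(MP c) = 2 * c / Real.pi * ∫ u in (-1 : ℝ)..1,
      g (2 * √c * u + (1 + c)) * √(1 - u ^ 2) := by
  have hq : 0 < √c := Real.sqrt_pos.mpr (by linarith)
  have hqq : √c * √c = c := Real.mul_self_sqrt (by linarith)
  rw [mp_integral hc]
  have : ∀ u ∈ Set.uIcc (-1 : ℝ) 1, (2 * √c * u + (1 + c)) * g (2 * √c * u + (1 + c)) *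
      (√(1 - u ^ 2) / ((1 + c) / (2 * √c) + u)) =
      2 * √c * (g (2 * √c * u + (1 + c)) * √(1 - u ^ 2)) := by
    intro u hu
    rw [Set.uIcc_of_le (by norm_num)] at hu
    have hzu : 0 < (1 + c) / (2 * √c) + u := by linarith [hu.1, mp_param hc]
    have e2 : 2 * √c * u + (1 + c) = 2 * √c * ((1 + c) / (2 * √c) + u) := by field_simp; ring
    generalize g (2 * √c * u + (1 + c)) = F
    rw [e2]
    generalize (1 + c) / (2 * √c) + u = y at hzu
    field_simp
  rw [intervalIntegral.integral_congr this, intervalIntegral.integral_const_mul, ← mul_assoc]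
  congr 1
  rw [div_mul_eq_mul_div]
  congr 1
  linear_combination 2 * hqq

lemma mp_mean {c : ℝ} (hc : 1 < c) : ∫ x, x ∂(MP c) = c := by
  have h := mp_integral_mul hc (fun _ => 1)
  simp only [one_mul, mul_one] at h
  rw [h, integral_sqrt_one_sub_sq]
  have := Real.pi_pos
  field_simp

lemma mp_second_moment {c : ℝ} (hc : 1 < c) : ∫ x, x ^ 2 ∂(MP c) = c + c ^ 2 := by
  have h := mp_integral_mul hc (fun x => x)
  simp only [← sq] at h
  have hodd : ∫ u in (-1 : ℝ)..1, u * √(1 - u ^ 2) = 0 := by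
    have h1 := intervalIntegral.integral_comp_neg (fun u : ℝ => u * √(1 - u ^ 2)) (a := -1) (b := 1)
    simp only [neg_neg, neg_mul, even_two.neg_pow, intervalIntegral.integral_neg] at h1
    linarith
  have : ∀ u : ℝ, (2 * √c * u + (1 + c)) * √(1 - u ^ 2) =
      2 * √c * (u * √(1 - u ^ 2)) + (1 + c) * √(1 - u ^ 2) := fun u => by ring
  simp_rw [this] at h
  rw [intervalIntegral.integral_add (Continuous.intervalIntegrable (by fun_prop) _ _)
    (Continuous.intervalIntegrable (by fun_prop) _ _), intervalIntegral.integral_const_mul,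
    intervalIntegral.integral_const_mul, hodd, integral_sqrt_one_sub_sq] at h
  rw [h]
  have := Real.pi_pos
  field_simp
  ring

/-- The Stieltjes transform of the Marčenko–Pastur law on the negative axis solves the
self-consistent equation. -/
lemma mp_stieltjes {c t : ℝ} (hc : 1 < c) (ht : 0 < t) :
    0 ≤ ∫ x, 1 / (x + t) ∂(MP c) ∧
    1 - t * ∫ x, 1 / (x + t) ∂(MP c) =
      c * ((∫ x, 1 / (x + t) ∂(MP c)) / (1 + ∫ x, 1 / (x + t) ∂(MP c))) := by
  have hq : 0 < √c := Real.sqrt_pos.mpr (by linarith)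
  have hqq : √c ^ 2 = c := Real.sq_sqrt (by linarith)
  have hpi := Real.pi_pos
  have hz := mp_param hc
  set z := (1 + c) / (2 * √c) with hzdef
  set z' := (1 + c + t) / (2 * √c) with hz'def
  have hzz' : z' - z = t / (2 * √c) := by rw [hzdef, hz'def]; ring
  have hz' : 1 < z' := by
    have : 0 < t / (2 * √c) := by positivity
    linarith
  have h : ∫ x, 1 / (x + t) ∂(MP c) =
      √c / Real.pi * ((1 / t) * (Real.pi * (z - √(z ^ 2 - 1)) - Real.pi * (z' - √(z' ^ 2 - 1)))) := by
    rw [mp_integral hc, ← integral_sqrt_div_add hz, ← integral_sqrt_div_add hz',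
      ← intervalIntegral.integral_sub]
    · congr 1
      rw [← intervalIntegral.integral_const_mul]
      refine intervalIntegral.integral_congr fun u hu => ?_
      rw [Set.uIcc_of_le (by norm_num)] at hu
      have hzu : 0 < z + u := by linarith [hu.1]
      have hzu' : 0 < z' + u := by linarith [hu.1]
      have e : 2 * √c * u + (1 + c) + t = 2 * √c * (z' + u) := by
        rw [hz'def]; field_simp; ring
      have e2 : t = 2 * √c * (z' - z) := by rw [hzz']; field_simp
      have e3 : 0 < z' - z := by rw [hzz']; positivity
      rw [e, ← hzdef, e2]
      field_simp
      ring
    · refine ContinuousOn.intervalIntegrable ?_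
      rw [Set.uIcc_of_le (by norm_num)]
      refine ContinuousOn.div (by fun_prop) (by fun_prop) fun u hu => ?_
      have : 0 < z + u := by linarith [hu.1]
      exact this.ne'
    · refine ContinuousOn.intervalIntegrable ?_
      rw [Set.uIcc_of_le (by norm_num)]
      refine ContinuousOn.div (by fun_prop) (by fun_prop) fun u hu => ?_
      have : 0 < z' + u := by linarith [hu.1]
      exact this.ne'
  rw [mp_param_sqrt hc] at h
  obtain ⟨T, hT⟩ : ∃ T, T = √(z' ^ 2 - 1) * (2 * √c) := ⟨_, rfl⟩
  have hTe : √(z' ^ 2 - 1) = T / (2 * √c) := by rw [hT]; field_simp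
  have hT0 : 0 ≤ T := by rw [hT]; positivity
  have hTT : T ^ 2 = (1 + c + t) ^ 2 - 4 * c := by
    rw [hT, mul_pow, Real.sq_sqrt (by nlinarith), hz'def, div_pow]
    field_simp
    rw [hqq]
    ring
  have hs : ∫ x, 1 / (x + t) ∂(MP c) = (1 - c - t + T) / (2 * t) := by
    rw [h, hTe, hzdef, hz'def]
    field_simp
    ring
  rw [hs]
  have hpos : 0 < 1 - c - t + T := by
    by_contra hcon
    nlinarith
  refine ⟨by positivity, ?_⟩
  have h1 : 0 < 1 + (1 - c - t + T) / (2 * t) := by positivity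
  field_simp
  nlinarith

lemma mp_compl_Icc {c : ℝ} (hc : 1 ≤ c) :
    MP c (Set.Icc ((1 - √c) ^ 2) ((1 + √c) ^ 2))ᶜ = 0 := by
  rw [MP_eq hc, withDensity_apply _ measurableSet_Icc.compl]
  refine setLIntegral_eq_zero measurableSet_Icc.compl fun x hx => ?_
  have : x ∉ Set.Ioo ((1 - √c) ^ 2) ((1 + √c) ^ 2) := fun h => hx ⟨h.1.le, h.2.le⟩
  simp [mpDens, this]

lemma msupport_MP_subset {c : ℝ} (hc : 1 ≤ c) :
    msupport (MP c) ⊆ Set.Icc ((1 - √c) ^ 2) ((1 + √c) ^ 2) := by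
  intro x hx
  by_contra h
  have := hx _ isClosed_Icc.isOpen_compl h
  rw [mp_compl_Icc hc] at this
  exact lt_irrefl _ this

lemma mp_Ioo_pos {c p q : ℝ} (hc : 1 ≤ c) (hp : (1 - √c) ^ 2 ≤ p) (hpq : p < q)
    (hq : q ≤ (1 + √c) ^ 2) : 0 < MP c (Set.Ioo p q) := by
  rw [MP_eq hc, withDensity_apply _ measurableSet_Ioo, pos_iff_ne_zero, Ne,
    setLIntegral_eq_zero_iff measurableSet_Ioo (measurable_mpDens c).ennreal_ofReal]
  intro h
  have h2 : volume (Set.Ioo p q) = 0 := by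
    refine measure_mono_null (fun x hx => ?_) h
    intro hcon
    have h3 := hcon hx
    have hx' : x ∈ Set.Ioo ((1 - √c) ^ 2) ((1 + √c) ^ 2) :=
      ⟨hp.trans_lt hx.1, hx.2.trans_le hq⟩
    have hx0 : 0 < x := (sq_nonneg _).trans_lt hx'.1
    have : 0 < mpDens c x := by
      rw [mpDens, Set.indicator_of_mem hx']
      have := mul_pos (sub_pos.mpr hx'.2) (sub_pos.mpr hx'.1)
      have := Real.pi_pos
      positivity
    exact absurd (ENNReal.ofReal_eq_zero.mp h3) (not_le.mpr this)
  rw [Real.volume_Ioo, ENNReal.ofReal_eq_zero] at h2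
  linarith

end MarcenkoPastur

section Quantile

/-- A finite family of nonnegative reals is close to the Marčenko–Pastur law, including at the
edges. -/
def SGood (c : ℝ) (k : ℕ) {N : ℕ} (l : Fin N → ℝ) : Prop :=
  (∀ i, 0 ≤ l i ∧ (1 - √c) ^ 2 - 1 / (k + 1) ≤ l i ∧ l i ≤ (1 + √c) ^ 2 + 1 / (k + 1)) ∧
    ∀ j ≤ k, |(∑ i, l i ^ j) / N - ∫ x, x ^ j ∂(MP c)| ≤ 1 / (k + 1)

lemma mp_ae_mem {c : ℝ} (hc : 1 ≤ c) :
    ∀ᵐ x ∂(MP c), x ∈ Set.Icc ((1 - √c) ^ 2) ((1 + √c) ^ 2) := mp_compl_Icc hc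

lemma mp_integrable {c : ℝ} (hc : 1 < c) {φ : ℝ → ℝ}
    (hφ : ContinuousOn φ (Set.Icc ((1 - √c) ^ 2) ((1 + √c) ^ 2))) : Integrable φ (MP c) := by
  have := mp_isProbability hc
  have h : (MP c).restrict (Set.Icc ((1 - √c) ^ 2) ((1 + √c) ^ 2)) = MP c :=
    Measure.restrict_eq_self_of_ae_mem (mp_ae_mem hc.le)
  rw [← h]
  exact hφ.integrableOn_compact isCompact_Icc

lemma avg_test {c η : ℝ} (hc : 1 < c) (hη : 0 < η) {φ : ℝ → ℝ} (hφ : Continuous φ) :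
    ∀ᶠ k : ℕ in atTop, ∀ (N : ℕ) (l : Fin N → ℝ), 0 < N → SGood c k l →
      |(∑ i, φ (l i)) / N - ∫ x, φ x ∂(MP c)| ≤ η := by
  have hprob := mp_isProbability hc
  set B := (1 + √c) ^ 2 + 1 with hB
  obtain ⟨P, hP⟩ := exists_polynomial_near_of_continuousOn 0 B φ hφ.continuousOn (η / 4)
    (by positivity)
  obtain ⟨M, hM⟩ : ∃ M : ℝ, M = ∑ j ∈ Finset.range (P.natDegree + 1), |P.coeff j| := ⟨_, rfl⟩
  have hM0 : 0 ≤ M := by rw [hM]; positivity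
  have hlim : ∀ᶠ k : ℕ in atTop, M * (1 / ((k : ℝ) + 1)) < η / 4 := by
    have := (tendsto_one_div_add_atTop_nhds_zero_nat (𝕜 := ℝ)).const_mul M
    rw [mul_zero] at this
    exact this.eventually_lt_const (by positivity)
  filter_upwards [hlim, eventually_ge_atTop P.natDegree] with k hk hkd N l hN hl
  have hN0 : (0 : ℝ) < N := by exact_mod_cast hN
  have h1 : |(∑ i, φ (l i)) / N - (∑ i, P.eval (l i)) / N| ≤ η / 4 := by
    rw [← sub_div, ← Finset.sum_sub_distrib, abs_div, abs_of_pos hN0, div_le_iff₀ hN0]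
    refine (Finset.abs_sum_le_sum_abs _ _).trans ?_
    refine (Finset.sum_le_card_nsmul _ _ (η / 4) fun i _ => ?_).trans ?_
    · rw [abs_sub_comm]
      refine (hP _ ⟨(hl.1 i).1, (hl.1 i).2.2.trans ?_⟩).le
      rw [hB]
      gcongr
      rw [div_le_one (by positivity)]
      linarith [(Nat.cast_nonneg k : (0 : ℝ) ≤ k)]
    · rw [Finset.card_univ, Fintype.card_fin, nsmul_eq_mul, mul_comm]
  have h2 : |(∑ i, P.eval (l i)) / N - ∫ x, P.eval x ∂(MP c)| ≤ η / 4 := by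
    have e1 : (∑ i, P.eval (l i)) / N =
        ∑ j ∈ Finset.range (P.natDegree + 1), P.coeff j * ((∑ i, l i ^ j) / N) := by
      simp_rw [Polynomial.eval_eq_sum_range]
      rw [Finset.sum_comm, Finset.sum_div]
      refine Finset.sum_congr rfl fun j _ => ?_
      rw [← Finset.mul_sum, mul_div_assoc]
    have e2 : ∫ x, P.eval x ∂(MP c) =
        ∑ j ∈ Finset.range (P.natDegree + 1), P.coeff j * ∫ x, x ^ j ∂(MP c) := by
      simp_rw [Polynomial.eval_eq_sum_range]
      rw [integral_finsetSum _ fun j _ => mp_integrable hc (by fun_prop)]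
      simp_rw [integral_const_mul]
    rw [e1, e2, ← Finset.sum_sub_distrib]
    refine (Finset.abs_sum_le_sum_abs _ _).trans (le_trans ?_ hk.le)
    rw [hM, Finset.sum_mul]
    refine Finset.sum_le_sum fun j hj => ?_
    rw [← mul_sub, abs_mul]
    have := hl.2 j (by have := Finset.mem_range.mp hj; omega)
    gcongr
  have h3 : |(∫ x, P.eval x ∂(MP c)) - ∫ x, φ x ∂(MP c)| ≤ η / 4 := by
    rw [← integral_sub (mp_integrable hc (by fun_prop)) (mp_integrable hc hφ.continuousOn)]
    have := norm_integral_le_of_norm_le_const (μ := MP c) (f := fun x => P.eval x - φ x)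
      (C := η / 4) ?_
    · simpa using this
    · filter_upwards [mp_ae_mem hc.le] with x hx
      exact (hP x ⟨(sq_nonneg _).trans hx.1, hx.2.trans (by rw [hB]; linarith)⟩).le
  have := abs_add_le ((∑ i, φ (l i)) / N - (∑ i, P.eval (l i)) / N +
    ((∑ i, P.eval (l i)) / N - ∫ x, P.eval x ∂(MP c))) ((∫ x, P.eval x ∂(MP c)) - ∫ x, φ x ∂(MP c))
  have h4 := abs_add_le ((∑ i, φ (l i)) / N - (∑ i, P.eval (l i)) / N)
    ((∑ i, P.eval (l i)) / N - ∫ x, P.eval x ∂(MP c))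
  rw [sub_add_sub_cancel, sub_add_sub_cancel] at this
  rw [sub_add_sub_cancel] at h4
  linarith

/-- The continuous function equal to `1` below `p`, to `0` above `p + δ`, affine in between. -/
def ramp (δ p x : ℝ) : ℝ := max 0 (min 1 ((p + δ - x) / δ))

lemma continuous_ramp (δ p : ℝ) : Continuous (ramp δ p) := by
  unfold ramp
  fun_prop

lemma ramp_nonneg (δ p x : ℝ) : 0 ≤ ramp δ p x := le_max_left _ _

lemma ramp_le_one (δ p x : ℝ) : ramp δ p x ≤ 1 := max_le zero_le_one (min_le_left _ _)

lemma ramp_of_le {δ p x : ℝ} (hδ : 0 < δ) (h : x ≤ p) : ramp δ p x = 1 := by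
  have : 1 ≤ (p + δ - x) / δ := by rw [le_div_iff₀ hδ]; linarith
  rw [ramp, min_eq_left this, max_eq_right zero_le_one]

lemma ramp_of_ge {δ p x : ℝ} (hδ : 0 < δ) (h : p + δ ≤ x) : ramp δ p x = 0 := by
  have : (p + δ - x) / δ ≤ 0 := div_nonpos_of_nonpos_of_nonneg (by linarith) hδ.le
  rw [ramp, max_eq_left ((min_le_right _ _).trans this)]

lemma ramp_mono {δ p q : ℝ} (hδ : 0 < δ) (h : p ≤ q) (x : ℝ) : ramp δ p x ≤ ramp δ q x := by
  unfold ramp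
  gcongr

lemma ramp_gap {c δ p : ℝ} (hc : 1 < c) (hδ : 0 < δ) (hp : (1 - √c) ^ 2 ≤ p)
    (hp' : p + 2 * δ ≤ (1 + √c) ^ 2) :
    ∫ x, ramp δ p x ∂(MP c) < ∫ x, ramp δ (p + 2 * δ) x ∂(MP c) := by
  have hprob := mp_isProbability hc
  rw [← sub_pos, ← integral_sub (mp_integrable hc (continuous_ramp _ _).continuousOn)
    (mp_integrable hc (continuous_ramp _ _).continuousOn)]
  have h0 : 0 < (MP c).real (Set.Ioo (p + δ) (p + 2 * δ)) := by
    rw [measureReal_def]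
    exact ENNReal.toReal_pos (mp_Ioo_pos hc.le (by linarith) (by linarith) hp').ne'
      (measure_ne_top _ _)
  refine h0.trans_le ?_
  rw [← integral_indicator_one measurableSet_Ioo]
  refine integral_mono ((integrable_const (1 : ℝ)).indicator measurableSet_Ioo)
    ((mp_integrable hc (continuous_ramp _ _).continuousOn).sub
    (mp_integrable hc (continuous_ramp _ _).continuousOn)) fun x => ?_
  by_cases hx : x ∈ Set.Ioo (p + δ) (p + 2 * δ)
  · simp [hx, ramp_of_le hδ hx.2.le, ramp_of_ge hδ hx.1.le]
  · simp only [Set.indicator_of_notMem hx, sub_nonneg]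
    exact ramp_mono hδ (by linarith) x

/-- Sorted families close to the Marčenko–Pastur law are uniformly close to each other. -/
lemma sorted_close {c ε : ℝ} (hc : 1 < c) (hε : 0 < ε) :
    ∀ᶠ k : ℕ in atTop, ∀ (N : ℕ) (l l' : Fin N → ℝ), Antitone l → Antitone l' →
      SGood c k l → SGood c k l' → ∀ i, l' i ≤ l i + ε := by
  set a := (1 - √c) ^ 2 with ha
  set b := (1 + √c) ^ 2 with hb
  obtain ⟨δ, hδε⟩ : ∃ δ, ε = 5 * δ := ⟨ε / 5, by ring⟩
  have hδ : 0 < δ := by linarith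
  set K := ⌈(b - a) / δ⌉₊ with hK
  obtain ⟨η, hη0, hη⟩ : ∃ η > 0, ∀ j ∈ Finset.range (K + 1), a + j * δ + 2 * δ ≤ b →
      ∫ x, ramp δ (a + j * δ) x ∂(MP c) + 2 * η < ∫ x, ramp δ (a + j * δ + 2 * δ) x ∂(MP c) := by
    have : ∀ᶠ η in 𝓝[>] (0 : ℝ), ∀ j ∈ Finset.range (K + 1), a + j * δ + 2 * δ ≤ b →
      ∫ x, ramp δ (a + j * δ) x ∂(MP c) + 2 * η < ∫ x, ramp δ (a + j * δ + 2 * δ) x ∂(MP c) := by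
      rw [Filter.eventually_all_finset]
      intro j _
      by_cases hj : a + j * δ + 2 * δ ≤ b
      · have hgap := ramp_gap hc hδ (p := a + j * δ) (by
          have : 0 ≤ (j : ℝ) * δ := by positivity
          linarith) hj
        have hlim : Tendsto (fun η : ℝ => ∫ x, ramp δ (a + j * δ) x ∂(MP c) + 2 * η) (𝓝[>] 0)
            (𝓝 (∫ x, ramp δ (a + j * δ) x ∂(MP c) + 2 * 0)) :=
          Tendsto.mono_left (Continuous.tendsto (by fun_prop) 0) nhdsWithin_le_nhds
        rw [mul_zero, add_zero] at hlim
        filter_upwards [hlim.eventually_lt_const hgap] with η h _ using h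
      · exact Eventually.of_forall fun η h => absurd h hj
    obtain ⟨η, h1, h2⟩ := (this.and self_mem_nhdsWithin).exists
    exact ⟨η, h2, h1⟩
  have hT1 : ∀ᶠ k : ℕ in atTop, ∀ j ∈ Finset.range (K + 1), ∀ (N : ℕ) (l : Fin N → ℝ), 0 < N →
      SGood c k l → |(∑ i, ramp δ (a + j * δ) (l i)) / N - ∫ x, ramp δ (a + j * δ) x ∂(MP c)| ≤ η := by
    rw [Filter.eventually_all_finset]
    exact fun j _ => avg_test hc hη0 (continuous_ramp _ _)
  have hT2 : ∀ᶠ k : ℕ in atTop, ∀ j ∈ Finset.range (K + 1), ∀ (N : ℕ) (l : Fin N → ℝ), 0 < N →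
      SGood c k l → |(∑ i, ramp δ (a + j * δ + 2 * δ) (l i)) / N -
        ∫ x, ramp δ (a + j * δ + 2 * δ) x ∂(MP c)| ≤ η := by
    rw [Filter.eventually_all_finset]
    exact fun j _ => avg_test hc hη0 (continuous_ramp _ _)
  have hlim : ∀ᶠ k : ℕ in atTop, 1 / ((k : ℝ) + 1) < δ :=
    (tendsto_one_div_add_atTop_nhds_zero_nat (𝕜 := ℝ)).eventually_lt_const hδ
  filter_upwards [hT1, hT2, hlim] with k hk1 hk2 hk3 N l l' hl hl' hg hg' i
  by_contra hcon
  push Not at hcon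
  have hN : 0 < N := Nat.pos_of_ne_zero fun h => by subst h; exact i.elim0
  have hN0 : (0 : ℝ) < N := by exact_mod_cast hN
  set y := l i with hy
  have hya : a - δ ≤ y := by linarith [(hg.1 i).2.1]
  have hyb : y + ε < b + δ := by linarith [(hg'.1 i).2.2]
  set j := ⌈(y - a) / δ⌉₊ with hj
  have hjle : y ≤ a + j * δ := by
    have := Nat.le_ceil ((y - a) / δ)
    rw [div_le_iff₀ hδ] at this
    linarith
  have hjlt : a + j * δ ≤ y + δ := by
    rcases le_or_gt y a with h | h
    · have : j = 0 := by
        rw [hj, Nat.ceil_eq_zero]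
        exact div_nonpos_of_nonpos_of_nonneg (by linarith) hδ.le
      rw [this]
      simp only [Nat.cast_zero, zero_mul]
      linarith
    · have := (Nat.ceil_lt_add_one (div_nonneg (sub_nonneg.mpr h.le) hδ.le)).le
      rw [← hj, ← sub_le_iff_le_add, le_div_iff₀ hδ] at this
      linarith
  have hjK : j ∈ Finset.range (K + 1) := by
    rw [Finset.mem_range, Nat.lt_succ_iff, hj, hK]
    refine Nat.ceil_mono ?_
    gcongr
    linarith
  have h1 := hk1 j hjK N l hN hg
  have h2 := hk2 j hjK N l' hN hg'
  have h3 := hη j hjK (by linarith)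
  set p := a + j * δ with hp
  have s1 : ((N - i : ℕ) : ℝ) ≤ ∑ x, ramp δ p (l x) := by
    calc ((N - i : ℕ) : ℝ) = ∑ x ∈ Finset.Ici i, (1 : ℝ) := by simp
      _ = ∑ x ∈ Finset.Ici i, ramp δ p (l x) := Finset.sum_congr rfl fun x hx => by
          rw [ramp_of_le hδ ((hl (Finset.mem_Ici.mp hx)).trans hjle)]
      _ ≤ _ := Finset.sum_le_sum_of_subset_of_nonneg (Finset.subset_univ _)
          fun _ _ _ => ramp_nonneg _ _ _
  have s2 : ∑ x, ramp δ (p + 2 * δ) (l' x) ≤ ((N - i : ℕ) : ℝ) := by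
    calc ∑ x, ramp δ (p + 2 * δ) (l' x) = ∑ x ∈ Finset.Ici i, ramp δ (p + 2 * δ) (l' x) := by
          refine (Finset.sum_subset (Finset.subset_univ _) fun x _ hx => ?_).symm
          have hxi : x ≤ i := by
            rw [Finset.mem_Ici] at hx
            exact (not_le.mp hx).le
          exact ramp_of_ge hδ (by linarith [hl' hxi])
      _ ≤ ∑ x ∈ Finset.Ici i, (1 : ℝ) := Finset.sum_le_sum fun x _ => ramp_le_one _ _ _
      _ = _ := by simp
  have s3 : (∑ x, ramp δ (p + 2 * δ) (l' x)) / N ≤ (∑ x, ramp δ p (l x)) / N :=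
    div_le_div_of_nonneg_right (s2.trans s1) hN0.le
  have := (abs_le.mp h1).2
  have := (abs_le.mp h2).1
  linarith

end Quantile

section GoodMatrices

open scoped Matrix.Norms.L2Operator MatrixOrder

/-- The matrix analogue of `SGood`. -/
def Good (c : ℝ) (k : ℕ) {J : Type*} [Fintype J] [DecidableEq J] (A : Matrix J J ℂ) : Prop :=
  A.PosSemidef ∧ (((1 - √c) ^ 2 - 1 / (k + 1) : ℝ) : ℂ) • 1 ≤ A ∧
    A ≤ (((1 + √c) ^ 2 + 1 / (k + 1) : ℝ) : ℂ) • 1 ∧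
    ∀ j ≤ k, |pw A j / Fintype.card J - ∫ x, x ^ j ∂(MP c)| ≤ 1 / (k + 1)

variable {J : Type*} [Fintype J] [DecidableEq J]

lemma conj_diagonal_sub {U : Matrix J J ℂ} (D D' : J → ℂ) :
    U * diagonal D * Uᴴ - U * diagonal D' * Uᴴ = U * diagonal (D - D') * Uᴴ := by
  rw [← Matrix.sub_mul, ← Matrix.mul_sub, diagonal_sub]
  rfl

lemma conj_smul_one {U : Matrix J J ℂ} (hU : U * Uᴴ = 1) (x : ℂ) :
    x • (1 : Matrix J J ℂ) = U * diagonal (fun _ => x) * Uᴴ := by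
  rw [← smul_one_eq_diagonal]
  simp [hU]

lemma diagonal_nonneg_of_conj {U : Matrix J J ℂ} (hU : Uᴴ * U = 1) {D : J → ℂ}
    (h : (U * diagonal D * Uᴴ).PosSemidef) (i : J) : 0 ≤ D i := by
  have h1 := h.conjTranspose_mul_mul_same U
  have h2 : Uᴴ * (U * diagonal D * Uᴴ) * U = diagonal D := by
    calc Uᴴ * (U * diagonal D * Uᴴ) * U = (Uᴴ * U) * diagonal D * (Uᴴ * U) := by
          simp only [Matrix.mul_assoc]
      _ = _ := by rw [hU]; simp
  rw [h2] at h1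
  exact posSemidef_diagonal_iff.mp h1 i

lemma le_eigenvalues {A : Matrix J J ℂ} (hA : A.IsHermitian) {x : ℝ}
    (h : (x : ℂ) • 1 ≤ A) (i : J) : x ≤ hA.eigenvalues i := by
  rw [Matrix.le_iff, isHermitian_eq_conj hA, conj_smul_one (eigenvectorUnitary_right hA),
    conj_diagonal_sub] at h
  have := diagonal_nonneg_of_conj (eigenvectorUnitary_left hA) h i
  rw [Pi.sub_apply, sub_nonneg] at this
  exact_mod_cast this

lemma eigenvalues_le {A : Matrix J J ℂ} (hA : A.IsHermitian) {x : ℝ}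
    (h : A ≤ (x : ℂ) • 1) (i : J) : hA.eigenvalues i ≤ x := by
  rw [Matrix.le_iff, isHermitian_eq_conj hA, conj_smul_one (eigenvectorUnitary_right hA),
    conj_diagonal_sub] at h
  have := diagonal_nonneg_of_conj (eigenvectorUnitary_left hA) h i
  rw [Pi.sub_apply, sub_nonneg] at this
  exact_mod_cast this

lemma Good.sGood {c : ℝ} {k : ℕ} {A : Matrix J J ℂ} (h : Good c k A) :
    SGood c k h.1.1.eigenvalues₀ := by
  obtain ⟨hA, h1, h2, h3⟩ := h
  set e : Fin (Fintype.card J) ≃ J := Fintype.equivOfCardEq (Fintype.card_fin _) with he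
  have hev : ∀ i, hA.1.eigenvalues₀ i = hA.1.eigenvalues (e i) := fun i => by
    rw [IsHermitian.eigenvalues, ← he, Equiv.symm_apply_apply]
  refine ⟨fun i => ?_, fun j hj => ?_⟩
  · rw [hev]
    exact ⟨hA.eigenvalues_nonneg _, le_eigenvalues hA.1 h1 _, eigenvalues_le hA.1 h2 _⟩
  · have := h3 j hj
    rw [pw_eq hA.1] at this
    simp_rw [hev]
    rwa [Equiv.sum_comp e (fun i => hA.1.eigenvalues i ^ j)]

/-- Two matrices with spectra close to the Marčenko–Pastur law are close up to unitary
conjugation. -/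
lemma good_close {c ε : ℝ} (hc : 1 < c) (hε : 0 < ε) :
    ∃ k₀ : ℕ, ∀ k ≥ k₀, ∀ (J : Type) [Fintype J] [DecidableEq J] (A B : Matrix J J ℂ),
      Good c k A → Good c k B →
      ∃ U ∈ unitary (Matrix J J ℂ), ‖U * A * star U - B‖ ≤ ε := by
  obtain ⟨k₀, hk₀⟩ := eventually_atTop.mp (sorted_close hc hε)
  refine ⟨k₀, fun k hk J _ _ A B hA hB => ?_⟩
  have hAh := hA.1.1
  have hBh := hB.1.1
  have h1 := hk₀ k hk _ _ _ hAh.eigenvalues₀_antitone hBh.eigenvalues₀_antitone hA.sGood hB.sGood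
  have h2 := hk₀ k hk _ _ _ hBh.eigenvalues₀_antitone hAh.eigenvalues₀_antitone hB.sGood hA.sGood
  set V := hAh.eigenvectorUnitary with hV
  set W := hBh.eigenvectorUnitary with hW
  refine ⟨(W : Matrix J J ℂ) * star (V : Matrix J J ℂ), (W * star V).2, ?_⟩
  have e : ((W : Matrix J J ℂ) * star (V : Matrix J J ℂ)) * A *
      star ((W : Matrix J J ℂ) * star (V : Matrix J J ℂ)) - B =
      W * diagonal ((fun i => (hAh.eigenvalues i : ℂ)) - (fun i => (hBh.eigenvalues i : ℂ))) *
        (W : Matrix J J ℂ)ᴴ := by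
    rw [← conj_diagonal_sub]
    congr 1
    · conv_lhs => rw [isHermitian_eq_conj hAh]
      have hl := eigenvectorUnitary_left hAh
      rw [← hV] at hl ⊢
      simp only [star_eq_conjTranspose, conjTranspose_mul, conjTranspose_conjTranspose]
      calc _ = (W : Matrix J J ℂ) * ((V : Matrix J J ℂ)ᴴ * V) *
            diagonal (fun i => (hAh.eigenvalues i : ℂ)) * ((V : Matrix J J ℂ)ᴴ * V) *
            (W : Matrix J J ℂ)ᴴ := by simp only [Matrix.mul_assoc]
        _ = _ := by rw [hl]; simp
    · exact isHermitian_eq_conj hBh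
  rw [e]
  refine (norm_conj_le (eigenvectorUnitary_left hBh) _).trans ?_
  rw [l2_opNorm_diagonal, pi_norm_le_iff_of_nonneg hε.le]
  intro i
  rw [Pi.sub_apply, ← Complex.ofReal_sub, Complex.norm_real, Real.norm_eq_abs, abs_le]
  have e1 := h1 ((Fintype.equivOfCardEq (Fintype.card_fin _)).symm i)
  have e2 := h2 ((Fintype.equivOfCardEq (Fintype.card_fin _)).symm i)
  constructor
  · change -ε ≤ hAh.eigenvalues₀ _ - hBh.eigenvalues₀ _
    linarith
  · change hAh.eigenvalues₀ _ - hBh.eigenvalues₀ _ ≤ ε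
    linarith

lemma trace_res_eq {A : Matrix J J ℂ} (hA : A.PosSemidef) {t : ℝ} (ht : 0 < t) :
    (res t A).trace.re = ∑ i, 1 / (hA.1.eigenvalues i + t) := by
  set U : Matrix J J ℂ := (hA.1.eigenvectorUnitary : Matrix J J ℂ) with hU
  have hl : Uᴴ * U = 1 := eigenvectorUnitary_left hA.1
  have hr : U * Uᴴ = 1 := eigenvectorUnitary_right hA.1
  have hpos : ∀ i, 0 < hA.1.eigenvalues i + t := fun i => by
    linarith [hA.eigenvalues_nonneg i]
  have hres : res t A = U * diagonal (fun i => ((1 / (hA.1.eigenvalues i + t) : ℝ) : ℂ)) * Uᴴ := by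
    refine Matrix.inv_eq_right_inv ?_
    have h1 : A + (t : ℂ) • 1 = U * diagonal (fun i => ((hA.1.eigenvalues i + t : ℝ) : ℂ)) * Uᴴ := by
      conv_lhs => rw [isHermitian_eq_conj hA.1, conj_smul_one hr (t : ℂ), ← hU]
      rw [← Matrix.add_mul, ← Matrix.mul_add, diagonal_add]
      simp
    rw [h1]
    calc _ = U * (diagonal (fun i => ((hA.1.eigenvalues i + t : ℝ) : ℂ)) * (Uᴴ * U) *
          diagonal (fun i => ((1 / (hA.1.eigenvalues i + t) : ℝ) : ℂ))) * Uᴴ := by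
          simp only [Matrix.mul_assoc]
      _ = U * 1 * Uᴴ := by
          rw [hl, Matrix.mul_one, diagonal_mul_diagonal]
          congr 2
          rw [← diagonal_one]
          congr 1
          ext i
          rw [← Complex.ofReal_mul, mul_one_div, div_self (hpos i).ne', Complex.ofReal_one]
      _ = 1 := by rw [Matrix.mul_one, hr]
  rw [hres, trace_conj_diagonal hl, ← Complex.ofReal_sum, Complex.ofReal_re]

end GoodMatrices

section ResolventTransfer

/-- Closeness of the empirical averages of `f` to its Marčenko–Pastur integral, for points in
`[0, B]`, is implied by closeness of finitely many resolvent averages. -/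
def Transfers (c B : ℝ) (f : ℝ → ℝ) : Prop :=
  Integrable f (MP c) ∧ ∀ η > 0, ∃ (S : Finset ℝ) (θ : ℝ), (∀ t ∈ S, 0 < t) ∧ 0 < θ ∧
    ∀ (J : Type) [Fintype J] [Nonempty J] (l : J → ℝ), (∀ i, l i ∈ Set.Icc 0 B) →
      (∀ t ∈ S, |(∑ i, 1 / (l i + t)) / Fintype.card J - ∫ x, 1 / (x + t) ∂(MP c)| ≤ θ) →
      |(∑ i, f (l i)) / Fintype.card J - ∫ x, f x ∂(MP c)| ≤ η

variable {c B : ℝ} {f g : ℝ → ℝ}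

lemma Transfers.add (hf : Transfers c B f) (hg : Transfers c B g) :
    Transfers c B (fun x => f x + g x) := by
  refine ⟨hf.1.add hg.1, fun η hη => ?_⟩
  obtain ⟨S, θ, hS, hθ, h⟩ := hf.2 (η / 2) (half_pos hη)
  obtain ⟨S', θ', hS', hθ', h'⟩ := hg.2 (η / 2) (half_pos hη)
  classical
  refine ⟨S ∪ S', min θ θ', fun t ht => ?_, lt_min hθ hθ', fun J _ _ l hl ht => ?_⟩
  · rcases Finset.mem_union.mp ht with ht | ht
    exacts [hS t ht, hS' t ht]
  · have h1 := h J l hl fun t hts =>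
      (ht t (Finset.mem_union_left _ hts)).trans (min_le_left _ _)
    have h2 := h' J l hl fun t hts =>
      (ht t (Finset.mem_union_right _ hts)).trans (min_le_right _ _)
    rw [integral_add hf.1 hg.1, Finset.sum_add_distrib, add_div]
    rw [abs_le] at *
    constructor <;> linarith

lemma Transfers.const_mul (hf : Transfers c B f) (r : ℝ) :
    Transfers c B (fun x => r * f x) := by
  refine ⟨hf.1.const_mul r, fun η hη => ?_⟩
  obtain ⟨S, θ, hS, hθ, h⟩ := hf.2 (η / (|r| + 1)) (by positivity)
  refine ⟨S, θ, hS, hθ, fun J _ _ l hl ht => ?_⟩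
  have h1 := h J l hl ht
  rw [integral_const_mul, ← Finset.mul_sum, mul_div_assoc, ← mul_sub, abs_mul]
  rw [le_div_iff₀ (by positivity)] at h1
  nlinarith [abs_nonneg ((∑ i, f (l i)) / Fintype.card J - ∫ x, f x ∂(MP c))]

lemma transfers_zero : Transfers c B (fun _ => 0) :=
  ⟨by simp, fun η hη => ⟨∅, 1, by simp, one_pos, fun J _ _ l _ _ => by simpa using hη.le⟩⟩

lemma Transfers.sum {ι : Type*} (s : Finset ι) {F : ι → ℝ → ℝ}
    (h : ∀ i ∈ s, Transfers c B (F i)) : Transfers c B (fun x => ∑ i ∈ s, F i x) := by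
  classical
  induction s using Finset.induction_on with
  | empty => simpa using transfers_zero
  | insert a s ha ih =>
    simp only [Finset.sum_insert ha]
    exact (h a (Finset.mem_insert_self _ _)).add
      (ih fun i hi => h i (Finset.mem_insert_of_mem hi))

lemma transfers_resolvent (hc : 1 < c) {t : ℝ} (ht : 0 < t) :
    Transfers c B (fun x => 1 / (x + t)) := by
  refine ⟨mp_integrable hc ?_, fun η hη => ⟨{t}, η, by simpa using ht, hη,
    fun J _ _ l _ h => h t (by simp)⟩⟩
  refine ContinuousOn.div (by fun_prop) (by fun_prop) fun x hx => ?_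
  have : 0 ≤ x := (sq_nonneg _).trans hx.1
  positivity

lemma transfers_of_approx (hc : 1 < c) (hB : (1 + √c) ^ 2 ≤ B) (hf : Integrable f (MP c))
    (h : ∀ ε > 0, ∃ g, Transfers c B g ∧ ∀ x ∈ Set.Icc 0 B, |f x - g x| ≤ ε) :
    Transfers c B f := by
  have := mp_isProbability hc
  refine ⟨hf, fun η hη => ?_⟩
  obtain ⟨g, hg, hfg⟩ := h (η / 3) (by positivity)
  obtain ⟨S, θ, hS, hθ, h⟩ := hg.2 (η / 3) (by positivity)
  refine ⟨S, θ, hS, hθ, fun J _ _ l hl ht => ?_⟩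
  have h1 := h J l hl ht
  have h2 : |∫ x, f x ∂(MP c) - ∫ x, g x ∂(MP c)| ≤ η / 3 := by
    rw [← integral_sub hf hg.1]
    have := norm_integral_le_of_norm_le_const (μ := MP c) (f := fun x => f x - g x) (C := η / 3) (by
      filter_upwards [mp_ae_mem hc.le] with x hx
      exact hfg x ⟨(sq_nonneg _).trans hx.1, hx.2.trans hB⟩)
    simpa using this
  have hN : (0 : ℝ) < Fintype.card J := by exact_mod_cast Fintype.card_pos
  have h3 : |(∑ i, f (l i)) / Fintype.card J - (∑ i, g (l i)) / Fintype.card J| ≤ η / 3 := by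
    rw [← sub_div, ← Finset.sum_sub_distrib, abs_div, abs_of_pos hN, div_le_iff₀ hN]
    refine (Finset.abs_sum_le_sum_abs _ _).trans ((Finset.sum_le_sum fun i _ =>
      hfg _ (hl i)).trans ?_)
    simp [mul_comm]
  rw [abs_le] at *
  constructor <;> linarith

lemma transfers_pow (hc : 1 < c) (hB : (1 + √c) ^ 2 ≤ B) (j : ℕ) :
    Transfers c B (fun x => x ^ j) := by
  induction j using Nat.strong_induction_on with
  | _ j ih =>
  refine transfers_of_approx hc hB (mp_integrable hc (by fun_prop)) fun ε hε => ?_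
  have hB0 : 0 ≤ B := (sq_nonneg _).trans hB
  set y := ε / (B ^ (j + 1) + 1) with hy
  have hy0 : 0 < y := by positivity
  have hyB : B ^ (j + 1) * y ≤ ε := by
    rw [hy, mul_div_assoc', div_le_iff₀ (by positivity)]
    nlinarith [pow_nonneg hB0 (j + 1)]
  refine ⟨fun x => ((-y) ^ j)⁻¹ * (y⁻¹ * (1 / (x + y⁻¹)) +
    ∑ i ∈ Finset.range j, (-(-y) ^ i) * x ^ i), ?_, fun x hx => ?_⟩
  · refine ((transfers_resolvent hc (inv_pos.mpr hy0)).const_mul _ |>.add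
      (Transfers.sum _ fun i hi => (ih i (Finset.mem_range.mp hi)).const_mul _)).const_mul _
  · have hx0 : 0 ≤ x := hx.1
    have h1 : (0 : ℝ) < 1 + x * y := by positivity
    have hg := geom_sum_eq (x := -y * x) (by nlinarith [mul_nonneg hy0.le hx0]) j
    have hsum : ∑ i ∈ Finset.range j, (-(-y) ^ i) * x ^ i =
        -∑ i ∈ Finset.range j, (-y * x) ^ i := by
      rw [← Finset.sum_neg_distrib]
      exact Finset.sum_congr rfl fun i _ => by rw [mul_pow]; ring
    have hyj : (-y) ^ j ≠ 0 := pow_ne_zero _ (by linarith)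
    have key : ((-y) ^ j)⁻¹ * (y⁻¹ * (1 / (x + y⁻¹)) +
        ∑ i ∈ Finset.range j, (-(-y) ^ i) * x ^ i) = x ^ j / (1 + x * y) := by
      have hd : -y * x - 1 ≠ 0 := by nlinarith [mul_nonneg hy0.le hx0]
      have e1 : y⁻¹ * (1 / (x + y⁻¹)) = 1 / (1 + x * y) := by
        have : x + y⁻¹ ≠ 0 := by positivity
        field_simp
        ring
      have e2 : -(((-y * x) ^ j - 1) / (-y * x - 1)) = ((-y * x) ^ j - 1) / (1 + x * y) := by
        rw [← div_neg]
        congr 1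
        ring
      rw [hsum, hg, e1, e2, ← add_div, add_sub_cancel, mul_pow]
      field_simp
    beta_reduce
    rw [key]
    have e3 : x ^ j - x ^ j / (1 + x * y) = x ^ (j + 1) * y / (1 + x * y) := by
      field_simp
      ring
    rw [e3, abs_of_nonneg (by positivity), div_le_iff₀ h1]
    have h4 : x ^ (j + 1) ≤ B ^ (j + 1) := pow_le_pow_left₀ hx0 hx.2 _
    nlinarith [mul_nonneg hx0 hy0.le, mul_le_mul_of_nonneg_right h4 hy0.le,
      mul_nonneg hε.le (mul_nonneg hx0 hy0.le)]

end ResolventTransfer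

section WishartGood

open scoped Matrix.Norms.L2Operator MatrixOrder

lemma transfers_pow_uniform {c B : ℝ} (hc : 1 < c) (hB : (1 + √c) ^ 2 ≤ B) {η : ℝ} (hη : 0 < η)
    (k : ℕ) : ∃ (S : Finset ℝ) (θ : ℝ), (∀ t ∈ S, 0 < t) ∧ 0 < θ ∧
    ∀ (J : Type) [Fintype J] [Nonempty J] (l : J → ℝ), (∀ i, l i ∈ Set.Icc 0 B) →
      (∀ t ∈ S, |(∑ i, 1 / (l i + t)) / Fintype.card J - ∫ x, 1 / (x + t) ∂(MP c)| ≤ θ) →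
      ∀ j < k, |(∑ i, l i ^ j) / Fintype.card J - ∫ x, x ^ j ∂(MP c)| ≤ η := by
  induction k with
  | zero => exact ⟨∅, 1, by simp, one_pos, by simp⟩
  | succ k ih =>
    obtain ⟨S, θ, hS, hθ, h⟩ := ih
    obtain ⟨S', θ', hS', hθ', h'⟩ := (transfers_pow hc hB k).2 η hη
    classical
    refine ⟨S ∪ S', min θ θ', fun t ht => ?_, lt_min hθ hθ', fun J _ _ l hl ht j hj => ?_⟩
    · rcases Finset.mem_union.mp ht with ht | ht
      exacts [hS t ht, hS' t ht]
    · rcases (Nat.lt_succ_iff_lt_or_eq).mp hj with hj | rfl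
      · exact h J l hl (fun t hts =>
          (ht t (Finset.mem_union_left _ hts)).trans (min_le_left _ _)) j hj
      · exact h' J l hl fun t hts =>
          (ht t (Finset.mem_union_right _ hts)).trans (min_le_right _ _)

lemma real_smul_mono {J : Type*} [Fintype J] {A B : Matrix J J ℂ} {r : ℝ} (hr : 0 ≤ r)
    (h : A ≤ B) : (r : ℂ) • A ≤ (r : ℂ) • B := by
  rw [Matrix.le_iff] at h ⊢
  rw [← smul_sub]
  exact smul_posSemidef h hr

/-- The rescaled Wishart matrix has, with probability close to one, spectrum close to the
Marčenko–Pastur law. -/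
lemma wishart_good {c ε : ℝ} (hc : 1 < c) (hε : 0 < ε) (k : ℕ) :
    ∀ᶠ N : ℕ in atTop, ∀ (J : Type) [Fintype J] [DecidableEq J] (m : ℕ),
      Fintype.card J = N → (m : ℝ) ≤ c * N → c * N ≤ m + 1 →
      (Measure.pi (fun _ : Fin m => gvec J)).real
        {w | ¬ Good c k (((1 / N : ℝ) : ℂ) • wish w)} ≤ ε := by
  have hk : (0 : ℝ) < 1 / (k + 1) := by positivity
  obtain ⟨S, θ, hS, hθ, hT⟩ := transfers_pow_uniform (B := (1 + √c) ^ 2 + 1) hc (by linarith) hk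
    (k + 1)
  obtain ⟨C₁, hC₁, hup⟩ := wishart_upper (ρ := c) (η := 1 / (k + 1)) (by linarith) hk
  obtain ⟨C₂, hC₂, hlow⟩ := wishart_lower (ρ := c) (η := 1 / (k + 1) / 2) hc (by positivity)
  have hbulk : ∀ᶠ N : ℕ in atTop, ∀ t ∈ S, ∀ (J : Type) [Fintype J] [DecidableEq J] [Nonempty J]
      (m : ℕ), Fintype.card J = N → (m : ℝ) ≤ c * N → c * N ≤ m + 1 →
      (Measure.pi (fun _ : Fin m => gvec J)).real
        {w | ¬ |stj t (((1 / N : ℝ) : ℂ) • wish w) - ∫ x, 1 / (x + t) ∂(MP c)| ≤ θ} ≤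
        ε / 3 / (S.card + 1) := by
    rw [Filter.eventually_all_finset]
    intro t ht
    obtain ⟨N₀, hN₀⟩ := wishart_bulk (c := c) (t := t) (by linarith) (hS t ht)
      (mp_stieltjes hc (hS t ht)).1 (mp_stieltjes hc (hS t ht)).2 hθ
      (show (0 : ℝ) < ε / 3 / (S.card + 1) by positivity)
    filter_upwards [eventually_ge_atTop N₀] with N hN J _ _ _ m hJ h1 h2
    subst hJ
    exact hN₀ J m hN h1 h2
  have hlim : ∀ C : ℝ, ∀ᶠ N : ℕ in atTop, C / (N : ℝ) ^ 2 ≤ ε / 3 := fun C =>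
    (((tendsto_pow_atTop two_ne_zero).comp tendsto_natCast_atTop_atTop).const_div_atTop
      C).eventually_le_const (by positivity)
  have hlim1 : ∀ᶠ N : ℕ in atTop, 1 / (N : ℝ) ≤ 1 / (k + 1) / 2 :=
    (tendsto_natCast_atTop_atTop.const_div_atTop 1).eventually_le_const (by positivity)
  filter_upwards [hbulk, hlim C₁, hlim C₂, hlim1, eventually_gt_atTop 0] with N hb h1 h2 h3 hN
    J _ _ m hJ hm hm'
  subst hJ
  have : Nonempty J := Fintype.card_pos_iff.mp hN
  have hN' : (0 : ℝ) < Fintype.card J := by exact_mod_cast hN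
  have hu := (hup J J 1 (by simp) m hm).trans h1
  have hl := (hlow J m hm hm').trans h2
  have hsub : {w : Fin m → J → ℂ | ¬ Good c k (((1 / Fintype.card J : ℝ) : ℂ) • wish w)} ⊆
      {w | ¬ (1 : Matrix J J ℂ) * wish w * (1 : Matrix J J ℂ)ᴴ ≤
        ((Fintype.card J * ((1 + √c) ^ 2 + 1 / (k + 1)) : ℝ) : ℂ) • 1} ∪
      {w | ¬ ((Fintype.card J * ((√c - 1) ^ 2 - 1 / (k + 1) / 2) - 1 : ℝ) : ℂ) • 1 ≤ wish w} ∪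
      ⋃ t ∈ S, {w | ¬ |stj t (((1 / Fintype.card J : ℝ) : ℂ) • wish w) -
        ∫ x, 1 / (x + t) ∂(MP c)| ≤ θ} := by
    intro w hw
    by_contra hcon
    simp only [Set.mem_union, Set.mem_ofPred_eq, Set.mem_iUnion, not_or, not_not, not_exists,
      conjTranspose_one, Matrix.one_mul, Matrix.mul_one] at hcon
    obtain ⟨⟨hA, hB⟩, hC⟩ := hcon
    apply hw
    have hinv : (0 : ℝ) ≤ 1 / Fintype.card J := by positivity
    have hpsd : (((1 / Fintype.card J : ℝ) : ℂ) • wish w).PosSemidef :=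
      smul_posSemidef (wish_posSemidef w) hinv
    have hA' := real_smul_mono hinv hA
    have hB' := real_smul_mono hinv hB
    rw [smul_smul, ← Complex.ofReal_mul] at hA' hB'
    have hA2 : ((1 / Fintype.card J : ℝ) : ℂ) • wish w ≤
        (((1 + √c) ^ 2 + 1 / (k + 1) : ℝ) : ℂ) • 1 := by
      refine hA'.trans (real_smul_one_mono (le_of_eq ?_))
      field_simp
    have hB2 : (((1 - √c) ^ 2 - 1 / (k + 1) : ℝ) : ℂ) • 1 ≤
        ((1 / Fintype.card J : ℝ) : ℂ) • wish w := by
      refine (real_smul_one_mono ?_).trans hB'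
      have : 1 / (Fintype.card J : ℝ) *
          (Fintype.card J * ((√c - 1) ^ 2 - 1 / (k + 1) / 2) - 1) =
          (√c - 1) ^ 2 - 1 / (k + 1) / 2 - 1 / Fintype.card J := by
        field_simp
      rw [this]
      nlinarith
    refine ⟨hpsd, hB2, hA2, fun j hj => ?_⟩
    rw [pw_eq hpsd.1]
    refine hT J hpsd.1.eigenvalues (fun i => ⟨hpsd.eigenvalues_nonneg i,
      (eigenvalues_le hpsd.1 hA2 i).trans ?_⟩) (fun t ht => ?_) j (by omega)
    · have : 1 / ((k : ℝ) + 1) ≤ 1 := by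
        rw [div_le_one (by positivity)]; linarith [(Nat.cast_nonneg k : (0 : ℝ) ≤ k)]
      linarith
    · have := hC t ht
      rwa [stj, trace_res_eq hpsd (hS t ht)] at this
  refine (measureReal_mono hsub (measure_ne_top _ _)).trans ?_
  refine (measureReal_union_le _ _).trans ?_
  have hS3 := (measureReal_biUnion_finset_le (μ := Measure.pi (fun _ : Fin m => gvec J)) S
    fun t => {w | ¬ |stj t (((1 / Fintype.card J : ℝ) : ℂ) • wish w) -
        ∫ x, 1 / (x + t) ∂(MP c)| ≤ θ}).trans
    (Finset.sum_le_sum fun t ht => hb t ht J m rfl hm hm')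
  have h12 := measureReal_union_le (μ := Measure.pi (fun _ : Fin m => gvec J))
    {w | ¬ (1 : Matrix J J ℂ) * wish w * (1 : Matrix J J ℂ)ᴴ ≤
        ((Fintype.card J * ((1 + √c) ^ 2 + 1 / (k + 1)) : ℝ) : ℂ) • 1}
    {w | ¬ ((Fintype.card J * ((√c - 1) ^ 2 - 1 / (k + 1) / 2) - 1 : ℝ) : ℂ) • 1 ≤ wish w}
  have h4 : ∑ t ∈ S, ε / 3 / ((S.card : ℝ) + 1) ≤ ε / 3 := by
    rw [Finset.sum_const, nsmul_eq_mul, mul_div_assoc', div_le_iff₀ (by positivity)]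
    nlinarith [(Nat.cast_nonneg S.card : (0 : ℝ) ≤ S.card)]
  linarith

end WishartGood

section EventuallyGood

open scoped Matrix.Norms.L2Operator MatrixOrder

lemma sSup_abs_image_le {c K : ℝ} (hc : 1 ≤ c) (f : ℝ → ℝ) (hK : 0 ≤ K)
    (h : ∀ x ∈ Set.Icc ((1 - √c) ^ 2) ((1 + √c) ^ 2), |f x| ≤ K) :
    sSup ((fun x => |f x|) '' msupport (MP c)) ≤ K := by
  refine Real.sSup_le ?_ hK
  rintro _ ⟨x, hx, rfl⟩
  exact h x (msupport_MP_subset hc hx)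

lemma eventually_good {n : ℕ} {c : ℝ} (hc : 1 < c)
    {X : (d : ℕ) → Matrix (Fin n × Fin d) (Fin n × Fin d) ℂ} (hX : ∀ d, (X d).PosSemidef)
    (h : ∀ P : Polynomial ℝ,
      Tendsto (fun d : ℕ => ((n : ℂ) * (d : ℂ))⁻¹ * (polyApply P (X d)).trace) atTop
        (𝓝 ((∫ x, P.eval x ∂(MP c) : ℝ) : ℂ)) ∧
      Tendsto (fun d : ℕ => opNorm (polyApply P (X d))) atTop
        (𝓝 (sSup ((fun x => |P.eval x|) '' msupport (MP c))))) (k : ℕ) :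
    ∀ᶠ d in atTop, Good c k (X d) := by
  have hk : (0 : ℝ) < 1 / (k + 1) := by positivity
  have hq : 0 < √c := Real.sqrt_pos.mpr (by linarith)
  set a := (1 - √c) ^ 2 with ha
  set b := (1 + √c) ^ 2 with hb
  have hab : a ≤ b := by nlinarith
  have hmom : ∀ᶠ d : ℕ in atTop, ∀ j ∈ Finset.range (k + 1),
      |pw (X d) j / Fintype.card (Fin n × Fin d) - ∫ x, x ^ j ∂(MP c)| ≤ 1 / (k + 1) := by
    rw [Filter.eventually_all_finset]
    intro j _
    have h1 := (Complex.continuous_re.tendsto _).comp (h (Polynomial.X ^ j)).1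
    have h2 : Tendsto (fun d => pw (X d) j / Fintype.card (Fin n × Fin d)) atTop
        (𝓝 (∫ x, x ^ j ∂(MP c))) := by
      simp only [Polynomial.eval_pow, Polynomial.eval_X, Complex.ofReal_re] at h1
      refine h1.congr fun d => ?_
      have e : polyApply (Polynomial.X ^ j) (X d) = X d ^ j := by simp [polyApply]
      have e2 : ((n : ℂ) * (d : ℂ))⁻¹ * ((pw (X d) j : ℝ) : ℂ) =
          ((pw (X d) j / Fintype.card (Fin n × Fin d) : ℝ) : ℂ) := by
        rw [Fintype.card_prod, Fintype.card_fin, Fintype.card_fin]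
        push_cast
        rw [div_eq_mul_inv, mul_comm]
      rw [Function.comp_apply, e, trace_pow_eq_pw (hX d).1, e2, Complex.ofReal_re]
    filter_upwards [Metric.tendsto_nhds.mp h2 _ hk] with d hd
    exact le_of_lt hd
  have hup : ∀ᶠ d : ℕ in atTop, ‖X d‖ ≤ b + 1 / (k + 1) := by
    have h1 := (h Polynomial.X).2
    have h2 : sSup ((fun x => |Polynomial.eval x Polynomial.X|) '' msupport (MP c)) ≤ b :=
      sSup_abs_image_le hc.le _ (sq_nonneg _) fun x hx => by
        rw [Polynomial.eval_X, abs_of_nonneg ((sq_nonneg _).trans hx.1)]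
        exact hx.2
    filter_upwards [h1.eventually_le_const (h2.trans_lt (lt_add_of_pos_right b hk))] with d hd
    have e : polyApply Polynomial.X (X d) = X d := by simp [polyApply]
    rwa [e] at hd
  have hlow : ∀ᶠ d : ℕ in atTop, ‖(b : ℂ) • 1 - X d‖ ≤ b - a + 1 / (k + 1) := by
    have h1 := (h (Polynomial.C b - Polynomial.X)).2
    have h2 : sSup ((fun x => |Polynomial.eval x (Polynomial.C b - Polynomial.X)|) ''
        msupport (MP c)) ≤ b - a :=
      sSup_abs_image_le hc.le _ (sub_nonneg.mpr hab) fun x hx => by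
        rw [Polynomial.eval_sub, Polynomial.eval_C, Polynomial.eval_X,
          abs_of_nonneg (sub_nonneg.mpr hx.2)]
        linarith [hx.1]
    filter_upwards [h1.eventually_le_const (h2.trans_lt (lt_add_of_pos_right (b - a) hk))]
      with d hd
    have e : polyApply (Polynomial.C b - Polynomial.X) (X d) = (b : ℂ) • 1 - X d := by
      simp [polyApply, Algebra.algebraMap_eq_smul_one]
    rwa [e] at hd
  filter_upwards [hmom, hup, hlow] with d h1 h2 h3
  refine ⟨hX d, ?_, isHermitian_le_norm (hX d).1 h2, fun j hj => h1 j (by simpa using by omega)⟩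
  have hH : ((b : ℂ) • (1 : Matrix (Fin n × Fin d) (Fin n × Fin d) ℂ) - X d).IsHermitian := by
    refine IsHermitian.sub ?_ (hX d).1
    rw [IsHermitian, conjTranspose_smul, conjTranspose_one, Complex.star_def, Complex.conj_ofReal]
  have h4 := isHermitian_le_norm hH h3
  rw [Matrix.le_iff] at h4 ⊢
  have e : X d - ((a - 1 / (k + 1) : ℝ) : ℂ) • (1 : Matrix (Fin n × Fin d) (Fin n × Fin d) ℂ) =
      ((b - a + 1 / (k + 1) : ℝ) : ℂ) • 1 - ((b : ℂ) • 1 - X d) := by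
    push_cast
    module
  rw [e]
  exact h4

end EventuallyGood

section HaarComparison

open scoped Matrix.Norms.L2Operator MatrixOrder

instance (m n : Type*) [Finite m] [Finite n] : BorelSpace (Matrix m n ℂ) :=
  inferInstanceAs (BorelSpace (m → n → ℂ))

instance (m n : Type*) [Finite m] [Finite n] : SecondCountableTopology (Matrix m n ℂ) :=
  inferInstanceAs (SecondCountableTopology (m → n → ℂ))

variable {J : Type*} [Fintype J] [DecidableEq J]

lemma isCompact_unitary : IsCompact (unitary (Matrix J J ℂ) : Set (Matrix J J ℂ)) := by
  have : ProperSpace (Matrix J J ℂ) := FiniteDimensional.proper ℂ _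
  refine Metric.isCompact_of_isClosed_isBounded ?_ ?_
  · have : (unitary (Matrix J J ℂ) : Set (Matrix J J ℂ)) =
        {U | star U * U = 1} ∩ {U | U * star U = 1} := by
      ext U
      simp [Unitary.mem_iff]
    rw [this]
    exact (isClosed_eq (by fun_prop) (by fun_prop)).inter (isClosed_eq (by fun_prop) (by fun_prop))
  · refine (Metric.isBounded_closedBall (x := (0 : Matrix J J ℂ)) (r := 1)).subset fun U hU => ?_
    rw [mem_closedBall_zero_iff]
    exact norm_le_one_of_conjTranspose_mul_self (Unitary.mem_iff.mp hU).1

lemma exists_haar_unitary (J : Type*) [Fintype J] [DecidableEq J] :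
    ∃ ν : Measure (Matrix J J ℂ), IsProbabilityMeasure ν ∧
      (∀ᵐ H ∂ν, H ∈ unitary (Matrix J J ℂ)) ∧
      ∀ V ∈ unitary (Matrix J J ℂ), ν.map (fun H => V * H) = ν := by
  have : CompactSpace (unitary (Matrix J J ℂ)) := isCompact_iff_compactSpace.mp isCompact_unitary
  let μ : Measure (unitary (Matrix J J ℂ)) := Measure.haarMeasure ⊤
  have hμ : IsProbabilityMeasure μ := ⟨by
    have := Measure.haarMeasure_self (K₀ := (⊤ : TopologicalSpace.PositiveCompacts
      (unitary (Matrix J J ℂ))))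
    simpa using this⟩
  have hm : Measurable (Subtype.val : unitary (Matrix J J ℂ) → Matrix J J ℂ) :=
    measurable_subtype_coe
  refine ⟨μ.map Subtype.val, Measure.isProbabilityMeasure_map hm.aemeasurable, ?_, fun V hV => ?_⟩
  · refine (ae_map_iff (p := fun H => H ∈ unitary (Matrix J J ℂ)) hm.aemeasurable
      isCompact_unitary.measurableSet).mpr ?_
    exact Eventually.of_forall fun x => x.2
  · have hmul : Measurable (fun H : Matrix J J ℂ => V * H) := by
      have : Continuous (fun H : Matrix J J ℂ => V * H) := by fun_prop
      exact this.measurable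
    rw [Measure.map_map hmul hm]
    have e : (fun H : Matrix J J ℂ => V * H) ∘ (Subtype.val : unitary (Matrix J J ℂ) → _) =
        Subtype.val ∘ (fun H => (⟨V, hV⟩ : unitary (Matrix J J ℂ)) * H) := rfl
    rw [e, ← Measure.map_map hm (measurable_const_mul _), map_mul_left_eq_self]

/-- Comparison of two unitarily invariant laws concentrated on nearly conjugate matrices. -/
lemma unitary_invariant_compare {P Q : Measure (Matrix J J ℂ)} [IsProbabilityMeasure P]
    [IsProbabilityMeasure Q]
    (hP : ∀ U ∈ unitary (Matrix J J ℂ), P.map (fun X => U * X * star U) = P)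
    (hQ : ∀ U ∈ unitary (Matrix J J ℂ), Q.map (fun X => U * X * star U) = Q)
    {G B B' : Set (Matrix J J ℂ)} (hG : MeasurableSet G) (hB : MeasurableSet B)
    (hB' : MeasurableSet B')
    (hGinv : ∀ U ∈ unitary (Matrix J J ℂ), ∀ X, U * X * star U ∈ G → X ∈ G)
    (hclose : ∀ X ∈ G, ∀ W ∈ G, ∃ V ∈ unitary (Matrix J J ℂ), ∀ U ∈ unitary (Matrix J J ℂ),
      U * (V * X * star V) * star U ∈ B → U * W * star U ∈ B') :
    P (B ∩ G) * Q G ≤ Q B' := by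
  obtain ⟨ν, hν, hνU, hνinv⟩ := exists_haar_unitary J
  have hc : Continuous fun p : Matrix J J ℂ × Matrix J J ℂ => star p.1 * p.2 * p.1 := by fun_prop
  have avg : ∀ (ρ : Measure (Matrix J J ℂ)) [IsProbabilityMeasure ρ],
      (∀ U ∈ unitary (Matrix J J ℂ), ρ.map (fun X => U * X * star U) = ρ) →
      ∀ S, MeasurableSet S → ρ S = ∫⁻ X, ν {H | star H * X * H ∈ S} ∂ρ := by
    intro ρ _ hρ S hS
    have hS' : MeasurableSet ((fun p : Matrix J J ℂ × Matrix J J ℂ => star p.1 * p.2 * p.1) ⁻¹' S) :=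
      hc.measurable hS
    have h1 := Measure.prod_apply (μ := ν) (ν := ρ) hS'
    have h2 := Measure.prod_apply_symm (μ := ν) (ν := ρ) hS'
    rw [h1] at h2
    have h3 : ∫⁻ H, ρ (Prod.mk H ⁻¹' ((fun p : Matrix J J ℂ × Matrix J J ℂ =>
        star p.1 * p.2 * p.1) ⁻¹' S)) ∂ν = ∫⁻ _, ρ S ∂ν := by
      refine lintegral_congr_ae ?_
      filter_upwards [hνU] with H hH
      have hcH : Continuous fun X : Matrix J J ℂ => star H * X * star (star H) := by fun_prop
      conv_rhs => rw [← hρ (star H) (Unitary.star_mem hH), Measure.map_apply hcH.measurable hS]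
      simp only [star_star]
      rfl
    rw [h3, lintegral_const, measure_univ, mul_one] at h2
    exact h2
  have key : ∀ X, ν {H | star H * X * H ∈ B ∩ G} * Q G ≤ Q B' := by
    intro X
    by_cases hX : X ∈ G
    · rw [← setLIntegral_const, avg Q hQ B' hB']
      refine (setLIntegral_mono' hG fun W hW => ?_).trans (setLIntegral_le_lintegral G _)
      obtain ⟨V, hV, h⟩ := hclose X hX W hW
      have hcV : Continuous fun H : Matrix J J ℂ => star V * H := by fun_prop
      have hcX : Continuous fun H : Matrix J J ℂ => star H * X * H := by fun_prop
      have hms : MeasurableSet {H : Matrix J J ℂ | star H * X * H ∈ B} := hcX.measurable hB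
      calc ν {H | star H * X * H ∈ B ∩ G} ≤ ν {H | star H * X * H ∈ B} :=
            measure_mono fun H hH => hH.1
        _ = ν ((fun H => star V * H) ⁻¹' {H | star H * X * H ∈ B}) := by
            conv_lhs => rw [← hνinv (star V) (Unitary.star_mem hV),
              Measure.map_apply hcV.measurable hms]
        _ ≤ _ := by
            refine measure_mono_ae ?_
            filter_upwards [hνU] with H hH hHX
            have := h (star H) (Unitary.star_mem hH)
            simp only [star_star] at this
            refine this ?_
            change star (star V * H) * X * (star V * H) ∈ B at hHX
            rw [star_mul, star_star] at hHX
            simpa only [Matrix.mul_assoc] using hHX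
    · have : ν {H | star H * X * H ∈ B ∩ G} = 0 := by
        rw [measure_eq_zero_iff_ae_notMem]
        filter_upwards [hνU] with H hH hmem
        refine hX (hGinv (star H) (Unitary.star_mem hH) X ?_)
        rw [star_star]
        exact hmem.2
      rw [this, zero_mul]
      exact zero_le
  rw [avg P hP _ (hB.inter hG), ← lintegral_mul_const'' _ ?_]
  · calc _ ≤ ∫⁻ _, Q B' ∂P := lintegral_mono fun X => key X
      _ = _ := by simp
  · have := measurable_measure_prodMk_right (μ := ν) (hc.measurable (hB.inter hG))
    exact this.aemeasurable

end HaarComparison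

section WishartComparison

open scoped Matrix.Norms.L2Operator MatrixOrder

variable {J : Type*} [Fintype J] [DecidableEq J]

lemma isClosed_good (c : ℝ) (k : ℕ) : IsClosed {A : Matrix J J ℂ | Good c k A} := by
  have hle : ∀ f g : Matrix J J ℂ → Matrix J J ℂ, Continuous f → Continuous g →
      IsClosed {A | f A ≤ g A} := fun f g hf hg => by
    simp only [Matrix.le_iff]
    exact isClosed_posSemidef.preimage (hg.sub hf)
  refine isClosed_posSemidef.inter ((hle _ _ continuous_const continuous_id).inter
    ((hle _ _ continuous_id continuous_const).inter ?_))
  have : {A : Matrix J J ℂ | ∀ j ≤ k, |pw A j / Fintype.card J - ∫ x, x ^ j ∂(MP c)| ≤ 1 / (k + 1)} =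
      ⋂ j, ⋂ (_ : j ≤ k),
        {A : Matrix J J ℂ | |pw A j / Fintype.card J - ∫ x, x ^ j ∂(MP c)| ≤ 1 / (k + 1)} := by
    ext A
    simp
  change IsClosed {A : Matrix J J ℂ |
    ∀ j ≤ k, |pw A j / Fintype.card J - ∫ x, x ^ j ∂(MP c)| ≤ 1 / (k + 1)}
  rw [this]
  refine isClosed_iInter fun j => isClosed_iInter fun _ => isClosed_le ?_ continuous_const
  have : Continuous fun A : Matrix J J ℂ => pw A j :=
    Complex.continuous_re.comp (Continuous.matrix_trace (continuous_pow j))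
  fun_prop

lemma unitary_conj_pow {U : Matrix J J ℂ} (hU : Uᴴ * U = 1) (hU' : U * Uᴴ = 1) (A : Matrix J J ℂ) (j : ℕ) :
    (U * A * Uᴴ) ^ j = U * A ^ j * Uᴴ := by
  induction j with
  | zero => simp [hU']
  | succ j ih =>
    rw [pow_succ, ih, pow_succ]
    calc U * A ^ j * Uᴴ * (U * A * Uᴴ) = U * A ^ j * (Uᴴ * U) * A * Uᴴ := by
          simp only [Matrix.mul_assoc]
      _ = _ := by rw [hU]; simp only [Matrix.mul_one, Matrix.mul_assoc]

lemma Good.conj {c : ℝ} {k : ℕ} {A : Matrix J J ℂ} (h : Good c k A) {U : Matrix J J ℂ}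
    (hU : U ∈ unitary (Matrix J J ℂ)) : Good c k (U * A * star U) := by
  obtain ⟨h1, h2⟩ := Unitary.mem_iff.mp hU
  rw [star_eq_conjTranspose] at h1 h2 ⊢
  obtain ⟨hA, hl, hu, hm⟩ := h
  have hone : ∀ x : ℂ, U * (x • (1 : Matrix J J ℂ)) * Uᴴ = x • 1 := fun x => by simp [h2]
  refine ⟨hA.mul_mul_conjTranspose_same U, ?_, ?_, fun j hj => ?_⟩
  · have := conj_mono hl U
    rwa [hone] at this
  · have := conj_mono hu U
    rwa [hone] at this
  · have : pw (U * A * Uᴴ) j = pw A j := by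
      rw [pw, unitary_conj_pow h1 h2, Matrix.trace_mul_cycle, h1, Matrix.one_mul, pw]
    rw [this]
    exact hm j hj

lemma good_of_conj {c : ℝ} {k : ℕ} {A U : Matrix J J ℂ} (hU : U ∈ unitary (Matrix J J ℂ))
    (h : Good c k (U * A * star U)) : Good c k A := by
  have h1 := h.conj (Unitary.star_mem hU)
  obtain ⟨h2, h3⟩ := Unitary.mem_iff.mp hU
  have : star U * (U * A * star U) * star (star U) = A := by
    rw [star_star]
    calc star U * (U * A * star U) * U = (star U * U) * A * (star U * U) := by
          simp only [Matrix.mul_assoc]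
      _ = A := by rw [h2]; simp
  rwa [this] at h1

lemma continuous_smul_wish {J : Type*} (r : ℝ) (m : ℕ) :
    Continuous fun w : Fin m → J → ℂ => (r : ℂ) • wish w :=
  (continuous_const_smul (r : ℂ)).comp continuous_wish

lemma wish_unitInv (r : ℝ) (m : ℕ) {U : Matrix J J ℂ} (hU : U ∈ unitary (Matrix J J ℂ)) :
    ((Measure.pi (fun _ : Fin m => gvec J)).map (fun w => (r : ℂ) • wish w)).map
      (fun X => U * X * star U) =
    (Measure.pi (fun _ : Fin m => gvec J)).map (fun w => (r : ℂ) • wish w) := by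
  have hcU : Continuous fun X : Matrix J J ℂ => U * X * star U := by fun_prop
  have hmp : MeasurePreserving (fun w : Fin m → J → ℂ => fun k => U *ᵥ w k)
      (Measure.pi (fun _ : Fin m => gvec J)) (Measure.pi (fun _ : Fin m => gvec J)) :=
    measurePreserving_pi _ _ fun _ => ⟨measurable_mulVec U, gvec_map U (Unitary.mem_iff.mp hU).2⟩
  have hm := (continuous_smul_wish (J := J) r m).measurable
  rw [Measure.map_map hcU.measurable hm]
  conv_rhs => rw [← hmp.map_eq, Measure.map_map hm hmp.measurable]
  congr 1
  ext1 w
  simp only [Function.comp_apply]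
  rw [mul_wish_mul, star_eq_conjTranspose, Matrix.mul_smul, Matrix.smul_mul]

/-- Probabilities of events for a unitarily invariant matrix with spectrum close to the
Marčenko–Pastur law are controlled by those for the Wishart model. -/
lemma wishart_compare {c ε : ℝ} (hc : 1 < c) (hε : 0 < ε) : ∃ k : ℕ, ∀ᶠ N : ℕ in atTop,
    ∀ (J : Type) [Fintype J] [DecidableEq J] (m : ℕ), Fintype.card J = N →
      (m : ℝ) ≤ c * N → c * N ≤ m + 1 →
      ∀ (P : Measure (Matrix J J ℂ)) [IsProbabilityMeasure P],
      (∀ U ∈ unitary (Matrix J J ℂ), P.map (fun X => U * X * star U) = P) →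
      ∀ B B' : Set (Matrix J J ℂ), MeasurableSet B → MeasurableSet B' →
      (∀ X W, ‖X - W‖ ≤ ε → X ∈ B → W ∈ B') →
      P.real (B ∩ {A | Good c k A}) ≤
        2 * (Measure.pi (fun _ : Fin m => gvec J)).real {w | ((1 / N : ℝ) : ℂ) • wish w ∈ B'} := by
  obtain ⟨k, hk⟩ := good_close hc hε
  refine ⟨k, ?_⟩
  filter_upwards [wishart_good hc (show (0 : ℝ) < 1 / 2 by norm_num) k]
    with N hN J _ _ m hJ hm hm' P _ hP B B' hB hB' hBB'
  have hG : MeasurableSet {A : Matrix J J ℂ | Good c k A} := (isClosed_good c k).measurableSet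
  have hmeas := (continuous_smul_wish (J := J) (1 / N) m).measurable
  set μ := Measure.pi (fun _ : Fin m => gvec J) with hμ
  have hQprob : IsProbabilityMeasure (μ.map (fun w => ((1 / N : ℝ) : ℂ) • wish w)) :=
    Measure.isProbabilityMeasure_map hmeas.aemeasurable
  have key := unitary_invariant_compare (P := P)
    (Q := μ.map (fun w => ((1 / N : ℝ) : ℂ) • wish w)) hP
    (fun U hU => wish_unitInv _ m hU) hG hB hB' (fun U hU X hX => good_of_conj hU hX)
    (fun X hX W hW => by
      obtain ⟨V, hV, h⟩ := hk k le_rfl J X W hX hW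
      refine ⟨V, hV, fun U hU hB => hBB' _ _ ?_ hB⟩
      rw [← Matrix.sub_mul, ← Matrix.mul_sub]
      exact (norm_conj_le (Unitary.mem_iff.mp hU).1 _).trans h)
  rw [Measure.map_apply hmeas hG, Measure.map_apply hmeas hB'] at key
  have key' : P.real (B ∩ {A | Good c k A}) *
      μ.real {w | Good c k (((1 / N : ℝ) : ℂ) • wish w)} ≤
      μ.real {w | ((1 / N : ℝ) : ℂ) • wish w ∈ B'} := by
    rw [measureReal_def, measureReal_def, measureReal_def, ← ENNReal.toReal_mul]
    exact ENNReal.toReal_mono (measure_ne_top _ _) key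
  have h1 := hN J m hJ hm hm'
  have h2 : μ.real {w | Good c k (((1 / N : ℝ) : ℂ) • wish w)} +
      μ.real {w | ¬ Good c k (((1 / N : ℝ) : ℂ) • wish w)} = 1 := by
    have := probReal_add_probReal_compl (μ := μ) (hmeas hG)
    exact this
  have h3 : 0 ≤ P.real (B ∩ {A | Good c k A}) := measureReal_nonneg
  nlinarith

end WishartComparison

section PartialTranspose

open scoped Matrix.Norms.L2Operator MatrixOrder

variable {n d : ℕ}

/-- The matrix unit `E_{ij} ⊗ 1`. -/
def blockUnit (d : ℕ) (i j : Fin n) : Matrix (Fin n × Fin d) (Fin n × Fin d) ℂ :=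
  fun p q => if p.1 = i ∧ q.1 = j ∧ p.2 = q.2 then 1 else 0

lemma blockUnit_mul (i j : Fin n) (Y : Matrix (Fin n × Fin d) (Fin n × Fin d) ℂ)
    (p q : Fin n × Fin d) :
    (blockUnit d i j * Y) p q = if p.1 = i then Y (j, p.2) q else 0 := by
  rw [Matrix.mul_apply, Fintype.sum_prod_type]
  by_cases h : p.1 = i
  · simp [blockUnit, h, ite_and]
  · simp [blockUnit, h]

lemma mul_blockUnit (i j : Fin n) (Y : Matrix (Fin n × Fin d) (Fin n × Fin d) ℂ)
    (p q : Fin n × Fin d) :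
    (Y * blockUnit d i j) p q = if q.1 = j then Y p (i, q.2) else 0 := by
  rw [Matrix.mul_apply, Fintype.sum_prod_type]
  by_cases h : q.1 = j
  · simp [blockUnit, h, ite_and]
  · simp [blockUnit, h]

lemma ptrans_eq_sum (Y : Matrix (Fin n × Fin d) (Fin n × Fin d) ℂ) :
    ptrans Y = ∑ i, ∑ j, blockUnit d i j * Y * blockUnit d i j := by
  ext p q
  simp only [Matrix.sum_apply, mul_blockUnit, blockUnit_mul]
  simp [ptrans]

lemma norm_blockUnit_le (i j : Fin n) : ‖blockUnit d i j‖ ≤ 1 := by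
  have h : (blockUnit d i j)ᴴ * blockUnit d i j =
      diagonal (fun p : Fin n × Fin d => if p.1 = j then (1 : ℂ) else 0) := by
    ext p q
    rw [mul_blockUnit, conjTranspose_apply, blockUnit, diagonal_apply]
    by_cases hq : q.1 = j
    · by_cases hpq : p = q
      · subst hpq
        simp [hq]
      · have : ¬ (p.1 = j ∧ q.2 = p.2) := fun h => hpq (Prod.ext (h.1.trans hq.symm) h.2.symm)
        simp [hq, hpq, this]
    · by_cases hpq : p = q
      · subst hpq
        simp [hq]
      · simp [hq, hpq]
  have h2 := l2_opNorm_conjTranspose_mul_self (blockUnit d i j)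
  rw [h, l2_opNorm_diagonal] at h2
  have h3 : ‖(fun p : Fin n × Fin d => if p.1 = j then (1 : ℂ) else 0)‖ ≤ 1 := by
    rw [pi_norm_le_iff_of_nonneg zero_le_one]
    intro p
    split_ifs <;> simp
  nlinarith [norm_nonneg (blockUnit d i j)]

lemma norm_ptrans_le (Y : Matrix (Fin n × Fin d) (Fin n × Fin d) ℂ) :
    ‖ptrans Y‖ ≤ (n : ℝ) ^ 2 * ‖Y‖ := by
  rw [ptrans_eq_sum]
  have : ∀ i j : Fin n, ‖blockUnit d i j * Y * blockUnit d i j‖ ≤ ‖Y‖ := fun i j => by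
    have h := norm_blockUnit_le (d := d) i j
    calc _ ≤ ‖blockUnit d i j‖ * ‖Y‖ * ‖blockUnit d i j‖ :=
          (norm_mul_le _ _).trans (mul_le_mul_of_nonneg_right (norm_mul_le _ _) (norm_nonneg _))
      _ ≤ 1 * ‖Y‖ * 1 := by gcongr
      _ = _ := by ring
  calc _ ≤ ∑ _i : Fin n, ∑ _j : Fin n, ‖Y‖ :=
        norm_sum_le_of_le _ fun i _ => norm_sum_le_of_le _ fun j _ => this i j
    _ = _ := by simp; ring

lemma continuous_ptrans : Continuous (ptrans (n := n) (d := d)) :=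
  continuous_matrix fun p q => continuous_apply_apply (q.1, p.2) (p.1, q.2)

lemma ptrans_posSemidef_of_close {X W : Matrix (Fin n × Fin d) (Fin n × Fin d) ℂ} {κ ε : ℝ}
    (hX : X.IsHermitian) (hW : (κ : ℂ) • 1 ≤ ptrans W) (hXW : ‖X - W‖ ≤ ε)
    (hε : (n : ℝ) ^ 2 * ε ≤ κ) : (ptrans X).PosSemidef := by
  have hXh : (ptrans X).IsHermitian := by
    ext p q
    exact hX.apply _ _
  have hWh : (ptrans W).IsHermitian := by
    have h1 : (ptrans W - (κ : ℂ) • 1).IsHermitian := (Matrix.le_iff.mp hW).1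
    have h2 : ((κ : ℂ) • (1 : Matrix (Fin n × Fin d) (Fin n × Fin d) ℂ)).IsHermitian := by
      rw [IsHermitian, conjTranspose_smul, conjTranspose_one, Complex.star_def,
        Complex.conj_ofReal]
    simpa using h1.add h2
  have h1 : ‖ptrans W - ptrans X‖ ≤ κ := by
    have e : ptrans W - ptrans X = ptrans (W - X) := rfl
    rw [e]
    refine (norm_ptrans_le _).trans (le_trans ?_ hε)
    rw [norm_sub_rev]
    gcongr
  have h2 := Matrix.le_iff.mp (hW.trans' (isHermitian_le_norm (hWh.sub hXh) h1))
  simpa using h2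

end PartialTranspose

section Separability

open scoped Matrix.Norms.L2Operator MatrixOrder

variable {n d : ℕ}

/-- The contraction `u* ⊗ 1`. -/
def sliceMap (d : ℕ) (u : Fin n → ℂ) : Matrix (Fin d) (Fin n × Fin d) ℂ :=
  fun s p => if s = p.2 then star (u p.1) else 0

lemma sliceMap_mul_conjTranspose (u : Fin n → ℂ) :
    sliceMap d u * (sliceMap d u)ᴴ = ((∑ i, ‖u i‖ ^ 2 : ℝ) : ℂ) • 1 := by
  ext s t
  rw [Matrix.mul_apply, Fintype.sum_prod_type, Matrix.smul_apply, Matrix.one_apply]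
  by_cases h : s = t
  · subst h
    simp [sliceMap, conjTranspose_apply, Complex.conj_mul']
  · simp [sliceMap, conjTranspose_apply, Ne.symm h, h]

lemma sliceMap_conj (u : Fin n → ℂ) (B : Matrix (Fin d) (Fin d) ℂ) :
    (sliceMap d u)ᴴ * B * sliceMap d u = vecMulVec u (star u) ⊗ₖ B := by
  ext ⟨i, s⟩ ⟨j, t⟩
  simp [Matrix.mul_apply, sliceMap, conjTranspose_apply, vecMulVec_apply, kroneckerMap_apply,
    apply_ite (starRingEnd ℂ)]
  ring

lemma norm_sliceMap_sq_le (u : Fin n → ℂ) : ‖sliceMap d u‖ ^ 2 ≤ ∑ i, ‖u i‖ ^ 2 := by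
  have h := l2_opNorm_conjTranspose_mul_self (sliceMap d u)ᴴ
  rw [conjTranspose_conjTranspose, sliceMap_mul_conjTranspose, l2_opNorm_conjTranspose,
    ← sq] at h
  rw [← h]
  have h1 : (0 : ℝ) ≤ ∑ i, ‖u i‖ ^ 2 := by positivity
  refine norm_le_of_le ?_ h1 le_rfl
  exact (smul_posSemidef PosSemidef.one h1).nonneg

lemma sep_trace_sq_le {X : Matrix (Fin n × Fin d) (Fin n × Fin d) ℂ} {h : ℝ} (hX : X ∈ SEP n d)
    (hh : ∀ u : Fin n → ℂ, ‖sliceMap d u * X * (sliceMap d u)ᴴ‖ ≤ h * ∑ i, ‖u i‖ ^ 2) :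
    pw X 2 ≤ h * pw X 1 := by
  obtain ⟨k, A, B, hA, hB, hXe⟩ := hX
  have key : ∀ i, (X * (A i ⊗ₖ B i)).trace.re ≤ h * (A i ⊗ₖ B i).trace.re := by
    intro i
    obtain ⟨Q, hQ⟩ := CStarAlgebra.nonneg_iff_eq_star_mul_self.mp (hA i).nonneg
    have hdec : A i ⊗ₖ B i = ∑ r, vecMulVec (star (Q r)) (star (star (Q r))) ⊗ₖ B i := by
      ext p q
      rw [hQ, Matrix.sum_apply]
      simp only [kroneckerMap_apply, vecMulVec_apply, Matrix.mul_apply, star_eq_conjTranspose,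
        conjTranspose_apply, star_star, Pi.star_apply, Finset.sum_mul]
    rw [hdec, Matrix.mul_sum, trace_sum, trace_sum, Complex.re_sum, Complex.re_sum,
      Finset.mul_sum]
    refine Finset.sum_le_sum fun r _ => ?_
    set u : Fin n → ℂ := star (Q r) with hu
    have e1 : (X * (vecMulVec u (star u) ⊗ₖ B i)).trace =
        ((sliceMap d u * X * (sliceMap d u)ᴴ) * B i).trace := by
      rw [← sliceMap_conj, ← Matrix.mul_assoc, Matrix.trace_mul_comm]
      simp only [Matrix.mul_assoc]
    have e2 : (vecMulVec u (star u) ⊗ₖ B i).trace = ((∑ i, ‖u i‖ ^ 2 : ℝ) : ℂ) * (B i).trace := by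
      rw [← sliceMap_conj, Matrix.trace_mul_cycle, sliceMap_mul_conjTranspose, Matrix.smul_mul,
        Matrix.one_mul, trace_smul, smul_eq_mul]
    rw [e1, e2, Complex.re_ofReal_mul, ← mul_assoc]
    refine (Complex.re_le_norm _).trans ((norm_trace_mul_le _ (hB i)).trans ?_)
    exact mul_le_mul_of_nonneg_right (hh u) (posSemidef_trace_re_nonneg (hB i))
  have e1 : pw X 1 = ∑ i, (A i ⊗ₖ B i).trace.re := by
    rw [pw, pow_one, hXe, trace_sum, Complex.re_sum]
  have e2 : pw X 2 = ∑ i, (X * (A i ⊗ₖ B i)).trace.re := by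
    have : X ^ 2 = ∑ i, X * (A i ⊗ₖ B i) := by rw [sq, ← Matrix.mul_sum, ← hXe]
    rw [pw, this, trace_sum, Complex.re_sum]
  rw [e1, e2, Finset.mul_sum]
  exact Finset.sum_le_sum fun i _ => key i

lemma sliceMap_sub (u v : Fin n → ℂ) : sliceMap d (u - v) = sliceMap d u - sliceMap d v := by
  ext s p
  rw [Matrix.sub_apply]
  by_cases h : s = p.2 <;> simp [sliceMap, h]

lemma sliceMap_smul (x : ℂ) (u : Fin n → ℂ) : sliceMap d (x • u) = star x • sliceMap d u := by
  ext s p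
  rw [Matrix.smul_apply]
  by_cases h : s = p.2 <;> simp [sliceMap, h]

lemma norm_sliceMap_le (u : EuclideanSpace ℂ (Fin n)) : ‖sliceMap d u.ofLp‖ ≤ ‖u‖ := by
  have h := norm_sliceMap_sq_le (d := d) u.ofLp
  rw [← EuclideanSpace.norm_sq_eq] at h
  exact (sq_le_sq₀ (norm_nonneg _) (norm_nonneg _)).mp h

/-- Bounds on the slices along a net of unit vectors propagate to all slices. -/
lemma slice_le_of_net {X : Matrix (Fin n × Fin d) (Fin n × Fin d) ℂ} {h r K : ℝ}
    {F : Set (EuclideanSpace ℂ (Fin n))}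
    (hF1 : ∀ a ∈ F, ‖a‖ = 1) (hF : ∀ v : EuclideanSpace ℂ (Fin n), ‖v‖ = 1 → ∃ a ∈ F, ‖v - a‖ ≤ r)
    (ha : ∀ a ∈ F, ‖sliceMap d a.ofLp * X * (sliceMap d a.ofLp)ᴴ‖ ≤ h) (hK : ‖X‖ ≤ K)
    (u : Fin n → ℂ) :
    ‖sliceMap d u * X * (sliceMap d u)ᴴ‖ ≤ (h + 2 * r * K) * ∑ i, ‖u i‖ ^ 2 := by
  have hK0 : 0 ≤ K := (norm_nonneg _).trans hK
  have hmul : ∀ P Q : Matrix (Fin d) (Fin n × Fin d) ℂ, ‖P * X * Qᴴ‖ ≤ ‖P‖ * ‖X‖ * ‖Q‖ :=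
    fun P Q => by
      rw [← l2_opNorm_conjTranspose Q]
      exact (l2_opNorm_mul _ _).trans
        (mul_le_mul_of_nonneg_right (l2_opNorm_mul _ _) (norm_nonneg _))
  have hunit : ∀ v : EuclideanSpace ℂ (Fin n), ‖v‖ = 1 →
      ‖sliceMap d v.ofLp * X * (sliceMap d v.ofLp)ᴴ‖ ≤ h + 2 * r * K := by
    intro v hv
    obtain ⟨a, haF, hva⟩ := hF v hv
    have hr : 0 ≤ r := (norm_nonneg _).trans hva
    set A := sliceMap d a.ofLp with hA
    set V := sliceMap d v.ofLp with hV
    have e : V * X * Vᴴ = A * X * Aᴴ + ((V - A) * X * Vᴴ + A * X * (V - A)ᴴ) := by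
      rw [conjTranspose_sub, Matrix.mul_sub, Matrix.sub_mul, Matrix.sub_mul]
      abel
    have hd : ‖V - A‖ ≤ r := by
      rw [hV, hA, ← sliceMap_sub]
      exact (norm_sliceMap_le (v - a)).trans hva
    have hV1 : ‖V‖ ≤ 1 := hv ▸ norm_sliceMap_le v
    have hA1 : ‖A‖ ≤ 1 := hF1 a haF ▸ norm_sliceMap_le a
    have b1 : ‖(V - A) * X * Vᴴ‖ ≤ r * K * 1 := (hmul _ _).trans (by gcongr)
    have b2 : ‖A * X * (V - A)ᴴ‖ ≤ 1 * K * r := (hmul _ _).trans (by gcongr)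
    have b3 := ha a haF
    rw [e]
    refine (norm_add_le _ _).trans ?_
    have := norm_add_le ((V - A) * X * Vᴴ) (A * X * (V - A)ᴴ)
    linarith
  set w : EuclideanSpace ℂ (Fin n) := WithLp.toLp 2 u with hw
  have hwu : ∑ i, ‖u i‖ ^ 2 = ‖w‖ ^ 2 := (EuclideanSpace.norm_sq_eq w).symm
  rw [hwu]
  by_cases hw0 : w = 0
  · have : u = 0 := by
      have := congrArg WithLp.ofLp hw0
      simpa [hw] using this
    have hs : sliceMap d u = 0 := by
      rw [this]
      ext s p
      simp [sliceMap]
    simp [hs, hw0]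
  · have hwn : ‖w‖ ≠ 0 := norm_ne_zero_iff.mpr hw0
    set v : EuclideanSpace ℂ (Fin n) := ((‖w‖⁻¹ : ℝ) : ℂ) • w with hv
    have hv1 : ‖v‖ = 1 := by
      rw [hv, norm_smul, Complex.norm_real, norm_inv, norm_norm, inv_mul_cancel₀ hwn]
    have hu : u = ((‖w‖ : ℝ) : ℂ) • v.ofLp := by
      have : w = ((‖w‖ : ℝ) : ℂ) • v := by
        rw [hv, smul_smul, ← Complex.ofReal_mul, mul_inv_cancel₀ hwn, Complex.ofReal_one, one_smul]
      have := congrArg WithLp.ofLp this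
      simpa [hw] using this
    have hn := hunit v hv1
    rw [hu, sliceMap_smul, conjTranspose_smul, Matrix.smul_mul, Matrix.smul_mul, Matrix.mul_smul,
      smul_smul, norm_smul, star_star, norm_mul, norm_star, Complex.norm_real, norm_norm, ← sq,
      mul_comm]
    exact mul_le_mul_of_nonneg_right hn (sq_nonneg _)

end Separability

section Conclusion

open scoped Matrix.Norms.L2Operator MatrixOrder

variable {Ω : Type*} [MeasurableSpace Ω] {ℙ : Measure Ω} [IsProbabilityMeasure ℙ] {n : ℕ} {c : ℝ}
  {X : (d : ℕ) → Ω → Matrix (Fin n × Fin d) (Fin n × Fin d) ℂ}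

/-- Events which are negligible for the Wishart model are almost surely avoided by a unitarily
invariant sequence with spectra close to the Marčenko–Pastur law. -/
lemma ae_eventually_notMem_of_wishart (hn : 0 < n) (hc : 1 < c) (hmeas : ∀ d, Measurable (X d))
    (hUI : UnitInv ℙ n X) (hgood : ∀ᵐ ω ∂ℙ, ∀ k, ∀ᶠ d in atTop, Good c k (X d ω))
    {ε : ℝ} (hε : 0 < ε) (B B' : (d : ℕ) → Set (Matrix (Fin n × Fin d) (Fin n × Fin d) ℂ))
    (hB : ∀ d, MeasurableSet (B d)) (hB' : ∀ d, MeasurableSet (B' d))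
    (hBB' : ∀ d X W, ‖X - W‖ ≤ ε → X ∈ B d → W ∈ B' d) {C : ℝ}
    (hW : ∀ᶠ d : ℕ in atTop, ∀ m : ℕ, (m : ℝ) ≤ c * n * d → c * n * d ≤ m + 1 →
      (Measure.pi (fun _ : Fin m => gvec (Fin n × Fin d))).real
        {w | ((1 / (n * d : ℕ) : ℝ) : ℂ) • wish w ∈ B' d} ≤ C / (d : ℝ) ^ 2) :
    ∀ᵐ ω ∂ℙ, ∀ᶠ d in atTop, X d ω ∉ B d := by
  obtain ⟨k, hk⟩ := wishart_compare hc hε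
  have hk' := (tendsto_id.const_mul_atTop' hn).eventually hk
  simp only [id] at hk'
  have hbound : ∀ᶠ d : ℕ in atTop,
      ℙ.real (X d ⁻¹' (B d ∩ {A | Good c k A})) ≤ 2 * C * (1 / (d : ℝ) ^ 2) := by
    filter_upwards [hk', hW] with d h1 h2
    have hP : IsProbabilityMeasure (ℙ.map (X d)) :=
      Measure.isProbabilityMeasure_map (hmeas d).aemeasurable
    have hpos : 0 ≤ c * n * d := by positivity
    have hm : ((⌊c * n * d⌋₊ : ℕ) : ℝ) ≤ c * n * d := Nat.floor_le hpos
    have hm' : c * n * d ≤ (⌊c * n * d⌋₊ : ℕ) + 1 := (Nat.lt_floor_add_one _).le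
    have h3 := h1 (Fin n × Fin d) ⌊c * n * d⌋₊ (by simp) (by push_cast; linarith)
      (by push_cast; linarith) (ℙ.map (X d)) (fun U hU => by
        have hcU : Continuous fun Y : Matrix (Fin n × Fin d) (Fin n × Fin d) ℂ =>
          U * Y * star U := by fun_prop
        rw [Measure.map_map hcU.measurable (hmeas d)]
        exact hUI d U hU) (B d) (B' d) (hB d) (hB' d) (hBB' d)
    have h4 := h2 _ hm hm'
    have hG : MeasurableSet (B d ∩ {A | Good c k A}) :=
      (hB d).inter (isClosed_good c k).measurableSet
    rw [measureReal_def, Measure.map_apply (hmeas d) hG, ← measureReal_def] at h3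
    refine h3.trans ?_
    calc _ ≤ 2 * (C / (d : ℝ) ^ 2) := by gcongr
      _ = _ := by ring
  have hsum : Summable fun d => ℙ.real (X d ⁻¹' (B d ∩ {A | Good c k A})) := by
    refine Summable.of_norm_bounded_eventually_nat
      ((Real.summable_one_div_nat_pow.mpr one_lt_two).mul_left (2 * C)) ?_
    filter_upwards [hbound] with d hd
    rwa [Real.norm_of_nonneg measureReal_nonneg]
  have hBC := ae_eventually_notMem (μ := ℙ) (s := fun d => X d ⁻¹' (B d ∩ {A | Good c k A})) (by
    have := hsum.tsum_ofReal_ne_top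
    rwa [tsum_congr fun d => ofReal_measureReal] at this)
  filter_upwards [hBC, hgood] with ω h1 h2
  filter_upwards [h1, h2 k] with d h3 h4 h5
  exact h3 ⟨h5, h4⟩

lemma ae_eventually_ptrans_posSemidef (hn : 2 ≤ n) (hc : 2 < c)
    (hc' : 4 * c * n ^ 2 - 4 < c ^ 2 * n ^ 2) (hmeas : ∀ d, Measurable (X d))
    (hUI : UnitInv ℙ n X) (hgood : ∀ᵐ ω ∂ℙ, ∀ k, ∀ᶠ d in atTop, Good c k (X d ω)) :
    ∀ᵐ ω ∂ℙ, ∀ᶠ d in atTop, (ptrans (X d ω)).PosSemidef := by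
  obtain ⟨κ, C, hκ, hC, h⟩ := wishart_ptrans hn hc.le hc'
  have hn0 : (0 : ℝ) < n := by exact_mod_cast (by omega : 0 < n)
  set κ' := κ / (2 * n) with hκ'
  have hκ'0 : 0 < κ' := by positivity
  have key := ae_eventually_notMem_of_wishart (ℙ := ℙ) (X := X) (c := c) (ε := κ' / n ^ 2) (C := C)
    (by omega) (by linarith)
    hmeas hUI hgood (by positivity)
    (fun d => {Y | Y.IsHermitian} ∩ {Y | (ptrans Y).PosSemidef}ᶜ)
    (fun d => {Y | (κ' : ℂ) • 1 ≤ ptrans Y}ᶜ)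
    (fun d => (isClosed_eq (by fun_prop) continuous_id).measurableSet.inter
      (isClosed_posSemidef.preimage continuous_ptrans).measurableSet.compl)
    (fun d => by
      simp only [Matrix.le_iff]
      exact (isClosed_posSemidef.preimage
        (continuous_ptrans.sub continuous_const)).measurableSet.compl)
    (fun d Y W hYW hY hW => hY.2 (ptrans_posSemidef_of_close hY.1 hW hYW
      (by rw [mul_div_cancel₀ _ (by positivity)])))
    (by
      have hlarge : ∀ᶠ d : ℕ in atTop, 2 / κ ≤ (d : ℝ) :=
        tendsto_natCast_atTop_atTop.eventually_ge_atTop _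
      filter_upwards [hlarge, eventually_gt_atTop 0] with d hd hd0 m hm hm'
      refine (measureReal_mono (fun w hw => ?_) (measure_ne_top _ _)).trans (h d m hd0 hm hm')
      intro hcon
      apply hw
      have hd0' : (0 : ℝ) < d := by exact_mod_cast hd0
      have hr : (0 : ℝ) ≤ 1 / (n * d : ℕ) := by positivity
      have h1 := real_smul_mono hr hcon
      rw [smul_smul, ← Complex.ofReal_mul] at h1
      refine (real_smul_one_mono ?_).trans h1
      push_cast
      rw [div_le_iff₀ hκ] at hd
      rw [hκ', div_mul_eq_mul_div, one_mul, div_le_div_iff₀ (by positivity) (by positivity)]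
      nlinarith [mul_nonneg hn0.le (sub_nonneg.mpr hd)])
  filter_upwards [key, hgood] with ω h1 h2
  filter_upwards [h1, h2 0] with d h3 h4
  by_contra hcon
  exact h3 ⟨h4.1.1, hcon⟩

lemma ae_eventually_slice_le (hn : 0 < n) (hc : 1 < c) (hmeas : ∀ d, Measurable (X d))
    (hUI : UnitInv ℙ n X) (hgood : ∀ᵐ ω ∂ℙ, ∀ k, ∀ᶠ d in atTop, Good c k (X d ω))
    {η : ℝ} (hη : 0 < η) {a : Fin n → ℂ} (ha : ∑ i, ‖a i‖ ^ 2 = 1) :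
    ∀ᵐ ω ∂ℙ, ∀ᶠ d in atTop, ‖sliceMap d a * X d ω * (sliceMap d a)ᴴ‖ ≤
      (1 + √(c * n)) ^ 2 / n + η := by
  have hn0 : (0 : ℝ) < n := by exact_mod_cast hn
  set h₀ := (1 + √(c * n)) ^ 2 / n with hh₀
  have hh₀0 : 0 ≤ h₀ := by positivity
  have hslice : ∀ d, sliceMap d a * (sliceMap d a)ᴴ = 1 := fun d => by
    rw [sliceMap_mul_conjTranspose, ha]
    simp
  have hslice1 : ∀ d, ‖sliceMap d a‖ ≤ 1 := fun d => by
    have := norm_sliceMap_sq_le (d := d) a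
    rw [ha] at this
    nlinarith [norm_nonneg (sliceMap d a)]
  have hcont : ∀ d, Continuous fun Y : Matrix (Fin n × Fin d) (Fin n × Fin d) ℂ =>
      sliceMap d a * Y * (sliceMap d a)ᴴ := fun d => by fun_prop
  obtain ⟨C, hC, h⟩ := wishart_upper (ρ := c * n) (η := n * (η / 2)) (by positivity) (by positivity)
  have key := ae_eventually_notMem_of_wishart (ℙ := ℙ) (X := X) (c := c) (ε := η / 2) (C := C)
    hn hc hmeas hUI hgood (by positivity)
    (fun d => {Y | ‖sliceMap d a * Y * (sliceMap d a)ᴴ‖ ≤ h₀ + η}ᶜ)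
    (fun d => {Y | ‖sliceMap d a * Y * (sliceMap d a)ᴴ‖ ≤ h₀ + η / 2}ᶜ)
    (fun d => (isClosed_le (hcont d).norm continuous_const).measurableSet.compl)
    (fun d => (isClosed_le (hcont d).norm continuous_const).measurableSet.compl)
    (fun d Y W hYW hY hW => by
      apply hY
      have e : sliceMap d a * Y * (sliceMap d a)ᴴ = sliceMap d a * W * (sliceMap d a)ᴴ +
          sliceMap d a * (Y - W) * (sliceMap d a)ᴴ := by
        rw [Matrix.mul_sub, Matrix.sub_mul]
        abel
      have h1 : ‖sliceMap d a * (Y - W) * (sliceMap d a)ᴴ‖ ≤ η / 2 := by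
        calc _ ≤ ‖sliceMap d a‖ * ‖Y - W‖ * ‖(sliceMap d a)ᴴ‖ :=
              (l2_opNorm_mul _ _).trans
                (mul_le_mul_of_nonneg_right (l2_opNorm_mul _ _) (norm_nonneg _))
          _ ≤ 1 * (η / 2) * 1 := by
              rw [l2_opNorm_conjTranspose]
              gcongr <;> exact hslice1 d
          _ = _ := by ring
      have h2 : ‖sliceMap d a * W * (sliceMap d a)ᴴ‖ ≤ h₀ + η / 2 := hW
      change ‖sliceMap d a * Y * (sliceMap d a)ᴴ‖ ≤ h₀ + η
      rw [e]
      refine (norm_add_le _ _).trans ?_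
      linarith)
    (by
      filter_upwards [eventually_gt_atTop 0] with d hd m hm hm'
      have hd0' : (0 : ℝ) < d := by exact_mod_cast hd
      have : Nonempty (Fin d) := ⟨⟨0, hd⟩⟩
      have h1 := h (Fin d) (Fin n × Fin d) (sliceMap d a) (hslice d) m (by simpa using hm)
      rw [Fintype.card_fin] at h1
      refine (measureReal_mono (fun w hw => ?_) (measure_ne_top _ _)).trans h1
      intro hcon
      apply hw
      have hr : (0 : ℝ) ≤ 1 / (n * d : ℕ) := by positivity
      have h2 := real_smul_mono hr hcon
      rw [smul_smul, ← Complex.ofReal_mul] at h2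
      change ‖sliceMap d a * _ * (sliceMap d a)ᴴ‖ ≤ h₀ + η / 2
      rw [Matrix.mul_smul, Matrix.smul_mul]
      refine norm_le_of_le ?_ (by positivity) (h2.trans (real_smul_one_mono (le_of_eq ?_)))
      · exact (smul_posSemidef ((wish_posSemidef w).mul_mul_conjTranspose_same _) hr).nonneg
      · rw [hh₀]
        push_cast
        field_simp)
  filter_upwards [key] with ω h1
  filter_upwards [h1] with d h2
  by_contra hcon
  exact h2 hcon

lemma exists_finite_net_sphere (n : ℕ) {r : ℝ} (hr : 0 < r) :
    ∃ F : Set (EuclideanSpace ℂ (Fin n)), F.Finite ∧ (∀ a ∈ F, ‖a‖ = 1) ∧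
      ∀ v : EuclideanSpace ℂ (Fin n), ‖v‖ = 1 → ∃ a ∈ F, ‖v - a‖ ≤ r := by
  obtain ⟨F, hFs, hF, hcov⟩ :=
    (isCompact_sphere (0 : EuclideanSpace ℂ (Fin n)) 1).finite_cover_balls hr
  refine ⟨F, hF, fun a ha => by simpa using hFs ha, fun v hv => ?_⟩
  have hv' := hcov (by simpa using hv : v ∈ Metric.sphere (0 : EuclideanSpace ℂ (Fin n)) 1)
  obtain ⟨a, ha, hva⟩ := Set.mem_iUnion₂.mp hv'
  exact ⟨a, ha, by rw [← dist_eq_norm]; exact (Metric.mem_ball.mp hva).le⟩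

lemma ae_eventually_notMem_sep (hn : 0 < n) (hc : 1 < c) (hh : (1 + √(c * n)) ^ 2 / n < 1 + c)
    (hmeas : ∀ d, Measurable (X d)) (hUI : UnitInv ℙ n X)
    (hgood : ∀ᵐ ω ∂ℙ, ∀ k, ∀ᶠ d in atTop, Good c k (X d ω)) :
    ∀ᵐ ω ∂ℙ, ∀ᶠ d in atTop, X d ω ∉ SEP n d := by
  have hh₀0 : 0 ≤ (1 + √(c * n)) ^ 2 / n := by positivity
  obtain ⟨g, hg⟩ : ∃ g, g = 1 + c - (1 + √(c * n)) ^ 2 / n := ⟨_, rfl⟩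
  have hg0 : 0 < g := by linarith
  obtain ⟨K, hKe⟩ : ∃ K, K = (1 + √c) ^ 2 + 1 := ⟨_, rfl⟩
  have hK0 : 0 < K := by rw [hKe]; positivity
  obtain ⟨F, hFfin, hF1, hF⟩ := exists_finite_net_sphere n (r := g / (8 * K)) (by positivity)
  have hslice : ∀ᵐ ω ∂ℙ, ∀ a ∈ F, ∀ᶠ d in atTop,
      ‖sliceMap d a.ofLp * X d ω * (sliceMap d a.ofLp)ᴴ‖ ≤
        (1 + √(c * n)) ^ 2 / n + g / 4 := by
    rw [ae_ball_iff hFfin.countable]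
    intro a ha
    refine ae_eventually_slice_le hn hc hmeas hUI hgood (by positivity) ?_
    rw [← EuclideanSpace.norm_sq_eq, hF1 a ha, one_pow]
  obtain ⟨k, hk⟩ := exists_nat_gt ((2 + c) / (c * g / 2))
  filter_upwards [hslice, hgood] with ω hω hωg
  filter_upwards [(eventually_all_finite hFfin).mpr hω, hωg (k + 2), eventually_gt_atTop 0]
    with d hd ⟨hpsd, _, hub, hmom⟩ hd0 hsep
  obtain ⟨δ, hδe⟩ : ∃ δ : ℝ, δ = 1 / (((k + 2 : ℕ) : ℝ) + 1) := ⟨_, rfl⟩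
  rw [← hδe] at hub hmom
  have hk0 : (0 : ℝ) ≤ k := k.cast_nonneg
  have hδ0 : 0 < δ := by rw [hδe]; positivity
  have hδ1 : δ ≤ 1 := by
    rw [hδe, div_le_one (by positivity)]
    push_cast
    linarith
  have hδ : (2 + c) * δ < c * g / 2 := by
    rw [div_lt_iff₀ (by positivity)] at hk
    rw [hδe, mul_one_div, div_lt_iff₀ (by positivity)]
    push_cast
    nlinarith [mul_pos (by linarith : 0 < c) hg0]
  have hX : ‖X d ω‖ ≤ K :=
    (norm_le_of_le hpsd.nonneg (by positivity) hub).trans (by rw [hKe]; linarith)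
  have hsq := sep_trace_sq_le hsep (slice_le_of_net hF1 hF hd hX)
  have hr : 2 * (g / (8 * K)) * K = g / 4 := by field_simp; norm_num
  rw [hr] at hsq
  have hcard : (0 : ℝ) < Fintype.card (Fin n × Fin d) := by
    rw [Fintype.card_prod, Fintype.card_fin, Fintype.card_fin]
    exact_mod_cast Nat.mul_pos hn hd0
  have h1 := hmom 1 (by omega)
  have h2 := hmom 2 (by omega)
  simp only [pow_one] at h1
  rw [mp_mean hc] at h1
  rw [mp_second_moment hc] at h2
  have hdiv := div_le_div_of_nonneg_right hsq hcard.le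
  rw [mul_div_assoc] at hdiv
  have h1' := (abs_le.mp h1).2
  have h2' := (abs_le.mp h2).1
  have hhe : (1 + √(c * n)) ^ 2 / n + g / 4 + g / 4 = 1 + c - g / 2 := by rw [hg]; ring
  have hhe0 : 0 ≤ 1 + c - g / 2 := by rw [← hhe]; positivity
  rw [hhe] at hdiv
  have hm := mul_le_mul_of_nonneg_left
    (by linarith : pw (X d ω) 1 / Fintype.card (Fin n × Fin d) ≤ c + δ) hhe0
  nlinarith [mul_pos hg0 hδ0]

end Conclusion

lemma marchenkoPastur_ptrans_gap {n : ℕ} (hn : 0 < n) {c : ℝ}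
    (hc : 2 + 2 * Real.sqrt (1 - 1 / (n : ℝ) ^ 2) < c) :
    2 < c ∧ 4 * c * n ^ 2 - 4 < c ^ 2 * n ^ 2 := by
  have hn1 : (1 : ℝ) ≤ n := by exact_mod_cast hn
  have hn2 : (1 : ℝ) ≤ (n : ℝ) ^ 2 := one_le_pow₀ hn1
  have h0 : 0 ≤ 1 - 1 / (n : ℝ) ^ 2 := by
    rw [sub_nonneg, div_le_one (by positivity)]
    exact hn2
  have hs := Real.sqrt_nonneg (1 - 1 / (n : ℝ) ^ 2)
  have hsq := Real.sq_sqrt h0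
  refine ⟨by linarith, ?_⟩
  have h1 : 4 * (1 - 1 / (n : ℝ) ^ 2) < (c - 2) ^ 2 := by nlinarith
  have h2 := mul_lt_mul_of_pos_right h1 (by positivity : (0 : ℝ) < (n : ℝ) ^ 2)
  have h3 : 4 * (1 - 1 / (n : ℝ) ^ 2) * n ^ 2 = 4 * n ^ 2 - 4 := by field_simp
  rw [h3] at h2
  linarith

lemma marchenkoPastur_slice_gap {n : ℕ} (hn : 2 ≤ n) {c : ℝ}
    (hc : c < ((n : ℝ) - 1) ^ 2 / (4 * n)) (hc0 : 0 ≤ c) :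
    (1 + Real.sqrt (c * n)) ^ 2 / n < 1 + c := by
  have hn1 : (2 : ℝ) ≤ n := by exact_mod_cast hn
  rw [lt_div_iff₀ (by positivity)] at hc
  have h1 : Real.sqrt (c * n) < ((n : ℝ) - 1) / 2 := by
    rw [Real.sqrt_lt' (by linarith)]
    linarith
  have h2 := Real.sq_sqrt (by positivity : 0 ≤ c * n)
  rw [div_lt_iff₀ (by positivity)]
  linarith

/-- for `n ≥ 18` and `2 + 2√(1−1/n²) < c < (n−1)²/(4n)`, a unitarily
invariant sequence of random PSD matrices converging strongly to `MP_c` is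
asymptotically PPT and entangled. -/
theorem stmt9
    {Ω : Type*} [MeasurableSpace Ω] (ℙ : Measure Ω) [IsProbabilityMeasure ℙ]
    (n : ℕ) (hn : 18 ≤ n) (c : ℝ)
    (hc1 : 2 + 2 * Real.sqrt (1 - 1 / (n : ℝ) ^ 2) < c)
    (hc2 : c < ((n : ℝ) - 1) ^ 2 / (4 * n))
    (X : (d : ℕ) → Ω → Matrix (Fin n × Fin d) (Fin n × Fin d) ℂ)
    (hmeas : ∀ d, Measurable (X d))
    (hpsd : ∀ d ω, (X d ω).PosSemidef)
    (hUI : UnitInv ℙ n X)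
    (hconv : StrongConv ℙ n X (MP c)) :
    ∀ᵐ ω ∂ℙ, ∀ᶠ d : ℕ in atTop, X d ω ∈ PPT n d ∧ X d ω ∉ SEP n d := by
  obtain ⟨hc, hgap⟩ := marchenkoPastur_ptrans_gap (by omega) hc1
  have hgood : ∀ᵐ ω ∂ℙ, ∀ k, ∀ᶠ d in atTop, Good c k (X d ω) := by
    filter_upwards [hconv] with ω h k
    exact eventually_good (by linarith) (fun d => hpsd d ω) h k
  filter_upwards [ae_eventually_ptrans_posSemidef (by omega) hc hgap hmeas hUI hgood,
    ae_eventually_notMem_sep (by omega) (by linarith)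
      (marchenkoPastur_slice_gap (by omega) hc2 (by linarith)) hmeas hUI hgood] with ω h1 h2
  filter_upwards [h1, h2] with d h1 h2
  exact ⟨⟨hpsd d ω, h1⟩, h2⟩
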